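/- arXiv:2602.18864 — 2 statements merged into one kernel-verified Lean document; each statement's English description precedes it below -/
import Mathlib

section
/- Let m ≡ r (mod 6) with r ∈ {1, 2, 4, 5} and m ≥ 7. Then for every positive integer n with n ≡ 0 (mod 4) and n ≥ 8, there exists a 2-D ([m:r]×n,3,1)-OOC with Θ(m,r,n,3) = ((m²−r²)n − 2(m−r))/6 codewords. -/
/-- The cyclic shift of a codeword `B ⊆ I_m × Z_n` by `τ`. -/
def OOCshift {m n : ℕ} (B : Finset (Fin m × ZMod n)) (τ : ZMod n) :
    Finset (Fin m × ZMod n) :=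
  B.image fun p => (p.1, p.2 + τ)

/-- A two-dimensional `(m × n, k, lam)` optical orthogonal code: a family of
`k`-element codewords of `I_m × Z_n` with auto- and cross-correlation at most `lam`. -/
def IsOOC (m n k lam : ℕ) (C : Finset (Finset (Fin m × ZMod n))) : Prop :=
  (∀ A ∈ C, A.card = k) ∧
  (∀ A ∈ C, ∀ τ : ZMod n, τ ≠ 0 → (A ∩ OOCshift A τ).card ≤ lam) ∧
  (∀ A ∈ C, ∀ B ∈ C, A ≠ B → ∀ τ : ZMod n, (A ∩ OOCshift B τ).card ≤ lam)

/-- The multiset `Δ_{ij}(C)` of all (pure and mixed) `(i,j)`-differences of the family `C`. -/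
def Delta {m n : ℕ} (i j : Fin m) (C : Finset (Finset (Fin m × ZMod n))) :
    Multiset (ZMod n) :=
  ∑ B ∈ C, (((B ×ˢ B).filter fun p => p.1 ≠ p.2 ∧ p.1.1 = i ∧ p.2.1 = j).val.map
      fun p => p.1.2 - p.2.2)

/-- A `g`-regular 2-D `([m : r] × n, k, 1)`-OOC with hole `R × Z_n` (`r = R.card`):
for `{i,j} ⊄ R` the multiset `Δ_{ij}(C)` is exactly `Z_n \ H` (each element once), where
`H = {z : g • z = 0}` is the subgroup of order `g` of `Z_n`, and `Δ_{ij}(C) = ∅` otherwise. -/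
def IsGRegOOC {m n : ℕ} (k g : ℕ) (R : Finset (Fin m))
    (C : Finset (Finset (Fin m × ZMod n))) : Prop :=
  (∀ A ∈ C, A.card = k) ∧
  ∀ i j : Fin m, ∀ z : ZMod n,
    Multiset.count z (Delta i j C) =
      if i ∈ R ∧ j ∈ R then 0 else if g • z = 0 then 0 else 1


namespace OOC16

/-- A triple of points `(row, position)`. -/
abbrev Tr (V : Type) (n : ℕ) := (V × ZMod n) × (V × ZMod n) × (V × ZMod n)

/-- The three points of a triple. -/
def pts {V : Type} {n : ℕ} (T : Tr V n) : List (V × ZMod n) := [T.1, T.2.1, T.2.2]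

/-- The triple `T` realises the `(i,j)`-difference `z`. -/
def Hit {V : Type} {n : ℕ} (T : Tr V n) (i j : V) (z : ZMod n) : Prop :=
  ∃ p ∈ pts T, ∃ q ∈ pts T, p.1 = i ∧ q.1 = j ∧ p.2 - q.2 = z

/-- Some triple of `L` realises the `(i,j)`-difference `z`. -/
def Cov {V : Type} {n : ℕ} (L : List (Tr V n)) (i j : V) (z : ZMod n) : Prop :=
  ∃ T ∈ L, Hit T i j z

/-- Relabel the rows of a triple. -/
def Tr.mp {V W : Type} {n : ℕ} (φ : V → W) (T : Tr V n) : Tr W n :=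
  ((φ T.1.1, T.1.2), (φ T.2.1.1, T.2.1.2), (φ T.2.2.1, T.2.2.2))

section basic
variable {V W : Type} {n : ℕ}

lemma Hit.symm {T : Tr V n} {i j : V} {z : ZMod n} (h : Hit T i j z) : Hit T j i (-z) := by
  obtain ⟨p, hp, q, hq, h1, h2, h3⟩ := h
  exact ⟨q, hq, p, hp, h2, h1, by rw [← h3]; ring⟩

lemma Cov.symm {L : List (Tr V n)} {i j : V} {z : ZMod n} (h : Cov L i j z) :
    Cov L j i (-z) := by
  obtain ⟨T, hT, h⟩ := h
  exact ⟨T, hT, h.symm⟩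

lemma Cov.symm_neg {L : List (Tr V n)} {i j : V} {z : ZMod n} (h : Cov L i j (-z)) :
    Cov L j i z := by
  simpa using h.symm

lemma Cov.mono {L L' : List (Tr V n)} {i j : V} {z : ZMod n} (h : Cov L i j z)
    (hs : ∀ T ∈ L, T ∈ L') : Cov L' i j z := by
  obtain ⟨T, hT, h⟩ := h
  exact ⟨T, hs T hT, h⟩

lemma Hit.mp {T : Tr V n} {i j : V} {z : ZMod n} (φ : V → W) (h : Hit T i j z) :
    Hit (Tr.mp φ T) (φ i) (φ j) z := by
  obtain ⟨p, hp, q, hq, h1, h2, h3⟩ := h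
  refine ⟨(φ p.1, p.2), ?_, (φ q.1, q.2), ?_, by simp [h1], by simp [h2], h3⟩
  · simp only [pts, List.mem_cons, List.not_mem_nil, or_false] at hp
    rcases hp with rfl | rfl | rfl <;> simp [pts, Tr.mp]
  · simp only [pts, List.mem_cons, List.not_mem_nil, or_false] at hq
    rcases hq with rfl | rfl | rfl <;> simp [pts, Tr.mp]

lemma Cov.mp {L : List (Tr V n)} {i j : V} {z : ZMod n} (φ : V → W) (h : Cov L i j z) :
    Cov (L.map (Tr.mp φ)) (φ i) (φ j) z := by
  obtain ⟨T, hT, h⟩ := h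
  exact ⟨_, List.mem_map_of_mem hT, h.mp φ⟩

lemma Cov.flatMap {α : Type} {A : List α} {f : α → List (Tr V n)} {i j : V} {z : ZMod n}
    {x : α} (hx : x ∈ A) (h : Cov (f x) i j z) : Cov (A.flatMap f) i j z :=
  h.mono fun _ hT => List.mem_flatMap.2 ⟨x, hx, hT⟩

lemma Cov.left {L L' : List (Tr V n)} {i j : V} {z : ZMod n} (h : Cov L i j z) :
    Cov (L ++ L') i j z := h.mono fun _ hT => List.mem_append_left _ hT

lemma Cov.right {L L' : List (Tr V n)} {i j : V} {z : ZMod n} (h : Cov L' i j z) :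
    Cov (L ++ L') i j z := h.mono fun _ hT => List.mem_append_right _ hT

lemma length_flatMap_const {α β : Type} (A : List α) (f : α → List β) (c : ℕ)
    (h : ∀ x ∈ A, (f x).length ≤ c) : (A.flatMap f).length ≤ A.length * c := by
  induction A with
  | nil => simp
  | cons x A ih =>
    have h1 := h x (by simp)
    have h2 := ih fun y hy => h y (by simp [hy])
    simp only [List.flatMap_cons, List.length_append, List.length_cons]
    nlinarith

/-! ### Primitive families -/

/-- The triangle family with stride `g` and half length `h`. -/
def triL (n : ℕ) (g h : ℕ) (a b c : V) (d1 d2 : ZMod n) : List (Tr V n) :=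
  (List.range (2 * h - 1)).map fun k =>
    ((a, d1 + ((g * (k + 1) : ℕ) : ZMod n)), (b, 0),
      (c, -(d2 + ((g * (if k < h then k + h else k - h + 1) : ℕ) : ZMod n))))

lemma triL_length (g h : ℕ) (a b c : V) (d1 d2 : ZMod n) :
    (triL n g h a b c d1 d2).length = 2 * h - 1 := by simp [triL]

lemma triL_ab (g h : ℕ) (a b c : V) (d1 d2 : ZMod n) (k : ℕ) (h1 : 1 ≤ k) (h2 : k < 2 * h) :
    Cov (triL n g h a b c d1 d2) a b (d1 + ((g * k : ℕ) : ZMod n)) := by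
  obtain ⟨k, rfl⟩ : ∃ l, k = l + 1 := ⟨k - 1, by omega⟩
  refine ⟨_, List.mem_map_of_mem (a := k) (List.mem_range.2 (by omega)), ?_⟩
  refine ⟨_, List.mem_cons_self, _, List.mem_cons_of_mem _ List.mem_cons_self, rfl, rfl, ?_⟩
  simp

lemma triL_bc (g h : ℕ) (a b c : V) (d1 d2 : ZMod n) (k : ℕ) (h1 : 1 ≤ k) (h2 : k < 2 * h) :
    Cov (triL n g h a b c d1 d2) b c (d2 + ((g * k : ℕ) : ZMod n)) := by
  by_cases hk : h ≤ k
  · refine ⟨_, List.mem_map_of_mem (a := k - h) (List.mem_range.2 (by omega)), ?_⟩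
    refine ⟨_, List.mem_cons_of_mem _ List.mem_cons_self,
      _, List.mem_cons_of_mem _ (List.mem_cons_of_mem _ List.mem_cons_self), rfl, rfl, ?_⟩
    rw [if_pos (by omega), show k - h + h = k by omega]
    simp
  · refine ⟨_, List.mem_map_of_mem (a := k - 1 + h) (List.mem_range.2 (by omega)), ?_⟩
    refine ⟨_, List.mem_cons_of_mem _ List.mem_cons_self,
      _, List.mem_cons_of_mem _ (List.mem_cons_of_mem _ List.mem_cons_self), rfl, rfl, ?_⟩
    rw [if_neg (by omega), show k - 1 + h - h + 1 = k by omega]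
    simp

lemma triL_ac (g h : ℕ) (a b c : V) (d1 d2 : ZMod n) (k : ℕ) (h1 : 1 ≤ k) (h2 : k < 2 * h) :
    Cov (triL n g h a b c d1 d2) a c
      (d1 + d2 + ((g * h : ℕ) : ZMod n) + ((g * k : ℕ) : ZMod n)) := by
  rcases Nat.even_or_odd' k with ⟨l, rfl | rfl⟩
  · refine ⟨_, List.mem_map_of_mem (a := l - 1 + h) (List.mem_range.2 (by omega)), ?_⟩
    refine ⟨_, List.mem_cons_self,
      _, List.mem_cons_of_mem _ (List.mem_cons_of_mem _ List.mem_cons_self), rfl, rfl, ?_⟩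
    rw [if_neg (by omega), show l - 1 + h - h + 1 = l by omega,
      show l - 1 + h + 1 = l + h by omega]
    push_cast
    ring
  · refine ⟨_, List.mem_map_of_mem (a := l) (List.mem_range.2 (by omega)), ?_⟩
    refine ⟨_, List.mem_cons_self,
      _, List.mem_cons_of_mem _ (List.mem_cons_of_mem _ List.mem_cons_self), rfl, rfl, ?_⟩
    rw [if_pos (by omega)]
    push_cast
    ring

/-- A single triple. -/
def sing (n : ℕ) (a b c : V) (d1 d2 : ZMod n) : Tr V n := ((a, d1), (b, 0), (c, -d2))

lemma sing_ab (a b c : V) (d1 d2 : ZMod n) : Hit (sing n a b c d1 d2) a b d1 :=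
  ⟨_, List.mem_cons_self, _, List.mem_cons_of_mem _ List.mem_cons_self, rfl, rfl, by simp [sing]⟩

lemma sing_bc (a b c : V) (d1 d2 : ZMod n) : Hit (sing n a b c d1 d2) b c d2 :=
  ⟨_, List.mem_cons_of_mem _ List.mem_cons_self, _,
    List.mem_cons_of_mem _ (List.mem_cons_of_mem _ List.mem_cons_self), rfl, rfl, by simp [sing]⟩

lemma sing_ac (a b c : V) (d1 d2 : ZMod n) : Hit (sing n a b c d1 d2) a c (d1 + d2) :=
  ⟨_, List.mem_cons_self, _,
    List.mem_cons_of_mem _ (List.mem_cons_of_mem _ List.mem_cons_self), rfl, rfl, by simp [sing]⟩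

/-- The family producing pure differences on row `a`. -/
def specL (t : ℕ) (a b : V) (p : ZMod (4 * t)) : List (Tr V (4 * t)) :=
  ((List.range t).map fun k =>
    ((a, p + t + ((1 + k : ℕ) : ZMod (4 * t))), (a, p + t + ((2 * t - k : ℕ) : ZMod (4 * t))),
      (b, 0))) ++
  ((List.range (t - 1)).map fun k =>
    ((a, p + t + ((2 * t + 1 + k : ℕ) : ZMod (4 * t))),
      (a, p + t + ((4 * t - 1 - k : ℕ) : ZMod (4 * t))), (b, 0)))

lemma specL_length (t : ℕ) (ht : 1 ≤ t) (a b : V) (p : ZMod (4 * t)) :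
    (specL t a b p).length = 2 * t - 1 := by
  simp [specL]; omega

lemma specL_pure (t : ℕ) (a b : V) (p : ZMod (4 * t)) (k : ℕ) (h1 : 1 ≤ k) (h2 : k < 2 * t) :
    Cov (specL t a b p) a a (k : ZMod (4 * t)) := by
  rcases Nat.even_or_odd' k with ⟨l, rfl | rfl⟩
  · apply Cov.right
    refine ⟨_, List.mem_map_of_mem (a := t - 1 - l) (List.mem_range.2 (by omega)), ?_⟩
    refine ⟨_, List.mem_cons_of_mem _ List.mem_cons_self, _, List.mem_cons_self, rfl, rfl, ?_⟩
    rw [show 4 * t - 1 - (t - 1 - l) = (2 * t + 1 + (t - 1 - l)) + 2 * l by omega]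
    push_cast
    ring
  · apply Cov.left
    refine ⟨_, List.mem_map_of_mem (a := t - 1 - l) (List.mem_range.2 (by omega)), ?_⟩
    refine ⟨_, List.mem_cons_of_mem _ List.mem_cons_self, _, List.mem_cons_self, rfl, rfl, ?_⟩
    rw [show 2 * t - (t - 1 - l) = (1 + (t - 1 - l)) + (2 * l + 1) by omega]
    push_cast
    ring

lemma specL_mixed (t : ℕ) (ht : 1 ≤ t) (a b : V) (p z : ZMod (4 * t)) (h1 : z ≠ p)
    (h2 : z ≠ p + t) : Cov (specL t a b p) a b z := by
  have : NeZero (4 * t) := ⟨by omega⟩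
  obtain ⟨k, hk, rfl⟩ : ∃ k : ℕ, k < 4 * t ∧ z = p + t + (k : ZMod (4 * t)) :=
    ⟨(z - (p + t)).val, ZMod.val_lt _, by rw [ZMod.natCast_zmod_val]; ring⟩
  have hk0 : k ≠ 0 := by
    rintro rfl
    simp at h2
  have hk3 : k ≠ 3 * t := by
    rintro rfl
    apply h1
    have : ((4 * t : ℕ) : ZMod (4 * t)) = 0 := ZMod.natCast_self _
    push_cast at this ⊢
    linear_combination this
  by_cases c1 : k ≤ t
  · apply Cov.left
    refine ⟨_, List.mem_map_of_mem (a := k - 1) (List.mem_range.2 (by omega)), ?_⟩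
    refine ⟨_, List.mem_cons_self, _,
      List.mem_cons_of_mem _ (List.mem_cons_of_mem _ List.mem_cons_self), rfl, rfl, ?_⟩
    rw [show 1 + (k - 1) = k by omega]
    simp
  by_cases c2 : k ≤ 2 * t
  · apply Cov.left
    refine ⟨_, List.mem_map_of_mem (a := 2 * t - k) (List.mem_range.2 (by omega)), ?_⟩
    refine ⟨_, List.mem_cons_of_mem _ List.mem_cons_self, _,
      List.mem_cons_of_mem _ (List.mem_cons_of_mem _ List.mem_cons_self), rfl, rfl, ?_⟩
    rw [show 2 * t - (2 * t - k) = k by omega]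
    simp
  by_cases c3 : k < 3 * t
  · apply Cov.right
    refine ⟨_, List.mem_map_of_mem (a := k - (2 * t + 1)) (List.mem_range.2 (by omega)), ?_⟩
    refine ⟨_, List.mem_cons_self, _,
      List.mem_cons_of_mem _ (List.mem_cons_of_mem _ List.mem_cons_self), rfl, rfl, ?_⟩
    rw [show 2 * t + 1 + (k - (2 * t + 1)) = k by omega]
    simp
  · apply Cov.right
    refine ⟨_, List.mem_map_of_mem (a := 4 * t - 1 - k) (List.mem_range.2 (by omega)), ?_⟩
    refine ⟨_, List.mem_cons_of_mem _ List.mem_cons_self, _,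
      List.mem_cons_of_mem _ (List.mem_cons_of_mem _ List.mem_cons_self), rfl, rfl, ?_⟩
    rw [show 4 * t - 1 - (4 * t - 1 - k) = k by omega]
    simp

end basic

/-! ### Descriptors: finite data describing a covering family uniformly in `t` -/

/-- `(a, b, c, d_ab, d_bc)`, where `(α, β)` stands for `α * t + β`. -/
abbrev TT := ℕ × ℕ × ℕ × (ℕ × ℕ) × (ℕ × ℕ)

/-- A descriptor. -/
structure Desc where
  /-- full triangles -/
  tri : List TT
  /-- half triangles -/
  half : List TT
  /-- families producing pure differences -/
  spec : List (ℕ × ℕ × (ℕ × ℕ))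
  /-- single triples -/
  sg : List TT

/-- The value `α * t + β`. -/
def ev (t : ℕ) (d : ℕ × ℕ) : ZMod (4 * t) := (d.1 : ZMod (4 * t)) * (t : ZMod (4 * t)) + d.2

/-- A version of `List.any` that reduces quickly in the kernel. -/
noncomputable def anyR {α : Type} (p : α → Bool) (l : List α) : Bool :=
  List.rec (motive := fun _ => Bool) false
    (fun x _ ih => Bool.rec (motive := fun _ => Bool) ih true (p x)) l

lemma anyR_eq {α : Type} (p : α → Bool) (l : List α) : anyR p l = l.any p := by
  induction l with
  | nil => rfl
  | cons x l ih =>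
    have : anyR p (x :: l) = Bool.rec (motive := fun _ => Bool) (anyR p l) true (p x) := rfl
    rw [this, ih, List.any_cons]
    cases p x <;> rfl

/-- Cheap test whether the row `a` can be the first row of an edge of `x`. -/
noncomputable def pre (a : ℕ) (x : TT) (q : Bool) : Bool :=
  Bool.rec (motive := fun _ => Bool)
    (Bool.rec (motive := fun _ => Bool) false q (Nat.beq x.2.1 a)) q (Nat.beq x.1 a)

lemma pre_true {a : ℕ} {x : TT} {q : Bool} (h : pre a x q = true) : q = true := by
  unfold pre at h
  cases h1 : Nat.beq x.1 a <;> cases h2 : Nat.beq x.2.1 a <;> rw [h1] at h <;>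
    first | exact h | (rw [h2] at h; first | exact h | exact absurd h (by simp))

/-- Leftovers of a triangle. -/
def triE (x : TT) : List (ℕ × ℕ × (ℕ × ℕ)) :=
  [(x.1, x.2.1, x.2.2.2.1), (x.2.1, x.2.2.1, x.2.2.2.2),
    (x.1, x.2.2.1, (x.2.2.2.1.1 + x.2.2.2.2.1 + 2, x.2.2.2.1.2 + x.2.2.2.2.2))]

/-- Differences of a single triple. -/
def sgE (x : TT) : List (ℕ × ℕ × (ℕ × ℕ)) :=
  [(x.1, x.2.1, x.2.2.2.1), (x.2.1, x.2.2.1, x.2.2.2.2),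
    (x.1, x.2.2.1, (x.2.2.2.1.1 + x.2.2.2.2.1, x.2.2.2.1.2 + x.2.2.2.2.2))]

/-- The entry `e` belongs to the edge `(a,b)`. -/
def onE (a b : ℕ) (e : ℕ × ℕ × (ℕ × ℕ)) : Bool := Nat.beq e.1 a && Nat.beq e.2.1 b

/-- The difference `d` on `(a,b)` is produced by a single triple. -/
noncomputable def hasS (D : Desc) (a b : ℕ) (d : ℕ × ℕ) : Bool :=
  anyR (l := D.sg) fun x => pre a x <| (sgE x).any fun e =>
    onE a b e && (Nat.beq (e.2.2.1 % 4) (d.1 % 4) && Nat.beq e.2.2.2 d.2)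

/-- Edge `(a,b)` covered by a full triangle. -/
noncomputable def okTri (D : Desc) (a b : ℕ) : Bool :=
  anyR (l := D.tri) fun x => pre a x <| (triE x).any fun e => onE a b e && hasS D a b e.2.2

/-- Edge `(a,b)` covered by a pure family. -/
noncomputable def okSpec (D : Desc) (a b : ℕ) : Bool :=
  D.spec.any fun e => (onE a b e || onE b a e) && hasS D a b e.2.2 &&
    hasS D a b (e.2.2.1 + 1, e.2.2.2)

/-- Edge `(a,b)` covered by a half triangle of parity `ε`. -/
noncomputable def okHalf (D : Desc) (a b ε : ℕ) : Bool :=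
  anyR (l := D.half) fun x => pre a x <| (triE x).any fun e => onE a b e && hasS D a b e.2.2 &&
    (Nat.beq (e.2.2.1 % 2) 0 && Nat.beq (e.2.2.2 % 2) ε)

/-- Edge `(a,b)` is covered. -/
noncomputable def okE (D : Desc) (a b : ℕ) : Bool :=
  okTri D a b || okSpec D a b || (okHalf D a b 0 && okHalf D a b 1)

/-- Row `a` gets pure differences. -/
def okP (D : Desc) (a : ℕ) : Bool := D.spec.any fun e => Nat.beq e.1 a

/-- The family of triples described by `D`. -/
def Desc.list (D : Desc) (t : ℕ) : List (Tr ℕ (4 * t)) :=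
  (D.tri.flatMap fun x =>
    triL (4 * t) 1 (2 * t) x.1 x.2.1 x.2.2.1 (ev t x.2.2.2.1) (ev t x.2.2.2.2)) ++
  ((D.half.flatMap fun x =>
    triL (4 * t) 2 t x.1 x.2.1 x.2.2.1 (ev t x.2.2.2.1) (ev t x.2.2.2.2)) ++
  ((D.spec.flatMap fun x =>
    specL t x.1 x.2.1 (if x.1 < x.2.1 then ev t x.2.2 else -ev t x.2.2 - t)) ++
  D.sg.map fun x =>
    sing (4 * t) x.1 x.2.1 x.2.2.1 (ev t x.2.2.2.1) (ev t x.2.2.2.2)))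

lemma four_t (t : ℕ) : (4 : ZMod (4 * t)) * (t : ZMod (4 * t)) = 0 := by
  have : ((4 * t : ℕ) : ZMod (4 * t)) = 0 := ZMod.natCast_self _
  push_cast at this
  exact this

lemma ev_congr (t : ℕ) (d e : ℕ × ℕ) (h1 : d.1 % 4 = e.1 % 4) (h2 : d.2 = e.2) :
    ev t d = ev t e := by
  have key : ∀ a : ℕ, (a : ZMod (4 * t)) * (t : ZMod (4 * t)) = ((a % 4 : ℕ) : ZMod (4 * t)) * t := by
    intro a
    conv_lhs => rw [← Nat.mod_add_div a 4]
    push_cast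
    linear_combination ((a / 4 : ℕ) : ZMod (4 * t)) * four_t t
  unfold ev
  rw [key d.1, key e.1, h1, h2]

lemma onE_iff {a b : ℕ} {e : ℕ × ℕ × (ℕ × ℕ)} (h : onE a b e = true) : e.1 = a ∧ e.2.1 = b := by
  simpa [onE] using h

lemma hasS_sound {D : Desc} {a b : ℕ} {d : ℕ × ℕ} (h : hasS D a b d = true) (t : ℕ) :
    Cov (D.list t) a b (ev t d) := by
  simp only [hasS, anyR_eq, List.any_eq_true] at h
  obtain ⟨x, hx, h⟩ := h
  have h := pre_true h
  simp only [List.any_eq_true, Bool.and_eq_true, Nat.beq_eq] at h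
  obtain ⟨e, he, h1, h2, h3⟩ := h
  obtain ⟨rfl, rfl⟩ := onE_iff h1
  rw [← ev_congr t e.2.2 d h2 h3]
  refine Cov.right (Cov.right (Cov.right ⟨_, List.mem_map_of_mem hx, ?_⟩))
  simp only [sgE, List.mem_cons, List.not_mem_nil, or_false] at he
  rcases he with rfl | rfl | rfl
  · exact sing_ab _ _ _ _ _
  · exact sing_bc _ _ _ _ _
  · convert sing_ac _ _ _ _ _ using 1
    simp only [ev]
    push_cast
    ring

/-- Every leftover-complement of a triangle is covered. -/
lemma triE_sound (t g h : ℕ) (hgh : g * h = 2 * t) (x : TT) (e : ℕ × ℕ × (ℕ × ℕ))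
    (he : e ∈ triE x) (k : ℕ) (h1 : 1 ≤ k) (h2 : k < 2 * h) :
    Cov (triL (4 * t) g h x.1 x.2.1 x.2.2.1 (ev t x.2.2.2.1) (ev t x.2.2.2.2)) e.1 e.2.1
      (ev t e.2.2 + ((g * k : ℕ) : ZMod (4 * t))) := by
  simp only [triE, List.mem_cons, List.not_mem_nil, or_false] at he
  rcases he with rfl | rfl | rfl
  · exact triL_ab _ _ _ _ _ _ _ _ h1 h2
  · exact triL_bc _ _ _ _ _ _ _ _ h1 h2
  · convert triL_ac g h x.1 x.2.1 x.2.2.1 (ev t x.2.2.2.1) (ev t x.2.2.2.2) k h1 h2 using 2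
    rw [hgh]
    simp only [ev]
    push_cast
    ring

lemma okTri_sound {D : Desc} {a b : ℕ} (h : okTri D a b = true) (t : ℕ) (ht : 1 ≤ t)
    (z : ZMod (4 * t)) : Cov (D.list t) a b z := by
  have : NeZero (4 * t) := ⟨by omega⟩
  simp only [okTri, anyR_eq, List.any_eq_true] at h
  obtain ⟨x, hx, h⟩ := h
  have h := pre_true h
  simp only [List.any_eq_true, Bool.and_eq_true] at h
  obtain ⟨e, he, h1, h2⟩ := h
  obtain ⟨rfl, rfl⟩ := onE_iff h1
  obtain ⟨k, hk, rfl⟩ : ∃ k : ℕ, k < 4 * t ∧ z = ev t e.2.2 + (k : ZMod (4 * t)) :=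
    ⟨(z - ev t e.2.2).val, ZMod.val_lt _, by rw [ZMod.natCast_zmod_val]; ring⟩
  rcases Nat.eq_zero_or_pos k with rfl | hk0
  · simpa using hasS_sound h2 t
  · refine Cov.left (Cov.flatMap hx ?_)
    have := triE_sound t 1 (2 * t) (by ring) x e he k hk0 (by omega)
    simpa using this

lemma okHalf_sound {D : Desc} {a b ε : ℕ} (h : okHalf D a b ε = true) (t : ℕ) (ht : 1 ≤ t)
    (z : ZMod (4 * t)) (hz : z.val % 2 = ε) : Cov (D.list t) a b z := by
  have : NeZero (4 * t) := ⟨by omega⟩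
  simp only [okHalf, anyR_eq, List.any_eq_true] at h
  obtain ⟨x, hx, h⟩ := h
  have h := pre_true h
  simp only [List.any_eq_true, Bool.and_eq_true, Nat.beq_eq] at h
  obtain ⟨e, he, ⟨h1, h2⟩, h3, h4⟩ := h
  obtain ⟨rfl, rfl⟩ := onE_iff h1
  obtain ⟨k, hk, rfl⟩ : ∃ k : ℕ, k < 4 * t ∧ z = ev t e.2.2 + (k : ZMod (4 * t)) :=
    ⟨(z - ev t e.2.2).val, ZMod.val_lt _, by rw [ZMod.natCast_zmod_val]; ring⟩
  have hk2 : k % 2 = 0 := by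
    have e1 : ev t e.2.2 + (k : ZMod (4 * t)) = ((e.2.2.1 * t + e.2.2.2 + k : ℕ) : ZMod (4 * t)) := by
      simp [ev]
    rw [e1, ZMod.val_natCast, Nat.mod_mod_of_dvd _ (Dvd.intro (2 * t) (by ring))] at hz
    have e2 : e.2.2.1 * t % 2 = 0 := by rw [Nat.mul_mod, h3]; simp
    omega
  obtain ⟨l, rfl⟩ : ∃ l, k = 2 * l := ⟨k / 2, by omega⟩
  rcases Nat.eq_zero_or_pos l with rfl | hl0
  · simpa using hasS_sound h2 t
  · refine Cov.right (Cov.left (Cov.flatMap hx ?_))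
    exact triE_sound t 2 t (by ring) x e he l hl0 (by omega)

lemma okSpec_sound {D : Desc} {a b : ℕ} (h : okSpec D a b = true) (hab : a < b)
    (t : ℕ) (ht : 1 ≤ t) (z : ZMod (4 * t)) : Cov (D.list t) a b z := by
  simp only [okSpec, List.any_eq_true, Bool.and_eq_true, Bool.or_eq_true] at h
  obtain ⟨e, he, ⟨h1, h2⟩, h3⟩ := h
  have h3' : Cov (D.list t) a b (ev t e.2.2 + t) := by
    convert hasS_sound h3 t using 1
    simp only [ev]
    push_cast
    ring
  by_cases c1 : z = ev t e.2.2
  · rw [c1]; exact hasS_sound h2 t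
  by_cases c2 : z = ev t e.2.2 + t
  · rw [c2]; exact h3'
  refine Cov.right (Cov.right (Cov.left (Cov.flatMap he ?_)))
  rcases h1 with h1 | h1
  · obtain ⟨rfl, rfl⟩ := onE_iff h1
    rw [if_pos hab]
    exact specL_mixed t ht _ _ _ _ c1 c2
  · obtain ⟨rfl, rfl⟩ := onE_iff h1
    rw [if_neg (by omega)]
    apply Cov.symm_neg
    apply specL_mixed t ht
    · intro h
      apply c2
      linear_combination -h
    · intro h
      apply c1
      linear_combination -h

lemma okE_sound {D : Desc} {a b : ℕ} (h : okE D a b = true) (hab : a < b)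
    (t : ℕ) (ht : 1 ≤ t) (z : ZMod (4 * t)) : Cov (D.list t) a b z := by
  simp only [okE, Bool.or_eq_true, Bool.and_eq_true] at h
  rcases h with (h | h) | ⟨h, h'⟩
  · exact okTri_sound h t ht z
  · exact okSpec_sound h hab t ht z
  · rcases Nat.mod_two_eq_zero_or_one z.val with hz | hz
    · exact okHalf_sound h t ht z hz
    · exact okHalf_sound h' t ht z hz

lemma okP_sound {D : Desc} {a : ℕ} (h : okP D a = true) (t : ℕ) (k : ℕ)
    (h1 : 1 ≤ k) (h2 : k < 2 * t) : Cov (D.list t) a a (k : ZMod (4 * t)) := by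
  simp only [okP, List.any_eq_true, Nat.beq_eq] at h
  obtain ⟨e, he, rfl⟩ := h
  exact Cov.right (Cov.right (Cov.left (Cov.flatMap he (specL_pure t _ _ _ k h1 h2))))

lemma Desc.length_le (D : Desc) (t : ℕ) (ht : 1 ≤ t) : (D.list t).length ≤
    D.tri.length * (4 * t - 1) + (D.half.length * (2 * t - 1) +
      (D.spec.length * (2 * t - 1) + D.sg.length)) := by
  unfold Desc.list
  simp only [List.length_append, List.length_map]
  refine Nat.add_le_add ?_ (Nat.add_le_add ?_ (Nat.add_le_add ?_ le_rfl))
  · exact length_flatMap_const _ _ _ fun x _ => by rw [triL_length]; omega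
  · exact length_flatMap_const _ _ _ fun x _ => by rw [triL_length]
  · exact length_flatMap_const _ _ _ fun x _ => by rw [specL_length t ht]

/-! ### The octahedron -/

/-- The octahedron on the pairs of rows `{0,1}`, `{2,3}`, `{4,5}`. -/
def octD : Desc where
  tri := [(0, 2, 4, (2, 0), (0, 0)), (0, 3, 5, (0, 0), (2, 0)), (1, 2, 5, (0, 0), (2, 0)),
    (1, 3, 4, (2, 0), (0, 0))]
  half := []
  spec := []
  sg := [(0, 2, 5, (2, 0), (2, 0)), (0, 3, 4, (0, 0), (0, 0)), (1, 2, 4, (0, 0), (0, 0)),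
    (1, 3, 5, (2, 0), (2, 0))]

/-- Row map of the octahedron. -/
def octR {W : Type} (A B C : Fin 2 → W) (i : ℕ) : W :=
  if i = 0 then A 0 else if i = 1 then A 1 else if i = 2 then B 0 else if i = 3 then B 1
  else if i = 4 then C 0 else C 1

/-- Octahedron with arbitrary rows. -/
def octL {W : Type} (t : ℕ) (A B C : Fin 2 → W) : List (Tr W (4 * t)) :=
  (octD.list t).map (Tr.mp (octR A B C))

lemma octL_length {W : Type} (t : ℕ) (ht : 1 ≤ t) (A B C : Fin 2 → W) :
    (octL t A B C).length ≤ 16 * t := by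
  have := octD.length_le t ht
  simp only [octL, List.length_map]
  refine this.trans ?_
  simp [octD]
  omega

lemma octL_AB {W : Type} (t : ℕ) (ht : 1 ≤ t) (A B C : Fin 2 → W) (i j : Fin 2)
    (z : ZMod (4 * t)) : Cov (octL t A B C) (A i) (B j) z := by
  have h : okE octD i.val (2 + j.val) = true := by revert i j; decide +kernel
  have := (okE_sound h (by omega) t ht z).mp (octR A B C)
  fin_cases i <;> fin_cases j <;> exact this

lemma octL_BC {W : Type} (t : ℕ) (ht : 1 ≤ t) (A B C : Fin 2 → W) (i j : Fin 2)
    (z : ZMod (4 * t)) : Cov (octL t A B C) (B i) (C j) z := by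
  have h : okE octD (2 + i.val) (4 + j.val) = true := by revert i j; decide +kernel
  have := (okE_sound h (by omega) t ht z).mp (octR A B C)
  fin_cases i <;> fin_cases j <;> exact this

lemma octL_AC {W : Type} (t : ℕ) (ht : 1 ≤ t) (A B C : Fin 2 → W) (i j : Fin 2)
    (z : ZMod (4 * t)) : Cov (octL t A B C) (A i) (C j) z := by
  have h : okE octD i.val (4 + j.val) = true := by revert i j; decide +kernel
  have := (okE_sound h (by omega) t ht z).mp (octR A B C)
  fin_cases i <;> fin_cases j <;> exact this

/-! ### The recursive object -/

/-- A covering family on the rows `V` together with a hole of `r` rows. -/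
def HasP (V : Type) (r t N : ℕ) : Prop :=
  ∃ L : List (Tr (V ⊕ Fin r) (4 * t)), L.length ≤ N ∧
    (∀ a b : V, a ≠ b → ∀ z, Cov L (Sum.inl a) (Sum.inl b) z) ∧
    (∀ (a : V) (h : Fin r), ∀ z, Cov L (Sum.inl a) (Sum.inr h) z) ∧
    (∀ (a : V) (k : ℕ), 1 ≤ k → k < 2 * t → Cov L (Sum.inl a) (Sum.inl a) (k : ZMod (4 * t)))

lemma HasP.equiv {V W : Type} {r t N : ℕ} (e : V ≃ W) (h : HasP V r t N) : HasP W r t N := by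
  obtain ⟨L, h0, h1, h2, h3⟩ := h
  refine ⟨L.map (Tr.mp (Sum.map e id)), by simpa using h0, ?_, ?_, ?_⟩
  · intro a b hab z
    have := (h1 (e.symm a) (e.symm b) (by simpa using hab) z).mp (Sum.map e id)
    simpa using this
  · intro a x z
    have := (h2 (e.symm a) x z).mp (Sum.map e id)
    simpa using this
  · intro a k hk hk'
    have := (h3 (e.symm a) k hk hk').mp (Sum.map e id)
    simpa using this

lemma HasP.card {V W : Type} [Fintype V] [Fintype W] {r t N N' : ℕ}
    (e : Fintype.card V = Fintype.card W) (hN : N ≤ N') (h : HasP V r t N) : HasP W r t N' := by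
  obtain ⟨L, h0, h1⟩ := h.equiv (Fintype.equivOfCardEq e)
  exact ⟨L, h0.trans hN, h1⟩

/-- The target number of codewords. -/
def NN (s r t : ℕ) : ℕ := s * (24 * s * t + 8 * r * t) - 2 * s

/-- The row part of an octahedron in the inflation. -/
def rowI {G Y U : Type} {r : ℕ} (x : G × Y) (a : U) (ε : Fin 2) :
    (G × Y × U × Fin 2) ⊕ Fin r := Sum.inl (x.1, x.2, a, ε)

/-- Inflation of a master family. -/
lemma inflate {G Y U : Type} [Fintype G] [Fintype U] [AddCommGroup U]
    (M : List ((G × Y) × (G × Y) × (G × Y)))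
    (hM : ∀ x y : G × Y, x.1 ≠ y.1 → ∃ T ∈ M, x ∈ [T.1, T.2.1, T.2.2] ∧ y ∈ [T.1, T.2.1, T.2.2])
    (r t N : ℕ) (ht : 1 ≤ t) (hP : HasP (Y × U × Fin 2) r t N) :
    HasP (G × Y × U × Fin 2) r t
      (M.length * (Fintype.card U * (Fintype.card U * (16 * t))) + Fintype.card G * N) := by
  obtain ⟨L, h0, h1, h2, h3⟩ := hP
  refine ⟨(M.flatMap fun T => (Finset.univ : Finset U).toList.flatMap fun a =>
      (Finset.univ : Finset U).toList.flatMap fun b =>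
        octL t (rowI T.1 a) (rowI T.2.1 b) (rowI T.2.2 (a + b))) ++
      (Finset.univ : Finset G).toList.flatMap fun g =>
        L.map (Tr.mp (Sum.map (fun v => (g, v)) id)), ?_, ?_, ?_, ?_⟩
  · rw [List.length_append]
    refine Nat.add_le_add ?_ ?_
    · refine length_flatMap_const _ _ _ fun T _ => ?_
      refine (length_flatMap_const _ _ (Fintype.card U * (16 * t)) fun a _ => ?_).trans ?_
      · refine (length_flatMap_const _ _ (16 * t) fun b _ => octL_length t ht _ _ _).trans ?_
        simp
      · simp
    · refine (length_flatMap_const _ _ N fun a _ => ?_).trans ?_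
      · simpa using h0
      · simp
  · rintro ⟨g, y, a, ε⟩ ⟨g', y', b, ε'⟩ hne z
    by_cases hg : g = g'
    · subst hg
      refine Cov.right (Cov.flatMap (x := g) (by simp) ?_)
      exact (h1 (y, a, ε) (y', b, ε') (by intro h; exact hne (by rw [h])) z).mp
        (Sum.map (fun v => (g, v)) id)
    · apply Cov.left
      obtain ⟨⟨T1, T2, T3⟩, hT, hx, hy⟩ := hM (g, y) (g', y') hg
      simp only [List.mem_cons, List.not_mem_nil, or_false] at hx hy
      refine Cov.flatMap hT ?_
      have fin : ∀ (u v : U), Cov (octL t (rowI T1 u) (rowI T2 v) (rowI T3 (u + v)))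
          (Sum.inl (g, y, a, ε) : (G × Y × U × Fin 2) ⊕ Fin r) (Sum.inl (g', y', b, ε')) z →
          Cov ((Finset.univ : Finset U).toList.flatMap fun a =>
            (Finset.univ : Finset U).toList.flatMap fun b =>
            octL t (rowI T1 a) (rowI T2 b) (rowI T3 (a + b)))
            (Sum.inl (g, y, a, ε) : (G × Y × U × Fin 2) ⊕ Fin r) (Sum.inl (g', y', b, ε')) z :=
        fun u v h => Cov.flatMap (x := u) (by simp) (Cov.flatMap (x := v) (by simp) h)
      rcases hx with rfl | rfl | rfl <;> rcases hy with hy | hy | hy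
      · exact absurd (congrArg Prod.fst hy).symm hg
      · subst hy
        exact fin a b (octL_AB t ht _ _ _ ε ε' z)
      · subst hy
        refine fin a (b - a) ?_
        rw [show a + (b - a) = b by abel]
        exact octL_AC t ht _ _ _ ε ε' z
      · subst hy
        refine fin b a ?_
        exact (octL_AB t ht _ _ _ ε' ε (-z)).symm_neg
      · exact absurd (congrArg Prod.fst hy).symm hg
      · subst hy
        refine fin (b - a) a ?_
        rw [show (b - a) + a = b by abel]
        exact octL_BC t ht _ _ _ ε ε' z
      · subst hy
        refine fin b (a - b) ?_
        rw [show b + (a - b) = a by abel]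
        exact (octL_AC t ht _ _ _ ε' ε (-z)).symm_neg
      · subst hy
        refine fin (a - b) b ?_
        rw [show (a - b) + b = a by abel]
        exact (octL_BC t ht _ _ _ ε' ε (-z)).symm_neg
      · exact absurd (congrArg Prod.fst hy).symm hg
  · rintro ⟨g, y, a, ε⟩ h z
    refine Cov.right (Cov.flatMap (x := g) (by simp) ?_)
    exact (h2 (y, a, ε) h z).mp (Sum.map (fun v => (g, v)) id)
  · rintro ⟨g, y, a, ε⟩ k hk hk'
    refine Cov.right (Cov.flatMap (x := g) (by simp) ?_)
    exact (h3 (y, a, ε) k hk hk').mp (Sum.map (fun v => (g, v)) id)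

/-- Master family of eight triples on four groups of size two. -/
def M4 : List ((Fin 4 × Fin 2) × (Fin 4 × Fin 2) × (Fin 4 × Fin 2)) :=
  [((0, 0), (1, 0), (2, 1)), ((0, 0), (1, 1), (3, 1)), ((0, 0), (2, 0), (3, 0)),
   ((0, 1), (1, 0), (3, 0)), ((0, 1), (1, 1), (2, 0)), ((0, 1), (2, 1), (3, 1)),
   ((1, 0), (2, 0), (3, 1)), ((1, 1), (2, 1), (3, 0))]

lemma M4_cov : ∀ x y : Fin 4 × Fin 2, x.1 ≠ y.1 →
    ∃ T ∈ M4, x ∈ [T.1, T.2.1, T.2.2] ∧ y ∈ [T.1, T.2.1, T.2.2] := by decide +kernel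

lemma NN_add (s r t : ℕ) (ht : 1 ≤ t) : NN s r t + 2 * s = s * (24 * s * t + 8 * r * t) := by
  unfold NN
  have : 2 * s ≤ s * (24 * s * t + 8 * r * t) := by
    rcases Nat.eq_zero_or_pos s with rfl | hs
    · simp
    · have : 1 ≤ s * t := Nat.mul_pos hs ht
      nlinarith
  omega

lemma step4 (v r t : ℕ) (hv : 1 ≤ v) (ht : 1 ≤ t)
    (h : HasP (Fin (6 * (2 * v))) r t (NN (2 * v) r t)) :
    HasP (Fin (6 * (8 * v))) r t (NN (8 * v) r t) := by
  have : NeZero (3 * v) := ⟨by omega⟩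
  have h' : HasP (Fin 2 × ZMod (3 * v) × Fin 2) r t (NN (2 * v) r t) :=
    h.card (by simp [ZMod.card]; ring) le_rfl
  refine (inflate M4 M4_cov r t _ ht h').card ?_ ?_
  · simp [ZMod.card]; ring
  · have e1 := NN_add (2 * v) r t ht
    have e2 := NN_add (8 * v) r t ht
    simp only [ZMod.card, Fintype.card_fin, show M4.length = 8 from rfl]
    nlinarith

/-- Master family for an odd number of groups of size three. -/
noncomputable def MQ (c : ℕ) : List ((ZMod (2 * c + 1) × ZMod 3) × (ZMod (2 * c + 1) × ZMod 3) ×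
    (ZMod (2 * c + 1) × ZMod 3)) :=
  (Finset.univ : Finset (ZMod (2 * c + 1))).toList.flatMap fun x =>
    (List.range c).flatMap fun δ : ℕ => (Finset.univ : Finset (ZMod 3)).toList.flatMap fun i =>
      [((x, i), (x + δ + 1, i), ((x + (x + δ + 1)) * (c + 1), i + 1))]

lemma MQ_length (c : ℕ) : (MQ c).length ≤ (2 * c + 1) * (c * 3) := by
  unfold MQ
  refine (length_flatMap_const _ _ (c * 3) fun x _ => ?_).trans (by simp [ZMod.card])
  refine (length_flatMap_const _ _ 3 fun x _ => ?_).trans (by simp)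
  refine (length_flatMap_const _ _ 1 fun x _ => ?_).trans (by simp [ZMod.card])
  simp

lemma MQ_mem (c : ℕ) (x y : ZMod (2 * c + 1)) (hxy : x ≠ y) (i : ZMod 3) :
    ((x, i), (y, i), ((x + y) * (c + 1), i + 1)) ∈ MQ c ∨
    ((y, i), (x, i), ((x + y) * (c + 1), i + 1)) ∈ MQ c := by
  have key : ∀ (x y : ZMod (2 * c + 1)) (k : ℕ), k < c → y = x + k + 1 →
      ((x, i), (y, i), ((x + y) * (c + 1), i + 1)) ∈ MQ c := by
    rintro x y k hk rfl
    unfold MQ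
    refine List.mem_flatMap.2 ⟨x, by simp, List.mem_flatMap.2 ⟨k, List.mem_range.2 hk,
      List.mem_flatMap.2 ⟨i, by simp, ?_⟩⟩⟩
    exact List.mem_singleton.2 rfl
  obtain ⟨k, hk, rfl⟩ : ∃ k : ℕ, k < 2 * c + 1 ∧ y = x + (k : ZMod (2 * c + 1)) :=
    ⟨(y - x).val, ZMod.val_lt _, by rw [ZMod.natCast_zmod_val]; ring⟩
  have hk0 : k ≠ 0 := by rintro rfl; simp at hxy
  obtain ⟨l, rfl⟩ : ∃ l, k = l + 1 := ⟨k - 1, by omega⟩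
  by_cases hl : l < c
  · left
    exact key _ _ l hl (by push_cast; ring)
  · right
    rw [add_comm x (x + _)]
    refine key _ _ (2 * c - l - 1) (by omega) ?_
    have e : (((l + 1) + (2 * c - l - 1) + 1 : ℕ) : ZMod (2 * c + 1)) = 0 := by
      rw [show (l + 1) + (2 * c - l - 1) + 1 = 2 * c + 1 by omega]
      exact ZMod.natCast_self _
    rw [Nat.cast_add, Nat.cast_add] at e
    push_cast at e ⊢
    linear_combination -e

lemma MQ_cov (c : ℕ) (x y : ZMod (2 * c + 1) × ZMod 3) (h : x.1 ≠ y.1) :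
    ∃ T ∈ MQ c, x ∈ [T.1, T.2.1, T.2.2] ∧ y ∈ [T.1, T.2.1, T.2.2] := by
  have e : (2 * c + 1 : ZMod (2 * c + 1)) = 0 := by
    have : ((2 * c + 1 : ℕ) : ZMod (2 * c + 1)) = 0 := ZMod.natCast_self _
    push_cast at this
    exact this
  have key : ∀ (a b : ZMod (2 * c + 1)) (i : ZMod 3), a ≠ b →
      ∃ T ∈ MQ c, (a, i) ∈ [T.1, T.2.1, T.2.2] ∧ (b, i + 1) ∈ [T.1, T.2.1, T.2.2] := by
    intro a b i hab
    have hne : a ≠ 2 * b - a := by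
      intro h
      apply hab
      linear_combination (c + 1 : ZMod (2 * c + 1)) * h + (b - a) * e
    have hm : (a + (2 * b - a)) * (c + 1 : ZMod (2 * c + 1)) = b := by
      linear_combination b * e
    rcases MQ_mem c a (2 * b - a) hne i with h | h <;> rw [hm] at h
    · exact ⟨_, h, by simp, by simp⟩
    · exact ⟨_, h, by simp, by simp⟩
  obtain ⟨a, i⟩ := x
  obtain ⟨b, j⟩ := y
  simp only at h
  have h3 : j = i ∨ j = i + 1 ∨ i = j + 1 := by revert i j; decide
  rcases h3 with rfl | rfl | rfl
  · rcases MQ_mem c a b h j with h | h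
    · exact ⟨_, h, by simp, by simp⟩
    · exact ⟨_, h, by simp, by simp⟩
  · exact key a b i h
  · obtain ⟨T, h1, h2, h3⟩ := key b a j h.symm
    exact ⟨T, h1, h3, h2⟩

lemma stepQ (c u r t : ℕ) (hu : 1 ≤ u) (ht : 1 ≤ t)
    (h : HasP (Fin (6 * u)) r t (NN u r t)) :
    HasP (Fin (6 * ((2 * c + 1) * u))) r t (NN ((2 * c + 1) * u) r t) := by
  have : NeZero u := ⟨by omega⟩
  have h' : HasP (ZMod 3 × ZMod u × Fin 2) r t (NN u r t) :=
    h.card (by simp [ZMod.card]; ring) le_rfl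
  refine (inflate (MQ c) (MQ_cov c) r t _ ht h').card ?_ ?_
  · simp [ZMod.card]; ring
  · have e1 := NN_add u r t ht
    have e2 := NN_add ((2 * c + 1) * u) r t ht
    have e3 := Nat.mul_le_mul_right (u * (u * (16 * t))) (MQ_length c)
    simp only [ZMod.card]
    have e4 : (2 * c + 1) * (NN u r t + 2 * u) =
      (2 * c + 1) * (u * (24 * u * t + 8 * r * t)) := by rw [e1]
    nlinarith

lemma rec_all (r t : ℕ) (ht : 1 ≤ t) (b1 : HasP (Fin (6 * 1)) r t (NN 1 r t))
    (b2 : HasP (Fin (6 * 2)) r t (NN 2 r t)) (b4 : HasP (Fin (6 * 4)) r t (NN 4 r t))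
    (s : ℕ) (hs : 1 ≤ s) : HasP (Fin (6 * s)) r t (NN s r t) := by
  have pw : ∀ e : ℕ, HasP (Fin (6 * 2 ^ e)) r t (NN (2 ^ e) r t) := by
    intro e
    induction e using Nat.strong_induction_on with
    | _ e ih =>
      match e with
      | 0 => exact b1
      | 1 => exact b2
      | 2 => exact b4
      | k + 3 =>
        have h := ih (k + 1) (by omega)
        rw [show 2 ^ (k + 1) = 2 * 2 ^ k by ring] at h
        have := step4 (2 ^ k) r t Nat.one_le_two_pow ht h
        rwa [show 8 * 2 ^ k = 2 ^ (k + 3) by ring] at this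
  obtain ⟨e, q, hq, rfl⟩ := Nat.exists_eq_two_pow_mul_odd (n := s) (by omega)
  obtain ⟨c, rfl⟩ := hq
  have := stepQ c (2 ^ e) r t Nat.one_le_two_pow ht (pw e)
  rwa [mul_comm (2 * c + 1)] at this

/-! ### Base cases -/

/-- The complete check of a descriptor. -/
noncomputable def okD (D : Desc) (s r : ℕ) : Bool :=
  (List.range (6 * s)).all (fun a => okP D a &&
    (List.range (6 * s + r)).all fun b => Nat.ble b a || okE D a b) &&
  (Nat.beq (4 * D.tri.length + 2 * D.half.length + 2 * D.spec.length) (s * (24 * s + 8 * r)) &&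
   Nat.beq (D.tri.length + D.half.length + D.spec.length) (D.sg.length + 2 * s))

/-- Interpretation of numeric rows. -/
def rowB (w r : ℕ) (hw : 0 < w) (i : ℕ) : Fin w ⊕ Fin r :=
  if h : i < w then Sum.inl ⟨i, h⟩ else if h' : i - w < r then Sum.inr ⟨i - w, h'⟩
  else Sum.inl ⟨0, hw⟩

lemma okD_sound (D : Desc) (s r t : ℕ) (hs : 1 ≤ s) (ht : 1 ≤ t) (h : okD D s r = true) :
    HasP (Fin (6 * s)) r t (NN s r t) := by
  simp only [okD, Bool.and_eq_true, List.all_eq_true, List.mem_range, Bool.or_eq_true,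
    Nat.beq_eq, Nat.ble_eq] at h
  obtain ⟨h1, h2, h3⟩ := h
  have hw : 0 < 6 * s := by omega
  have hl : ∀ a : Fin (6 * s), rowB (6 * s) r hw a = Sum.inl a := by
    intro a; simp [rowB]
  have hr : ∀ a : Fin r, rowB (6 * s) r hw (6 * s + a) = Sum.inr a := by
    intro a; simp [rowB]
  have hE : ∀ a b : Fin (6 * s), a < b → ∀ z, Cov ((D.list t).map (Tr.mp (rowB (6 * s) r hw)))
      (Sum.inl a) (Sum.inl b) z := by
    intro a b hab z
    have hab' : a.val < b.val := hab
    have hk := ((h1 a a.2).2 b (by omega)).resolve_left (by omega)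
    have := (okE_sound hk hab' t ht z).mp (rowB (6 * s) r hw)
    rwa [hl, hl] at this
  refine ⟨(D.list t).map (Tr.mp (rowB (6 * s) r hw)), ?_, ?_, ?_, ?_⟩
  · rw [List.length_map]
    refine (D.length_le t ht).trans ?_
    have e1 := NN_add s r t ht
    obtain ⟨u, rfl⟩ : ∃ u, t = u + 1 := ⟨t - 1, by omega⟩
    rw [show 4 * (u + 1) - 1 = 4 * u + 3 by omega, show 2 * (u + 1) - 1 = 2 * u + 1 by omega]
    have e2 : s * (24 * s * (u + 1) + 8 * r * (u + 1)) = s * (24 * s + 8 * r) * (u + 1) := by ring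
    rw [e2, ← h2] at e1
    generalize D.tri.length = A at *
    generalize D.half.length = B at *
    generalize D.spec.length = E at *
    generalize D.sg.length = F at *
    generalize NN s r (u + 1) = X at *
    clear hE h1 h2 e2 hl hr
    have h4 : A * (4 * u + 3) + (B * (2 * u + 1) + (E * (2 * u + 1) + F)) + 2 * s = X + 2 * s := by
      rw [e1]
      linear_combination -h3
    omega
  · intro a b hab z
    rcases lt_or_gt_of_ne hab with h | h
    · exact hE a b h z
    · exact (hE b a h (-z)).symm_neg
  · intro a b z
    have hk := ((h1 a a.2).2 (6 * s + b) (by omega)).resolve_left (by omega)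
    have := (okE_sound hk (by omega) t ht z).mp (rowB (6 * s) r hw)
    rwa [hl, hr] at this
  · intro a k hk hk'
    have := (okP_sound (h1 a a.2).1 t k hk hk').mp (rowB (6 * s) r hw)
    rwa [hl] at this

/-- Embed data without constant terms. -/
def z5 (l : List (ℕ × ℕ × ℕ × ℕ × ℕ)) : List TT :=
  l.map fun x => (x.1, x.2.1, x.2.2.1, (x.2.2.2.1, 0), (x.2.2.2.2, 0))

/-- Embed data without constant terms. -/
def z3 (l : List (ℕ × ℕ × ℕ)) : List (ℕ × ℕ × (ℕ × ℕ)) :=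
  l.map fun x => (x.1, x.2.1, (x.2.2, 0))

/-- Base descriptor for `s = 1`, `r = 1`. -/
def D11 : Desc where
  tri := z5
    [(0, 2, 6, 2, 0), (0, 1, 3, 2, 0), (1, 5, 6, 2, 0), (2, 4, 5, 2, 0), (3, 4, 6, 2, 0)]
  half := []
  spec := z3
    [(2, 3, 0), (3, 5, 2), (5, 0, 3), (0, 4, 2), (4, 1, 3), (1, 2, 0)]
  sg := z5
    [(0, 1, 2, 2, 0), (0, 3, 4, 0, 2), (0, 4, 5, 3, 0), (0, 5, 6, 0, 0), (1, 2, 4, 1, 2), (1, 4,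
    6, 0, 0), (1, 3, 5, 0, 2), (2, 3, 5, 1, 3), (2, 3, 6, 0, 0)]

lemma D11_ok : okD D11 1 1 = true := by decide +kernel

/-- Base descriptor for `s = 1`, `r = 2`. -/
def D12 : Desc where
  tri := z5
    [(0, 1, 4, 2, 1), (0, 2, 3, 2, 0), (0, 5, 7, 2, 0), (1, 2, 5, 2, 0), (1, 3, 7, 2, 0), (2, 4,
    7, 0, 0), (3, 4, 5, 3, 0)]
  half := []
  spec := z3
    [(0, 6, 0), (1, 6, 2), (2, 6, 0), (3, 6, 0), (4, 6, 0), (5, 6, 3)]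
  sg := z5
    [(0, 1, 6, 2, 2), (0, 4, 6, 1, 0), (0, 2, 5, 2, 0), (0, 3, 7, 0, 0), (1, 2, 7, 2, 2), (4, 5,
    7, 0, 0), (1, 3, 4, 2, 3), (1, 5, 6, 0, 3), (2, 3, 6, 0, 0), (2, 4, 6, 0, 1), (3, 5, 6, 1,
    0)]

lemma D12_ok : okD D12 1 2 = true := by decide +kernel

/-- Base descriptor for `s = 1`, `r = 4`. -/
def D14 : Desc where
  tri := z5
    [(0, 3, 7, 2, 0), (1, 2, 7, 0, 2), (4, 5, 7, 2, 0), (0, 1, 4, 3, 0), (0, 5, 8, 1, 1), (0, 2,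
    9, 2, 0), (2, 3, 5, 3, 0), (1, 5, 9, 3, 3), (1, 3, 8, 0, 2), (2, 4, 8, 3, 3), (3, 4, 9, 1,
    1)]
  half := []
  spec := z3
    [(0, 6, 0), (1, 6, 1), (2, 6, 0), (3, 6, 1), (4, 6, 0), (5, 6, 3)]
  sg := z5
    [(0, 1, 6, 3, 1), (0, 4, 6, 1, 0), (0, 2, 7, 2, 2), (0, 3, 8, 2, 2), (0, 5, 9, 1, 3), (1, 4,
    7, 0, 0), (3, 5, 7, 0, 0), (1, 2, 8, 0, 0), (1, 5, 6, 3, 3), (1, 3, 9, 0, 0), (2, 4, 9, 3,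
    1), (2, 3, 6, 3, 1), (2, 5, 6, 1, 0), (3, 4, 6, 1, 1), (4, 5, 8, 2, 1)]

lemma D14_ok : okD D14 1 4 = true := by decide +kernel

/-- Base descriptor for `s = 1`, `r = 5`. -/
def D15 : Desc where
  tri :=
    [(0, 1, 6, (2, 3), (0, 11)), (2, 3, 6, (0, 2), (0, 6)), (4, 5, 6, (2, 3), (0, 2)), (0, 3, 7,
    (0, 7), (0, 8)), (2, 5, 7, (0, 6), (2, 4)), (1, 4, 7, (2, 5), (0, 7)), (0, 5, 8, (2, 12),
    (0, 6)), (1, 2, 8, (2, 3), (0, 11)), (3, 4, 8, (2, 3), (0, 8))]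
  half :=
    [(0, 2, 4, (2, 4), (0, 4)), (0, 2, 9, (2, 5), (0, 15)), (2, 4, 9, (0, 3), (0, 11)), (0, 4,
    9, (0, 9), (2, 10)), (1, 3, 5, (2, 4), (0, 4)), (1, 3, 9, (2, 5), (0, 13)), (3, 5, 9, (0,
    3), (0, 9)), (1, 5, 9, (0, 9), (2, 8))]
  spec :=
    [(0, 10, (0, 21)), (1, 10, (0, 18)), (2, 10, (2, 17)), (3, 10, (1, 14)), (4, 10, (3, 13)),
    (5, 10, (1, 11))]
  sg :=
    [(0, 4, 6, (0, 9), (0, 5)), (1, 2, 6, (2, 3), (2, 8)), (3, 5, 6, (0, 4), (0, 2)), (2, 3, 7,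
    (0, 2), (0, 8)), (0, 1, 7, (2, 3), (0, 12)), (4, 5, 7, (2, 3), (2, 4)), (1, 5, 8, (0, 8),
    (0, 6)), (2, 4, 8, (0, 3), (0, 8)), (0, 3, 8, (0, 7), (0, 11)), (2, 5, 10, (0, 6), (2, 11)),
    (0, 5, 9, (2, 12), (2, 8)), (0, 4, 10, (0, 8), (0, 13)), (0, 2, 10, (2, 4), (3, 17)), (0, 2,
    9, (2, 5), (2, 14)), (2, 4, 9, (0, 4), (0, 11)), (1, 4, 10, (2, 5), (3, 13)), (3, 4, 9, (2,
    3), (2, 10)), (1, 3, 10, (2, 4), (2, 14)), (3, 5, 10, (0, 3), (1, 11)), (1, 3, 9, (2, 5),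
    (2, 12)), (1, 5, 9, (0, 9), (0, 9))]

lemma D15_ok : okD D15 1 5 = true := by decide +kernel

/-- Base descriptor for `s = 2`, `r = 1`. -/
def D21 : Desc where
  tri := z5
    [(0, 1, 7, 3, 0), (0, 3, 9, 1, 2), (0, 4, 5, 3, 3), (0, 2, 10, 1, 1), (0, 6, 12, 2, 0), (1,
    6, 8, 1, 0), (2, 4, 6, 3, 0), (6, 7, 10, 2, 2), (6, 9, 11, 2, 0), (1, 10, 11, 3, 0), (5, 9,
    10, 2, 0), (8, 10, 12, 0, 0), (2, 3, 8, 0, 3), (4, 8, 11, 2, 0), (7, 8, 9, 2, 0), (4, 9, 12,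
    2, 0), (3, 4, 7, 3, 0), (5, 7, 12, 2, 0), (1, 2, 12, 2, 0), (1, 3, 5, 2, 0), (2, 5, 11, 2,
    0), (3, 11, 12, 2, 0)]
  half := []
  spec := z3
    [(7, 11, 3), (11, 0, 0), (0, 8, 1), (8, 5, 0), (5, 6, 3), (6, 3, 3), (3, 10, 2), (10, 4, 3),
    (4, 1, 0), (1, 9, 3), (9, 2, 0), (2, 7, 0)]
  sg := z5
    [(0, 1, 11, 3, 1), (1, 2, 3, 2, 0), (1, 4, 7, 0, 0), (1, 4, 5, 1, 3), (1, 6, 10, 1, 2), (1,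
    8, 9, 3, 0), (1, 9, 12, 0, 0), (0, 4, 9, 3, 2), (2, 4, 8, 3, 2), (4, 6, 11, 0, 0), (3, 4,
    10, 3, 3), (4, 10, 12, 0, 0), (6, 7, 9, 2, 0), (0, 2, 6, 1, 1), (2, 5, 9, 2, 2), (2, 9, 10,
    1, 0), (3, 9, 11, 2, 0), (2, 7, 12, 0, 0), (2, 7, 11, 1, 3), (3, 5, 6, 0, 3), (3, 6, 12, 0,
    0), (5, 6, 8, 0, 0), (0, 3, 10, 1, 3), (3, 7, 8, 1, 2), (0, 7, 11, 1, 0), (5, 7, 10, 2, 2),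
    (8, 10, 11, 0, 0), (5, 11, 12, 0, 0), (0, 5, 8, 0, 1), (0, 8, 12, 2, 2)]

lemma D21_ok : okD D21 2 1 = true := by decide +kernel

/-- Base descriptor for `s = 2`, `r = 2`. -/
def D22 : Desc where
  tri := z5
    [(0, 1, 8, 2, 0), (0, 2, 11, 2, 0), (0, 3, 13, 0, 2), (0, 4, 6, 2, 3), (0, 5, 9, 2, 0), (0,
    7, 10, 2, 0), (1, 2, 13, 2, 0), (1, 4, 7, 2, 0), (1, 3, 5, 2, 0), (1, 6, 11, 0, 0), (1, 9,
    10, 0, 0), (2, 4, 8, 1, 1), (2, 5, 10, 2, 0), (4, 5, 11, 1, 1), (3, 4, 10, 2, 0), (4, 9, 13,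
    2, 0), (6, 10, 13, 2, 0), (8, 10, 11, 0, 2), (7, 11, 13, 2, 0), (3, 9, 11, 0, 0), (5, 8, 13,
    0, 0), (5, 6, 7, 2, 0), (2, 3, 6, 2, 2), (2, 7, 9, 0, 0), (3, 7, 8, 2, 0), (6, 8, 9, 2, 0)]
  half := []
  spec := z3
    [(0, 12, 0), (1, 12, 3), (2, 12, 0), (3, 12, 0), (4, 12, 2), (5, 12, 0), (6, 12, 1), (7, 12,
    1), (8, 12, 0), (9, 12, 2), (10, 12, 2), (11, 12, 3)]
  sg := z5
    [(0, 6, 12, 3, 1), (0, 1, 12, 2, 3), (0, 2, 9, 2, 2), (0, 3, 10, 0, 0), (0, 4, 7, 2, 0), (0,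
    5, 13, 2, 2), (0, 8, 11, 0, 0), (2, 10, 13, 0, 0), (4, 11, 13, 0, 0), (1, 3, 13, 2, 2), (6,
    9, 13, 0, 0), (7, 8, 13, 0, 0), (2, 4, 5, 1, 1), (2, 8, 12, 0, 0), (1, 2, 6, 2, 2), (2, 3,
    11, 2, 2), (2, 7, 12, 0, 1), (1, 4, 9, 2, 2), (1, 5, 8, 0, 0), (1, 7, 11, 0, 2), (1, 10, 12,
    2, 2), (3, 4, 12, 2, 2), (3, 8, 12, 0, 1), (8, 9, 10, 0, 0), (4, 6, 8, 3, 2), (4, 10, 12, 0,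
    3), (3, 6, 7, 2, 0), (3, 5, 9, 0, 0), (7, 9, 12, 0, 2), (5, 7, 10, 0, 0), (6, 10, 11, 2, 2),
    (5, 6, 12, 2, 2), (5, 11, 12, 1, 0), (9, 11, 12, 0, 3)]

lemma D22_ok : okD D22 2 2 = true := by decide +kernel

/-- Base descriptor for `s = 2`, `r = 4`. -/
def D24 : Desc where
  tri := z5
    [(0, 6, 13, 1, 1), (1, 7, 13, 2, 0), (2, 5, 13, 0, 2), (3, 4, 13, 0, 0), (8, 11, 13, 1, 1),
    (9, 10, 13, 2, 0), (0, 1, 5, 0, 2), (0, 3, 9, 2, 0), (0, 7, 8, 3, 0), (0, 4, 14, 2, 0), (0,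
    2, 11, 2, 0), (0, 10, 15, 2, 0), (1, 2, 3, 1, 2), (1, 10, 14, 2, 0), (1, 4, 8, 1, 0), (1, 6,
    15, 0, 2), (1, 9, 11, 1, 0), (2, 8, 10, 2, 0), (2, 6, 14, 0, 0), (2, 4, 9, 2, 0), (2, 7, 15,
    2, 0), (4, 11, 15, 1, 0), (3, 5, 15, 2, 0), (8, 9, 15, 2, 0), (3, 8, 14, 2, 0), (5, 6, 8, 0,
    2), (6, 7, 9, 2, 0), (4, 6, 10, 3, 3), (3, 6, 11, 2, 0), (3, 7, 10, 1, 2), (4, 5, 7, 0, 0),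
    (5, 9, 14, 0, 2), (5, 10, 11, 3, 3), (7, 11, 14, 1, 0)]
  half := []
  spec := z3
    [(0, 12, 0), (1, 12, 0), (2, 12, 0), (3, 12, 0), (4, 12, 2), (5, 12, 0), (6, 12, 0), (7, 12,
    0), (8, 12, 0), (9, 12, 0), (10, 12, 3), (11, 12, 0)]
  sg := z5
    [(0, 4, 12, 2, 2), (0, 8, 12, 1, 0), (0, 3, 13, 2, 2), (0, 2, 14, 2, 2), (0, 1, 10, 0, 2),
    (0, 5, 15, 0, 0), (0, 6, 7, 1, 2), (0, 9, 11, 0, 0), (1, 5, 13, 2, 2), (4, 6, 13, 3, 1), (2,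
    9, 13, 0, 0), (7, 8, 13, 0, 0), (10, 11, 13, 3, 1), (1, 6, 14, 0, 0), (5, 11, 14, 0, 0), (3,
    7, 14, 1, 3), (4, 10, 14, 0, 0), (8, 9, 14, 2, 2), (1, 3, 9, 1, 0), (4, 5, 9, 0, 0), (5, 7,
    12, 0, 0), (6, 9, 12, 0, 0), (9, 10, 12, 2, 3), (7, 9, 15, 0, 0), (2, 7, 10, 2, 2), (1, 7,
    11, 2, 1), (4, 7, 12, 2, 1), (1, 8, 12, 3, 1), (1, 2, 12, 1, 0), (1, 4, 15, 1, 3), (2, 3, 4,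
    2, 0), (4, 8, 11, 0, 1), (2, 5, 12, 0, 1), (2, 6, 8, 0, 2), (2, 11, 15, 0, 0), (3, 11, 12,
    0, 0), (6, 11, 12, 0, 1), (3, 10, 12, 1, 0), (3, 5, 8, 2, 0), (3, 6, 15, 2, 2), (5, 6, 10,
    0, 3), (8, 10, 15, 0, 0)]

lemma D24_ok : okD D24 2 4 = true := by decide +kernel

/-- Base descriptor for `s = 2`, `r = 5`. -/
def D25 : Desc where
  tri := z5
    [(0, 3, 12, 0, 2), (1, 5, 12, 0, 2), (2, 8, 12, 2, 0), (4, 7, 12, 0, 0), (6, 10, 12, 1, 3),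
    (9, 11, 12, 2, 0), (0, 1, 14, 2, 0), (2, 10, 14, 2, 0), (5, 9, 14, 2, 0), (3, 7, 14, 2, 0),
    (4, 8, 14, 0, 2), (6, 11, 14, 2, 0), (3, 4, 9, 2, 0), (3, 5, 11, 1, 3), (3, 8, 13, 2, 0),
    (1, 3, 15, 2, 0), (2, 3, 16, 0, 2), (1, 2, 13, 0, 0), (2, 4, 11, 2, 0), (10, 11, 13, 2, 0),
    (8, 11, 15, 0, 2), (1, 11, 16, 2, 0), (1, 6, 7, 2, 0), (1, 8, 10, 2, 0), (2, 5, 15, 0, 0),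
    (0, 2, 6, 2, 0), (6, 8, 16, 2, 0), (7, 8, 9, 0, 0), (4, 6, 15, 2, 0), (6, 9, 13, 0, 2), (4,
    5, 13, 0, 0), (0, 4, 16, 2, 0), (0, 7, 13, 2, 0), (0, 5, 10, 2, 0), (0, 9, 15, 2, 0), (5, 7,
    16, 2, 0), (7, 10, 15, 1, 1), (9, 10, 16, 2, 0)]
  half := []
  spec := z3
    [(7, 11, 0), (11, 0, 3), (0, 8, 3), (8, 5, 3), (5, 6, 1), (6, 3, 3), (3, 10, 0), (10, 4, 2),
    (4, 1, 1), (1, 9, 0), (9, 2, 3), (2, 7, 0)]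
  sg := z5
    [(0, 5, 12, 2, 2), (1, 6, 12, 2, 2), (2, 4, 12, 2, 2), (3, 11, 12, 2, 0), (7, 10, 12, 1, 3),
    (8, 9, 12, 0, 0), (0, 1, 13, 2, 2), (2, 6, 13, 0, 0), (3, 4, 13, 2, 2), (7, 11, 13, 0, 0),
    (8, 10, 13, 0, 0), (5, 9, 13, 2, 2), (0, 2, 15, 2, 2), (0, 3, 7, 0, 2), (0, 8, 11, 3, 0),
    (0, 8, 16, 0, 0), (0, 4, 6, 2, 2), (0, 9, 10, 2, 2), (0, 11, 14, 0, 0), (2, 3, 8, 0, 2), (5,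
    6, 8, 1, 2), (1, 8, 14, 2, 2), (4, 5, 8, 0, 0), (7, 8, 15, 0, 0), (4, 7, 14, 0, 0), (2, 5,
    14, 0, 0), (6, 9, 14, 0, 0), (3, 10, 14, 0, 0), (2, 10, 11, 2, 2), (1, 2, 7, 0, 0), (2, 7,
    9, 1, 2), (2, 9, 16, 0, 0), (3, 9, 15, 0, 0), (1, 9, 11, 0, 2), (1, 4, 9, 1, 0), (4, 11, 16,
    0, 0), (1, 4, 10, 2, 2), (4, 10, 15, 3, 1), (1, 5, 15, 0, 0), (1, 3, 16, 2, 2), (6, 11, 15,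
    2, 2), (5, 7, 11, 2, 1), (6, 7, 16, 0, 0), (5, 10, 16, 0, 0), (3, 5, 6, 1, 2), (3, 6, 10, 0,
    1)]

lemma D25_ok : okD D25 2 5 = true := by decide +kernel

/-- Base descriptor for `s = 4`, `r = 1`. -/
def D41 : Desc where
  tri := z5
    [(0, 2, 20, 2, 0), (0, 1, 3, 0, 2), (0, 5, 19, 2, 0), (0, 14, 18, 2, 0), (0, 10, 17, 3, 3),
    (0, 4, 11, 3, 3), (0, 12, 23, 0, 2), (0, 13, 15, 0, 1), (0, 8, 9, 0, 2), (0, 16, 21, 2, 0),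
    (0, 22, 24, 2, 0), (1, 5, 6, 2, 0), (1, 10, 12, 1, 1), (1, 2, 14, 1, 0), (1, 15, 21, 0, 2),
    (1, 4, 19, 1, 0), (1, 13, 23, 1, 1), (1, 8, 24, 3, 3), (1, 9, 11, 1, 3), (1, 16, 18, 1, 1),
    (1, 17, 22, 2, 0), (2, 5, 17, 2, 0), (2, 12, 13, 1, 1), (2, 4, 9, 1, 1), (2, 7, 15, 0, 2),
    (2, 16, 22, 2, 0), (2, 6, 11, 1, 3), (2, 3, 24, 2, 0), (2, 10, 19, 0, 0), (2, 21, 23, 1, 0),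
    (4, 6, 13, 3, 0), (4, 8, 17, 1, 0), (4, 5, 15, 0, 1), (4, 12, 21, 1, 0), (4, 7, 22, 2, 0),
    (4, 10, 20, 3, 3), (4, 14, 24, 2, 0), (4, 16, 23, 2, 0), (5, 9, 16, 2, 0), (5, 18, 24, 2,
    3), (5, 7, 23, 2, 0), (3, 5, 21, 2, 0), (5, 11, 12, 1, 2), (5, 14, 20, 2, 0), (5, 8, 22, 2,
    0), (6, 12, 22, 1, 0), (8, 12, 20, 2, 0), (7, 12, 14, 1, 1), (12, 15, 24, 2, 0), (3, 9, 12,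
    0, 0), (12, 17, 18, 2, 0), (9, 13, 14, 1, 1), (9, 15, 18, 3, 1), (9, 17, 19, 3, 3), (7, 9,
    24, 2, 0), (9, 20, 21, 2, 0), (9, 22, 23, 2, 0), (3, 14, 17, 2, 0), (8, 14, 16, 0, 2), (10,
    11, 14, 2, 0), (14, 19, 21, 2, 0), (6, 14, 23, 2, 0), (18, 21, 22, 2, 0), (3, 10, 22, 1, 0),
    (11, 13, 22, 2, 0), (19, 20, 22, 2, 0), (11, 21, 24, 2, 0), (6, 8, 21, 2, 0), (7, 10, 21, 0,
    0), (11, 16, 17, 1, 0), (15, 17, 20, 0, 0), (6, 7, 17, 3, 3), (13, 17, 24, 2, 0), (19, 23,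
    24, 2, 0), (3, 20, 23, 2, 0), (10, 15, 23, 2, 0), (8, 18, 23, 2, 0), (8, 10, 13, 1, 1), (6,
    10, 18, 3, 3), (10, 16, 24, 3, 3), (6, 20, 24, 2, 0), (6, 15, 16, 2, 0), (3, 6, 19, 1, 1),
    (3, 11, 15, 1, 3), (8, 15, 19, 1, 3), (7, 8, 11, 2, 0), (11, 18, 19, 2, 0), (7, 13, 19, 2,
    0), (3, 7, 18, 3, 1), (3, 13, 16, 1, 1), (7, 16, 20, 2, 0), (13, 18, 20, 1, 0)]
  half := []
  spec := z3
    [(20, 11, 0), (11, 23, 2), (23, 17, 0), (17, 21, 3), (21, 13, 0), (13, 5, 2), (5, 10, 3),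
    (10, 9, 3), (9, 6, 0), (6, 0, 0), (0, 7, 1), (7, 1, 0), (1, 20, 0), (19, 16, 2), (16, 12,
    2), (12, 19, 3), (22, 14, 0), (14, 15, 0), (15, 22, 0), (3, 8, 0), (8, 2, 2), (2, 18, 3),
    (18, 4, 2), (4, 3, 0)]
  sg := z5
    [(0, 1, 5, 0, 2), (0, 2, 8, 2, 2), (0, 3, 19, 0, 0), (0, 4, 7, 3, 2), (0, 6, 21, 0, 0), (0,
    6, 11, 1, 3), (0, 7, 13, 2, 2), (0, 9, 10, 0, 3), (0, 12, 16, 0, 2), (0, 14, 22, 2, 0), (0,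
    15, 18, 3, 1), (0, 17, 23, 0, 0), (0, 20, 24, 0, 0), (2, 6, 7, 1, 3), (1, 6, 24, 0, 0), (3,
    6, 12, 1, 1), (6, 14, 15, 2, 0), (4, 6, 19, 3, 1), (5, 6, 8, 0, 2), (6, 9, 20, 0, 2), (6, 9,
    22, 1, 2), (6, 10, 13, 3, 1), (6, 16, 17, 0, 0), (6, 18, 23, 0, 0), (1, 7, 22, 0, 0), (1, 3,
    7, 2, 3), (7, 18, 24, 1, 3), (5, 7, 21, 2, 2), (7, 9, 16, 2, 0), (7, 8, 19, 2, 2), (7, 10,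
    12, 0, 1), (7, 11, 14, 0, 0), (7, 15, 20, 2, 2), (7, 17, 23, 3, 1), (1, 8, 9, 3, 2), (1, 10,
    18, 1, 3), (1, 12, 17, 0, 2), (1, 4, 15, 1, 3), (1, 11, 21, 2, 2), (1, 2, 23, 1, 3), (1, 13,
    20, 1, 3), (1, 14, 16, 3, 2), (1, 19, 20, 3, 2), (9, 18, 21, 2, 2), (18, 19, 22, 0, 0), (11,
    12, 18, 2, 0), (2, 16, 18, 2, 1), (2, 5, 18, 2, 2), (4, 13, 18, 1, 1), (3, 18, 20, 2, 0),
    (4, 8, 18, 1, 2), (14, 17, 18, 0, 0), (10, 17, 20, 3, 0), (2, 14, 20, 0, 0), (5, 20, 23, 0,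
    0), (8, 11, 20, 0, 0), (4, 11, 20, 3, 1), (12, 20, 22, 0, 0), (16, 20, 21, 0, 0), (4, 10,
    16, 3, 3), (2, 4, 17, 1, 3), (4, 5, 14, 0, 2), (4, 9, 12, 1, 0), (3, 4, 23, 0, 0), (3, 4,
    21, 1, 3), (4, 22, 24, 0, 0), (5, 12, 16, 1, 3), (16, 19, 23, 2, 2), (13, 16, 19, 1, 3), (3,
    8, 16, 0, 0), (15, 16, 22, 0, 0), (11, 16, 24, 1, 3), (10, 11, 23, 2, 2), (11, 13, 23, 2,
    1), (9, 14, 23, 0, 0), (21, 22, 23, 0, 0), (8, 12, 23, 2, 2), (15, 23, 24, 0, 0), (2, 11,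
    19, 2, 0), (2, 12, 21, 1, 0), (12, 13, 15, 1, 1), (12, 14, 19, 1, 2), (12, 19, 24, 0, 0),
    (17, 19, 21, 3, 0), (5, 15, 19, 1, 3), (9, 10, 19, 0, 0), (3, 5, 10, 2, 3), (5, 10, 22, 0,
    0), (5, 9, 11, 2, 3), (5, 13, 17, 2, 2), (5, 13, 24, 3, 0), (3, 9, 13, 0, 1), (2, 9, 24, 0,
    0), (9, 15, 17, 3, 0), (2, 8, 10, 3, 1), (2, 13, 22, 0, 0), (2, 3, 15, 2, 2), (11, 15, 22,
    3, 1), (3, 11, 17, 1, 3), (8, 17, 22, 0, 0), (3, 14, 22, 2, 1), (3, 8, 24, 1, 3), (17, 21,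
    24, 0, 0), (10, 14, 24, 0, 0), (10, 15, 21, 2, 2), (8, 14, 15, 0, 1), (8, 13, 21, 0, 0),
    (13, 14, 21, 1, 0)]

lemma D41_ok : okD D41 4 1 = true := by decide +kernel

/-- Base descriptor for `s = 4`, `r = 2`. -/
def D42 : Desc where
  tri := z5
    [(0, 1, 4, 0, 2), (0, 2, 12, 2, 2), (0, 3, 10, 0, 0), (0, 5, 21, 2, 0), (0, 6, 9, 0, 0), (0,
    7, 8, 2, 0), (0, 11, 18, 2, 0), (0, 13, 19, 2, 0), (0, 14, 25, 0, 2), (0, 15, 23, 2, 0), (0,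
    16, 17, 2, 0), (0, 20, 22, 2, 0), (1, 2, 7, 0, 0), (1, 3, 11, 0, 2), (1, 5, 25, 2, 0), (1,
    6, 18, 0, 2), (1, 13, 17, 2, 0), (1, 12, 15, 2, 0), (1, 19, 20, 2, 0), (1, 8, 21, 0, 0), (1,
    9, 16, 0, 0), (1, 10, 22, 1, 1), (1, 14, 23, 2, 0), (2, 3, 8, 0, 0), (2, 4, 5, 2, 0), (2, 6,
    22, 2, 0), (2, 11, 13, 2, 0), (2, 14, 18, 2, 0), (2, 16, 19, 2, 0), (2, 9, 15, 2, 0), (2,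
    10, 20, 0, 2), (2, 17, 25, 1, 1), (2, 21, 23, 2, 0), (3, 5, 18, 2, 0), (3, 9, 25, 2, 0), (3,
    12, 19, 2, 0), (3, 16, 23, 2, 0), (3, 7, 22, 1, 1), (3, 13, 20, 2, 0), (3, 4, 21, 2, 0), (3,
    6, 17, 2, 0), (3, 14, 15, 2, 0), (5, 12, 13, 3, 3), (5, 10, 16, 3, 0), (5, 6, 7, 1, 1), (5,
    11, 15, 1, 1), (5, 17, 20, 0, 0), (5, 8, 14, 2, 0), (5, 9, 22, 2, 0), (5, 19, 23, 0, 2), (6,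
    10, 19, 1, 0), (6, 14, 20, 3, 3), (6, 8, 15, 3, 3), (6, 13, 16, 2, 0), (6, 12, 21, 3, 3),
    (4, 6, 25, 2, 0), (6, 11, 23, 3, 3), (7, 13, 14, 1, 1), (11, 14, 16, 2, 0), (9, 10, 14, 0,
    0), (12, 14, 22, 0, 0), (4, 14, 19, 0, 0), (14, 17, 21, 3, 1), (8, 9, 13, 0, 0), (4, 13, 18,
    2, 0), (13, 23, 25, 2, 0), (10, 13, 15, 0, 2), (13, 21, 22, 2, 0), (10, 21, 25, 2, 0), (9,
    11, 21, 2, 0), (9, 18, 19, 2, 0), (7, 19, 21, 2, 0), (15, 19, 25, 0, 0), (8, 17, 19, 2, 0),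
    (11, 19, 22, 0, 0), (15, 16, 21, 2, 0), (18, 20, 21, 2, 0), (7, 15, 20, 2, 0), (4, 15, 22,
    2, 0), (15, 17, 18, 3, 1), (17, 22, 23, 2, 3), (8, 22, 25, 3, 3), (16, 18, 22, 2, 0), (12,
    18, 25, 0, 0), (7, 18, 23, 2, 0), (8, 10, 18, 2, 2), (10, 12, 23, 0, 2), (4, 8, 23, 0, 0),
    (9, 20, 23, 2, 0), (8, 11, 20, 1, 0), (8, 12, 16, 3, 3), (4, 12, 20, 0, 3), (4, 7, 16, 2,
    0), (4, 9, 17, 0, 2), (4, 10, 11, 2, 2), (7, 9, 12, 0, 0), (7, 10, 17, 0, 0), (7, 11, 25, 2,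
    0), (11, 12, 17, 1, 1), (16, 20, 25, 0, 0)]
  half := []
  spec := z3
    [(0, 24, 0), (1, 24, 0), (2, 24, 2), (3, 24, 1), (4, 24, 0), (5, 24, 0), (6, 24, 0), (7, 24,
    0), (8, 24, 0), (9, 24, 0), (10, 24, 3), (11, 24, 2), (12, 24, 0), (13, 24, 0), (14, 24, 0),
    (15, 24, 3), (16, 24, 0), (17, 24, 0), (18, 24, 0), (19, 24, 0), (20, 24, 3), (21, 24, 0),
    (22, 24, 0), (23, 24, 0)]
  sg := z5
    [(0, 23, 24, 0, 0), (0, 20, 24, 2, 3), (0, 1, 12, 0, 2), (0, 2, 14, 2, 2), (0, 3, 8, 0, 0),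
    (0, 4, 22, 0, 0), (0, 5, 7, 2, 0), (0, 6, 25, 0, 0), (0, 9, 15, 2, 0), (0, 10, 16, 2, 0),
    (0, 11, 13, 2, 0), (0, 17, 19, 0, 0), (0, 18, 21, 0, 0), (1, 14, 25, 2, 2), (3, 12, 25, 2,
    2), (4, 15, 25, 2, 2), (5, 13, 25, 0, 0), (10, 23, 25, 0, 0), (17, 22, 25, 2, 3), (11, 18,
    25, 0, 0), (2, 16, 25, 2, 2), (7, 20, 25, 0, 0), (8, 21, 25, 0, 0), (9, 19, 25, 0, 0), (1,
    4, 5, 2, 0), (1, 8, 9, 0, 0), (1, 10, 24, 1, 3), (1, 11, 17, 0, 0), (1, 2, 20, 0, 0), (1,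
    16, 18, 2, 2), (1, 3, 24, 0, 1), (1, 6, 22, 0, 0), (1, 7, 21, 2, 0), (1, 13, 15, 2, 2), (1,
    19, 23, 2, 2), (2, 4, 8, 2, 0), (2, 7, 11, 0, 2), (2, 10, 19, 0, 0), (2, 6, 13, 2, 2), (2,
    3, 24, 0, 2), (2, 5, 9, 0, 2), (2, 17, 21, 1, 1), (2, 12, 22, 2, 2), (2, 15, 24, 0, 3), (2,
    18, 23, 0, 0), (4, 9, 11, 0, 2), (3, 11, 16, 2, 0), (10, 11, 14, 2, 2), (11, 22, 24, 2, 0),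
    (8, 11, 23, 1, 3), (5, 11, 24, 1, 3), (6, 11, 15, 3, 1), (11, 12, 20, 1, 3), (11, 19, 21, 0,
    0), (3, 4, 19, 2, 2), (4, 10, 13, 2, 0), (4, 6, 18, 2, 2), (4, 7, 17, 2, 2), (4, 12, 23, 0,
    2), (4, 14, 24, 0, 0), (4, 16, 21, 0, 0), (4, 20, 24, 1, 0), (5, 6, 19, 1, 3), (16, 19, 20,
    0, 0), (7, 12, 19, 2, 0), (13, 18, 19, 0, 0), (8, 19, 24, 0, 0), (14, 19, 24, 0, 1), (15,
    19, 22, 0, 0), (12, 13, 16, 3, 0), (8, 13, 17, 2, 0), (9, 13, 24, 0, 0), (13, 22, 24, 0, 1),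
    (3, 7, 13, 1, 1), (13, 14, 20, 1, 3), (13, 21, 23, 2, 0), (8, 20, 22, 3, 0), (14, 16, 22, 0,
    0), (7, 22, 23, 1, 3), (5, 10, 22, 3, 1), (3, 18, 22, 0, 0), (9, 21, 22, 0, 0), (5, 16, 24,
    1, 0), (5, 8, 18, 2, 2), (5, 12, 17, 3, 1), (5, 14, 23, 0, 0), (3, 5, 20, 2, 2), (5, 15, 21,
    0, 0), (10, 20, 21, 2, 0), (3, 14, 21, 2, 2), (6, 21, 24, 0, 0), (12, 21, 24, 3, 1), (3, 15,
    23, 0, 0), (15, 18, 20, 2, 2), (3, 6, 9, 2, 0), (3, 10, 17, 0, 0), (6, 20, 23, 0, 0), (9,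
    17, 20, 2, 0), (9, 16, 23, 0, 0), (17, 23, 24, 3, 1), (17, 18, 24, 1, 0), (6, 16, 17, 0, 0),
    (14, 15, 17, 0, 3), (6, 12, 14, 3, 0), (7, 8, 14, 0, 0), (9, 14, 18, 2, 0), (6, 7, 24, 1,
    0), (6, 8, 10, 3, 2), (7, 9, 24, 0, 1), (7, 15, 16, 2, 2), (7, 10, 18, 0, 2), (8, 16, 24, 0,
    1), (8, 12, 15, 3, 0), (9, 10, 12, 0, 0), (10, 15, 24, 0, 0), (12, 18, 24, 0, 1)]

lemma D42_ok : okD D42 4 2 = true := by decide +kernel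

/-- Base descriptor for `s = 4`, `r = 4`. -/
def D44 : Desc where
  tri := z5
    [(0, 10, 25, 2, 0), (1, 19, 25, 2, 0), (2, 4, 25, 2, 0), (3, 14, 25, 0, 2), (5, 20, 25, 0,
    2), (6, 11, 25, 2, 0), (7, 17, 25, 2, 0), (8, 12, 25, 2, 0), (9, 18, 25, 2, 0), (13, 16, 25,
    2, 0), (15, 21, 25, 2, 0), (22, 23, 25, 2, 0), (0, 1, 27, 2, 0), (0, 2, 16, 3, 3), (0, 3,
    26, 2, 0), (0, 5, 11, 0, 2), (0, 7, 22, 1, 1), (0, 8, 13, 2, 0), (0, 9, 19, 0, 2), (0, 15,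
    18, 0, 2), (0, 4, 17, 0, 2), (0, 6, 12, 2, 0), (0, 14, 20, 2, 0), (0, 21, 23, 2, 0), (1, 2,
    14, 1, 3), (1, 5, 6, 2, 2), (1, 7, 18, 2, 0), (1, 8, 9, 2, 0), (1, 10, 21, 0, 0), (1, 3, 22,
    0, 0), (1, 4, 11, 2, 0), (1, 13, 17, 2, 0), (1, 12, 16, 2, 0), (1, 15, 23, 2, 0), (1, 20,
    26, 2, 0), (2, 5, 8, 2, 0), (2, 3, 7, 3, 1), (2, 15, 20, 2, 0), (2, 6, 23, 2, 0), (2, 9, 12,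
    2, 0), (2, 10, 18, 3, 0), (2, 11, 13, 2, 0), (2, 22, 26, 2, 0), (2, 17, 27, 2, 0), (2, 19,
    21, 2, 0), (3, 5, 21, 0, 2), (3, 9, 17, 1, 1), (3, 6, 18, 2, 0), (3, 13, 19, 2, 0), (3, 10,
    12, 0, 0), (3, 15, 27, 2, 0), (3, 4, 23, 2, 0), (3, 8, 20, 2, 0), (3, 11, 16, 2, 0), (5, 14,
    17, 2, 0), (5, 18, 23, 3, 2), (5, 12, 26, 2, 0), (5, 10, 13, 2, 0), (5, 7, 19, 1, 1), (4, 5,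
    15, 2, 0), (5, 9, 22, 3, 0), (5, 16, 27, 2, 0), (7, 12, 15, 2, 0), (13, 15, 26, 2, 0), (6,
    9, 15, 0, 0), (8, 11, 15, 2, 0), (14, 15, 19, 2, 0), (10, 15, 16, 2, 0), (15, 17, 22, 2, 0),
    (12, 17, 19, 0, 2), (12, 14, 23, 0, 0), (7, 13, 23, 3, 2), (9, 13, 14, 0, 0), (6, 13, 20, 2,
    0), (4, 13, 27, 2, 0), (12, 13, 18, 0, 0), (13, 21, 22, 0, 0), (4, 12, 21, 2, 0), (11, 12,
    22, 0, 2), (12, 20, 27, 2, 0), (4, 9, 26, 2, 0), (9, 16, 20, 2, 0), (7, 9, 21, 0, 0), (4, 7,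
    20, 1, 3), (9, 10, 27, 0, 0), (9, 11, 23, 2, 0), (19, 23, 27, 2, 0), (10, 20, 23, 2, 0),
    (19, 20, 22, 2, 0), (8, 17, 23, 1, 1), (16, 23, 26, 2, 0), (7, 8, 16, 0, 2), (10, 17, 26, 0,
    0), (6, 17, 21, 1, 1), (16, 17, 18, 3, 3), (11, 17, 20, 2, 0), (14, 16, 21, 0, 2), (18, 20,
    21, 0, 0), (8, 21, 26, 2, 0), (11, 21, 27, 2, 0), (4, 16, 19, 2, 0), (6, 16, 22, 2, 0), (7,
    14, 27, 3, 1), (6, 8, 27, 2, 0), (18, 22, 27, 2, 0), (4, 6, 14, 0, 0), (4, 8, 18, 1, 0), (4,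
    10, 22, 2, 0), (8, 10, 19, 0, 0), (6, 7, 10, 0, 0), (6, 19, 26, 2, 0), (7, 11, 26, 2, 0),
    (8, 14, 22, 1, 1), (10, 11, 14, 2, 0), (11, 18, 19, 2, 0), (14, 18, 26, 2, 0)]
  half := []
  spec := z3
    [(0, 24, 0), (1, 24, 0), (2, 24, 0), (3, 24, 3), (4, 24, 0), (5, 24, 0), (6, 24, 1), (7, 24,
    0), (8, 24, 3), (9, 24, 0), (10, 24, 3), (11, 24, 2), (12, 24, 0), (13, 24, 3), (14, 24, 0),
    (15, 24, 0), (16, 24, 0), (17, 24, 2), (18, 24, 2), (19, 24, 0), (20, 24, 1), (21, 24, 3),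
    (22, 24, 2), (23, 24, 2)]
  sg := z5
    [(0, 5, 24, 0, 0), (0, 3, 24, 2, 3), (0, 19, 25, 0, 0), (0, 17, 26, 0, 0), (0, 1, 13, 2, 2),
    (0, 2, 18, 3, 1), (0, 4, 7, 0, 1), (0, 6, 14, 2, 0), (0, 8, 11, 2, 2), (0, 9, 23, 0, 0), (0,
    10, 21, 2, 0), (0, 12, 16, 0, 0), (0, 15, 27, 0, 0), (0, 20, 22, 0, 0), (1, 11, 25, 0, 0),
    (2, 13, 25, 0, 0), (4, 15, 25, 0, 0), (6, 23, 25, 0, 0), (10, 20, 25, 2, 2), (12, 21, 25, 0,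
    0), (3, 5, 25, 0, 0), (7, 16, 25, 0, 0), (8, 18, 25, 0, 0), (9, 14, 25, 2, 2), (17, 22, 25,
    0, 0), (1, 9, 26, 0, 0), (2, 12, 26, 0, 0), (4, 22, 26, 0, 0), (6, 7, 26, 0, 0), (8, 13, 26,
    0, 0), (5, 10, 26, 2, 2), (3, 16, 26, 0, 0), (11, 14, 26, 0, 0), (15, 23, 26, 0, 0), (18,
    19, 26, 0, 0), (20, 21, 26, 0, 0), (1, 4, 17, 2, 2), (1, 6, 16, 2, 2), (1, 2, 10, 1, 3), (1,
    15, 18, 2, 2), (1, 14, 20, 2, 0), (1, 3, 8, 0, 2), (1, 12, 23, 2, 2), (1, 22, 24, 2, 2), (1,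
    21, 24, 2, 3), (1, 5, 19, 2, 0), (1, 7, 27, 2, 2), (2, 4, 19, 2, 0), (2, 6, 8, 2, 2), (2, 3,
    14, 3, 0), (2, 9, 27, 2, 2), (2, 20, 23, 0, 0), (2, 7, 15, 2, 0), (2, 16, 17, 3, 3), (2, 5,
    21, 2, 2), (2, 11, 24, 2, 2), (2, 22, 24, 2, 3), (4, 8, 24, 1, 3), (4, 12, 14, 2, 0), (4, 5,
    11, 2, 2), (3, 4, 20, 2, 2), (4, 6, 10, 0, 2), (4, 9, 13, 2, 0), (4, 18, 24, 3, 2), (4, 16,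
    21, 2, 2), (4, 23, 27, 0, 0), (5, 23, 24, 3, 2), (5, 6, 12, 2, 0), (5, 7, 20, 1, 3), (5, 9,
    17, 3, 1), (5, 8, 27, 0, 0), (5, 14, 15, 2, 2), (5, 13, 16, 0, 2), (5, 18, 22, 3, 2), (8,
    15, 20, 0, 0), (15, 16, 22, 0, 0), (8, 9, 16, 0, 2), (11, 16, 20, 0, 0), (16, 18, 27, 0, 0),
    (10, 16, 19, 0, 0), (14, 16, 24, 0, 0), (16, 23, 24, 2, 3), (9, 19, 20, 2, 2), (17, 20, 27,
    0, 0), (6, 20, 24, 0, 1), (12, 20, 24, 2, 2), (13, 18, 20, 0, 0), (14, 22, 27, 1, 0), (10,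
    13, 27, 0, 0), (11, 12, 27, 0, 0), (3, 19, 27, 0, 0), (6, 21, 27, 0, 0), (6, 17, 18, 1, 3),
    (6, 9, 11, 0, 2), (6, 13, 22, 2, 2), (3, 6, 24, 2, 2), (6, 15, 19, 2, 0), (9, 15, 24, 0, 0),
    (9, 18, 21, 2, 2), (9, 12, 24, 0, 1), (3, 7, 9, 1, 0), (9, 10, 22, 0, 0), (7, 12, 18, 2, 2),
    (3, 10, 18, 0, 0), (11, 18, 23, 2, 2), (14, 18, 24, 2, 3), (10, 12, 17, 0, 0), (8, 12, 22,
    2, 2), (12, 13, 19, 0, 0), (3, 12, 15, 2, 0), (10, 15, 24, 2, 1), (7, 10, 11, 0, 2), (8, 10,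
    24, 0, 0), (10, 14, 23, 0, 0), (3, 21, 22, 0, 0), (11, 19, 22, 0, 0), (7, 22, 23, 1, 2), (3,
    11, 17, 2, 2), (3, 13, 23, 2, 2), (11, 15, 21, 0, 2), (11, 13, 24, 0, 3), (13, 15, 17, 2,
    2), (7, 13, 14, 3, 0), (13, 21, 24, 0, 0), (7, 17, 24, 2, 2), (7, 19, 24, 1, 0), (7, 8, 21,
    0, 2), (17, 19, 24, 2, 1), (8, 14, 17, 1, 0), (8, 19, 23, 2, 2), (14, 19, 21, 0, 0), (17,
    21, 23, 1, 0)]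

lemma D44_ok : okD D44 4 4 = true := by decide +kernel

/-- Base descriptor for `s = 4`, `r = 5`. -/
def D45 : Desc where
  tri := z5
    [(0, 7, 24, 2, 2), (2, 9, 24, 2, 0), (3, 16, 24, 0, 2), (5, 18, 24, 2, 0), (8, 14, 24, 2,
    0), (4, 15, 24, 3, 1), (19, 23, 24, 1, 0), (6, 10, 24, 2, 0), (1, 20, 24, 0, 2), (11, 21,
    24, 3, 0), (12, 22, 24, 2, 2), (13, 17, 24, 2, 0), (0, 2, 8, 2, 0), (0, 3, 22, 0, 2), (0, 5,
    6, 1, 1), (0, 13, 21, 1, 1), (0, 9, 25, 2, 0), (0, 14, 15, 2, 2), (0, 4, 19, 0, 2), (0, 17,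
    26, 2, 0), (0, 18, 27, 2, 0), (0, 10, 28, 1, 1), (0, 12, 23, 0, 2), (0, 16, 20, 2, 0), (2,
    3, 11, 2, 0), (2, 12, 17, 2, 0), (2, 18, 19, 2, 0), (1, 2, 28, 2, 0), (2, 13, 25, 2, 0), (2,
    10, 20, 2, 0), (2, 5, 15, 3, 0), (2, 22, 26, 0, 2), (2, 7, 16, 1, 0), (2, 14, 21, 2, 0), (2,
    23, 27, 2, 0), (3, 13, 14, 2, 0), (3, 12, 18, 2, 0), (3, 7, 28, 2, 0), (3, 4, 9, 3, 0), (1,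
    3, 26, 2, 0), (3, 5, 17, 2, 0), (3, 10, 25, 2, 0), (3, 6, 19, 3, 2), (3, 8, 27, 2, 0), (3,
    15, 21, 2, 0), (10, 12, 15, 2, 0), (15, 23, 26, 1, 0), (7, 15, 19, 1, 0), (15, 16, 27, 0,
    2), (9, 11, 15, 3, 0), (15, 18, 28, 2, 0), (1, 8, 15, 0, 0), (6, 15, 17, 3, 3), (15, 22, 25,
    2, 0), (14, 19, 25, 2, 0), (1, 12, 19, 2, 0), (19, 22, 27, 2, 0), (8, 10, 19, 0, 1), (13,
    19, 20, 1, 0), (16, 19, 26, 2, 0), (5, 9, 19, 2, 0), (19, 21, 28, 2, 0), (10, 18, 26, 2, 2),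
    (9, 10, 13, 3, 2), (7, 9, 26, 0, 2), (14, 20, 26, 1, 1), (5, 21, 26, 2, 0), (4, 13, 26, 2,
    0), (6, 11, 26, 1, 1), (8, 12, 26, 2, 0), (6, 12, 13, 3, 3), (11, 13, 27, 2, 0), (13, 18,
    22, 0, 2), (1, 5, 13, 3, 3), (7, 8, 13, 2, 0), (13, 23, 28, 2, 0), (9, 12, 28, 1, 3), (4,
    12, 16, 2, 0), (11, 12, 25, 3, 3), (7, 12, 20, 0, 2), (12, 21, 27, 2, 0), (4, 5, 25, 0, 2),
    (5, 7, 11, 2, 0), (5, 8, 20, 2, 0), (5, 14, 27, 3, 0), (5, 10, 16, 0, 0), (5, 22, 28, 2, 0),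
    (4, 10, 27, 0, 2), (6, 7, 27, 2, 0), (1, 9, 27, 2, 0), (17, 20, 27, 2, 0), (6, 20, 28, 2,
    0), (9, 20, 23, 2, 0), (18, 20, 25, 2, 0), (4, 11, 20, 0, 2), (20, 21, 22, 0, 2), (6, 9, 14,
    2, 0), (9, 17, 18, 2, 0), (9, 16, 21, 0, 0), (6, 22, 23, 1, 0), (1, 6, 25, 3, 3), (6, 8, 21,
    0, 0), (6, 16, 18, 2, 0), (8, 18, 23, 2, 0), (4, 8, 28, 3, 3), (4, 14, 18, 0, 2), (1, 11,
    18, 3, 3), (8, 11, 17, 3, 3), (8, 16, 25, 2, 0), (16, 17, 28, 2, 0), (11, 14, 28, 2, 0),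
    (10, 11, 23, 2, 0), (11, 16, 22, 2, 0), (14, 16, 23, 2, 0), (1, 7, 14, 1, 1), (10, 14, 22,
    2, 0), (1, 10, 17, 2, 0), (1, 4, 22, 2, 0), (1, 21, 23, 2, 0), (7, 17, 22, 2, 0), (4, 7, 21,
    0, 2), (4, 17, 23, 2, 0), (7, 23, 25, 2, 0), (17, 21, 25, 0, 0)]
  half := []
  spec := z3
    [(12, 5, 0), (5, 23, 0), (23, 3, 0), (3, 20, 2), (20, 15, 3), (15, 13, 2), (13, 16, 0), (16,
    1, 1), (1, 0, 2), (0, 11, 0), (11, 19, 2), (19, 17, 2), (17, 14, 2), (14, 12, 2), (7, 10,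
    3), (10, 21, 2), (21, 18, 0), (18, 7, 0), (4, 2, 0), (2, 6, 1), (6, 4, 0), (8, 9, 0), (9,
    22, 0), (22, 8, 0)]
  sg := z5
    [(0, 4, 24, 0, 2), (1, 12, 24, 2, 2), (2, 17, 24, 0, 0), (3, 22, 24, 2, 2), (5, 7, 24, 2,
    2), (6, 8, 24, 0, 0), (9, 11, 24, 3, 1), (10, 23, 24, 0, 0), (13, 19, 24, 1, 3), (14, 16,
    24, 2, 2), (15, 20, 24, 3, 2), (18, 21, 24, 0, 0), (0, 11, 25, 0, 0), (1, 8, 25, 0, 0), (2,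
    19, 25, 0, 0), (3, 18, 25, 0, 0), (5, 9, 25, 2, 0), (10, 15, 25, 0, 0), (14, 22, 25, 0, 0),
    (4, 17, 25, 2, 2), (6, 23, 25, 3, 0), (7, 20, 25, 0, 0), (12, 13, 25, 3, 0), (16, 21, 25, 0,
    0), (1, 2, 16, 2, 3), (2, 3, 6, 2, 3), (0, 2, 5, 2, 3), (2, 6, 21, 2, 2), (2, 10, 27, 2, 2),
    (2, 7, 14, 1, 1), (2, 9, 28, 2, 2), (2, 12, 20, 2, 2), (2, 4, 13, 0, 2), (2, 4, 8, 1, 3),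
    (2, 11, 22, 0, 0), (2, 15, 23, 1, 1), (2, 18, 26, 2, 2), (3, 4, 15, 3, 3), (4, 7, 11, 0, 0),
    (4, 16, 26, 0, 0), (4, 6, 27, 0, 0), (1, 4, 6, 2, 1), (4, 9, 18, 0, 0), (4, 5, 10, 0, 0),
    (4, 12, 21, 2, 2), (4, 14, 23, 0, 0), (4, 19, 22, 2, 2), (4, 20, 28, 0, 0), (5, 6, 15, 1,
    3), (6, 7, 10, 2, 0), (6, 9, 26, 2, 2), (6, 12, 22, 3, 2), (6, 13, 14, 0, 0), (6, 19, 20, 2,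
    0), (0, 6, 28, 0, 0), (6, 11, 18, 1, 3), (6, 16, 17, 2, 2), (3, 5, 12, 2, 0), (5, 12, 14, 1,
    2), (5, 22, 26, 2, 2), (5, 16, 19, 2, 2), (5, 17, 28, 0, 0), (1, 5, 27, 3, 1), (5, 11, 23,
    0, 0), (5, 8, 21, 2, 0), (5, 13, 23, 3, 2), (5, 18, 20, 2, 2), (12, 19, 26, 0, 0), (17, 23,
    26, 0, 0), (7, 12, 23, 0, 2), (10, 12, 28, 2, 3), (9, 12, 15, 1, 0), (8, 12, 16, 2, 0), (11,
    12, 14, 3, 3), (0, 12, 27, 0, 0), (12, 17, 18, 0, 0), (3, 14, 28, 0, 0), (11, 15, 28, 0, 0),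
    (8, 19, 28, 3, 0), (21, 23, 28, 0, 0), (1, 13, 28, 0, 0), (7, 22, 28, 0, 0), (16, 18, 28, 0,
    0), (18, 23, 27, 0, 0), (3, 19, 23, 3, 1), (0, 8, 23, 0, 0), (3, 9, 23, 1, 0), (1, 22, 23,
    0, 0), (16, 20, 23, 0, 0), (7, 8, 18, 2, 2), (0, 18, 22, 2, 2), (13, 18, 21, 0, 1), (7, 10,
    18, 3, 2), (1, 15, 18, 2, 2), (14, 18, 19, 2, 0), (0, 15, 16, 2, 0), (15, 19, 27, 0, 0), (7,
    15, 26, 1, 3), (13, 15, 22, 2, 2), (13, 15, 17, 3, 3), (8, 14, 15, 2, 2), (15, 20, 21, 0,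
    0), (10, 16, 22, 0, 0), (9, 21, 22, 2, 2), (1, 3, 16, 2, 0), (11, 16, 27, 2, 2), (7, 13, 16,
    0, 0), (9, 13, 16, 3, 1), (8, 13, 27, 0, 0), (8, 17, 22, 0, 0), (8, 9, 22, 0, 1), (20, 22,
    27, 0, 0), (8, 9, 10, 1, 3), (3, 8, 20, 2, 0), (8, 11, 26, 3, 1), (3, 17, 27, 0, 0), (0, 3,
    7, 0, 2), (7, 9, 27, 0, 0), (14, 21, 27, 0, 0), (1, 7, 19, 1, 3), (7, 17, 21, 2, 0), (9, 17,
    19, 2, 2), (0, 9, 14, 2, 0), (1, 9, 20, 2, 2), (1, 14, 26, 0, 0), (10, 14, 17, 2, 2), (14,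
    17, 20, 3, 2), (0, 1, 17, 2, 0), (11, 17, 19, 3, 3), (0, 1, 10, 3, 2), (1, 11, 21, 3, 3),
    (0, 11, 19, 1, 3), (0, 21, 26, 0, 0), (0, 13, 20, 1, 3), (3, 10, 21, 2, 2), (10, 19, 21, 1,
    2), (3, 11, 13, 0, 2), (3, 20, 26, 3, 1), (10, 11, 20, 2, 2), (10, 13, 26, 2, 0)]

lemma D45_ok : okD D45 4 5 = true := by decide +kernel


/-! ### Counting: a small covering family is an optimal code -/

/-- The codeword of a triple. -/
def toF {m n : ℕ} (T : Tr (Fin m) n) : Finset (Fin m × ZMod n) := {T.1, T.2.1, T.2.2}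

lemma mem_toF {m n : ℕ} (T : Tr (Fin m) n) (p : Fin m × ZMod n) : p ∈ toF T ↔ p ∈ pts T := by
  simp [toF, pts]

/-- The difference type of a pair of points of a codeword. -/
def dif {m n : ℕ} (x : Σ _ : Finset (Fin m × ZMod n), (Fin m × ZMod n) × (Fin m × ZMod n)) :
    Fin m × Fin m × ZMod n := (x.2.1.1, x.2.2.1, x.2.1.2 - x.2.2.2)

lemma card_shape {m n : ℕ} [NeZero n] (R : Finset (Fin m)) (hf : ZMod n) (N : ℕ)
    (hN : 6 * N + R.card * (R.card * n) + 2 * (m - R.card) = m * (m * n)) :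
    6 * N ≤ ((Finset.univ : Finset (Fin m × Fin m × ZMod n)).filter fun w =>
      ¬ (w.1 ∈ R ∧ w.2.1 ∈ R) ∧ (w.1 = w.2.1 → w.2.2 ≠ 0 ∧ w.2.2 ≠ hf)).card := by
  set D := (Finset.univ : Finset (Fin m × Fin m × ZMod n)).filter fun w =>
      ¬ (w.1 ∈ R ∧ w.2.1 ∈ R) ∧ (w.1 = w.2.1 → w.2.2 ≠ 0 ∧ w.2.2 ≠ hf) with hD
  have hsub : Dᶜ ⊆ (R ×ˢ R ×ˢ Finset.univ) ∪
      ((Rᶜ.image fun i => (i, i, (0 : ZMod n))) ∪ (Rᶜ.image fun i => (i, i, hf))) := by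
    rintro ⟨i, j, z⟩ hw
    simp only [hD, Finset.mem_compl, Finset.mem_filter, Finset.mem_univ, true_and] at hw
    simp only [Finset.mem_union, Finset.mem_product, Finset.mem_univ, and_true, Finset.mem_image,
      Finset.mem_compl, Prod.mk.injEq]
    by_cases h1 : i ∈ R ∧ j ∈ R
    · exact Or.inl h1
    · right
      by_cases hij : i = j
      · subst hij
        have hi : i ∉ R := fun h => h1 ⟨h, h⟩
        by_cases hz : z = 0
        · exact Or.inl ⟨i, hi, rfl, rfl, hz.symm⟩
        · by_cases hz' : z = hf
          · exact Or.inr ⟨i, hi, rfl, rfl, hz'.symm⟩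
          · exact absurd ⟨h1, fun _ => ⟨hz, hz'⟩⟩ hw
      · exact absurd ⟨h1, fun h => absurd h hij⟩ hw
  have h1 := Finset.card_le_card hsub
  have h2 := Finset.card_union_le (R ×ˢ R ×ˢ (Finset.univ : Finset (ZMod n)))
    ((Rᶜ.image fun i => (i, i, (0 : ZMod n))) ∪ (Rᶜ.image fun i => (i, i, hf)))
  have h3 := Finset.card_union_le (Rᶜ.image fun i => (i, i, (0 : ZMod n)))
    (Rᶜ.image fun i => (i, i, hf))
  have h4 := Finset.card_image_le (s := Rᶜ) (f := fun i => (i, i, (0 : ZMod n)))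
  have h5 := Finset.card_image_le (s := Rᶜ) (f := fun i => (i, i, hf))
  have h6 : (R ×ˢ R ×ˢ (Finset.univ : Finset (ZMod n))).card = R.card * (R.card * n) := by
    simp [Finset.card_product, ZMod.card]
  have h7 : Rᶜ.card = m - R.card := by simp [Finset.card_compl]
  have h8 : D.card + Dᶜ.card = m * (m * n) := by
    rw [Finset.card_add_card_compl]
    simp [ZMod.card]
  omega

lemma counting {m n : ℕ} [NeZero n] (R : Finset (Fin m)) (hf : ZMod n) (N : ℕ)
    (hN : 6 * N + R.card * (R.card * n) + 2 * (m - R.card) = m * (m * n))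
    (L : List (Tr (Fin m) n)) (hL : L.length ≤ N)
    (hcov : ∀ i j z, ¬ (i ∈ R ∧ j ∈ R) → (i = j → z ≠ 0 ∧ z ≠ hf) → Cov L i j z) :
    ∃ C : Finset (Finset (Fin m × ZMod n)),
      IsOOC m n 3 1 C ∧ (∀ i ∈ R, ∀ j ∈ R, Delta i j C = 0) ∧ C.card = N := by
  have hD1 := card_shape R hf N hN
  set D := (Finset.univ : Finset (Fin m × Fin m × ZMod n)).filter fun w =>
      ¬ (w.1 ∈ R ∧ w.2.1 ∈ R) ∧ (w.1 = w.2.1 → w.2.2 ≠ 0 ∧ w.2.2 ≠ hf) with hD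
  set C : Finset (Finset (Fin m × ZMod n)) := (L.map toF).toFinset with hC
  have hCN : C.card ≤ N := by
    refine (List.toFinset_card_le _).trans ?_
    simpa using hL
  have hc3 : ∀ B ∈ C, B.card ≤ 3 := by
    intro B hB
    simp only [hC, List.mem_toFinset, List.mem_map] at hB
    obtain ⟨T, -, rfl⟩ := hB
    exact Finset.card_le_three
  have hoff : ∀ B ∈ C, B.offDiag.card ≤ 6 := by
    intro B hB
    have := hc3 B hB
    rw [Finset.offDiag_card]
    interval_cases B.card <;> simp
  set S : Finset (Σ _ : Finset (Fin m × ZMod n), (Fin m × ZMod n) × (Fin m × ZMod n)) :=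
    C.sigma fun B => B.offDiag with hS
  have hScard : S.card = ∑ B ∈ C, B.offDiag.card := Finset.card_sigma _ _
  have hS6 : ∑ B ∈ C, B.offDiag.card ≤ ∑ _B ∈ C, 6 := Finset.sum_le_sum hoff
  have h6C : ∑ _B ∈ C, 6 = 6 * C.card := by simp [mul_comm]
  have himg : D ⊆ S.image dif := by
    rintro ⟨i, j, z⟩ hw
    simp only [hD, Finset.mem_filter, Finset.mem_univ, true_and] at hw
    obtain ⟨T, hT, p, hp, q, hq, h1, h2, h3⟩ := hcov i j z hw.1 hw.2
    refine Finset.mem_image.2 ⟨⟨toF T, (p, q)⟩, ?_, ?_⟩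
    · simp only [hS, Finset.mem_sigma, Finset.mem_offDiag, mem_toF]
      refine ⟨by simp only [hC, List.mem_toFinset]; exact List.mem_map_of_mem hT, hp, hq, ?_⟩
      rintro rfl
      have hij : i = j := h1.symm.trans h2
      exact (hw.2 hij).1 (by rw [← h3]; simp)
    · simp [dif, h1, h2, h3]
  have hcI : (S.image dif).card ≤ S.card := Finset.card_image_le
  have hDI := Finset.card_le_card himg
  have hCeq : C.card = N := by omega
  have hcS : (S.image dif).card = S.card := by omega
  have hinj := Finset.card_image_iff.1 hcS
  have hDeq : D = S.image dif := Finset.eq_of_subset_of_card_le himg (by omega)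
  have heach : ∀ B ∈ C, B.offDiag.card = 6 :=
    (Finset.sum_eq_sum_iff_of_le hoff).1 (by omega)
  have hmem : ∀ B ∈ C, ∀ p ∈ B, ∀ q ∈ B, p ≠ q →
      (⟨B, (p, q)⟩ : Σ _ : Finset (Fin m × ZMod n), (Fin m × ZMod n) × (Fin m × ZMod n)) ∈ S := by
    intro B hB p hp q hq hpq
    simp only [hS, Finset.mem_sigma, Finset.mem_offDiag]
    exact ⟨hB, hp, hq, hpq⟩
  have hcross : ∀ A ∈ C, ∀ B ∈ C, ∀ τ : ZMod n, 1 < (A ∩ OOCshift B τ).card → A = B ∧ τ = 0 := by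
    intro A hA B hB τ hcard
    obtain ⟨p, hp, q, hq, hpq⟩ := Finset.one_lt_card.1 hcard
    rw [Finset.mem_inter] at hp hq
    obtain ⟨hpA, hpB⟩ := hp
    obtain ⟨hqA, hqB⟩ := hq
    simp only [OOCshift, Finset.mem_image] at hpB hqB
    obtain ⟨p', hp', rfl⟩ := hpB
    obtain ⟨q', hq', rfl⟩ := hqB
    have hpq' : p' ≠ q' := by
      rintro rfl
      exact hpq rfl
    have := hinj (Finset.mem_coe.2 (hmem A hA _ hpA _ hqA hpq))
      (Finset.mem_coe.2 (hmem B hB _ hp' _ hq' hpq')) (by simp [dif])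
    rw [Sigma.mk.injEq] at this
    obtain ⟨h1, h2⟩ := this
    have h2 := congrArg (fun x => x.1.2) (eq_of_heq h2)
    refine ⟨h1, ?_⟩
    simpa using h2
  refine ⟨C, ⟨?_, ?_, ?_⟩, ?_, hCeq⟩
  · intro B hB
    have h1 := heach B hB
    have h2 := hc3 B hB
    rw [Finset.offDiag_card] at h1
    generalize B.card = x at h1 h2 ⊢
    clear_value D C S
    interval_cases x <;> omega
  · intro A hA τ hτ
    by_contra hlt
    exact hτ (hcross A hA A hA τ (by omega)).2
  · intro A hA B hB hAB τ
    by_contra hlt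
    exact hAB (hcross A hA B hB τ (by omega)).1
  · intro i hi j hj
    refine Multiset.eq_zero_of_forall_notMem fun z hz => ?_
    unfold Delta at hz
    obtain ⟨B, hB, hz⟩ := Multiset.mem_sum.1 hz
    obtain ⟨⟨p, q⟩, hpq, hz⟩ := Multiset.mem_map.1 hz
    rw [Finset.mem_val, Finset.mem_filter, Finset.mem_product] at hpq
    obtain ⟨⟨hp, hq⟩, hne, h1, h2⟩ := hpq
    have hin : dif ⟨B, (p, q)⟩ ∈ D := by
      rw [hDeq]
      exact Finset.mem_image_of_mem _ (hmem B hB p hp q hq hne)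
    simp only [hD, Finset.mem_filter, dif] at hin
    exact hin.2.1 ⟨(show p.1 = i from h1) ▸ hi, (show q.1 = j from h2) ▸ hj⟩

/-- All base cases. -/
lemma bases (r t s : ℕ) (hr : r = 1 ∨ r = 2 ∨ r = 4 ∨ r = 5) (ht : 1 ≤ t) (hs : 1 ≤ s) :
    HasP (Fin (6 * s)) r t (NN s r t) := by
  rcases hr with rfl | rfl | rfl | rfl
  · exact rec_all _ t ht (okD_sound D11 1 1 t (by omega) ht D11_ok)
      (okD_sound D21 2 1 t (by omega) ht D21_ok) (okD_sound D41 4 1 t (by omega) ht D41_ok) s hs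
  · exact rec_all _ t ht (okD_sound D12 1 2 t (by omega) ht D12_ok)
      (okD_sound D22 2 2 t (by omega) ht D22_ok) (okD_sound D42 4 2 t (by omega) ht D42_ok) s hs
  · exact rec_all _ t ht (okD_sound D14 1 4 t (by omega) ht D14_ok)
      (okD_sound D24 2 4 t (by omega) ht D24_ok) (okD_sound D44 4 4 t (by omega) ht D44_ok) s hs
  · exact rec_all _ t ht (okD_sound D15 1 5 t (by omega) ht D15_ok)
      (okD_sound D25 2 5 t (by omega) ht D25_ok) (okD_sound D45 4 5 t (by omega) ht D45_ok) s hs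

lemma final (s r t : ℕ) (hr : r = 1 ∨ r = 2 ∨ r = 4 ∨ r = 5) (ht : 1 ≤ t) (hs : 1 ≤ s) :
    ∃ (R : Finset (Fin (6 * s + r))) (C : Finset (Finset (Fin (6 * s + r) × ZMod (4 * t)))),
      R.card = r ∧ IsOOC (6 * s + r) (4 * t) 3 1 C ∧ (∀ i ∈ R, ∀ j ∈ R, Delta i j C = 0) ∧
      C.card = NN s r t := by
  have : NeZero (4 * t) := ⟨by omega⟩
  obtain ⟨L, h0, h1, h2, h3⟩ := bases r t s hr ht hs
  set φ : Fin (6 * s) ⊕ Fin r → Fin (6 * s + r) :=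
    fun x => finSumFinEquiv x with hφ
  set R : Finset (Fin (6 * s + r)) := (Finset.univ : Finset (Fin r)).map (Fin.natAddEmb (6 * s))
    with hR
  have hRc : R.card = r := by simp [hR]
  have hin : ∀ x : Fin r, φ (Sum.inr x) ∈ R := by
    intro x
    simp [hR, hφ]
  obtain ⟨C, hC⟩ := counting R ((2 * t : ℕ) : ZMod (4 * t)) (NN s r t) (by
      rw [hRc]
      have := NN_add s r t ht
      have e : 6 * s + r - r = 6 * s := by omega
      rw [e]
      linear_combination 6 * this) (L.map (Tr.mp φ)) (by simpa using h0) (by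
      intro i j z hij hz
      obtain ⟨x, rfl⟩ := finSumFinEquiv.surjective i
      obtain ⟨y, rfl⟩ := finSumFinEquiv.surjective j
      refine Cov.mp φ ?_
      rcases x with x | x <;> rcases y with y | y
      · by_cases hxy : x = y
        · subst hxy
          obtain ⟨z0, z1⟩ := hz rfl
          obtain ⟨k, hk, rfl⟩ : ∃ k : ℕ, k < 4 * t ∧ z = (k : ZMod (4 * t)) :=
            ⟨z.val, ZMod.val_lt _, by rw [ZMod.natCast_zmod_val]⟩
          have hk0 : k ≠ 0 := by rintro rfl; simp at z0
          have hk1 : k ≠ 2 * t := by rintro rfl; exact z1 rfl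
          by_cases hk2 : k < 2 * t
          · exact h3 x k (by omega) hk2
          · apply Cov.symm_neg
            have := h3 x (4 * t - k) (by omega) (by omega)
            rwa [Nat.cast_sub hk.le, ZMod.natCast_self, zero_sub] at this
        · exact h1 x y hxy z
      · exact h2 x y z
      · exact (h2 y x (-z)).symm_neg
      · exact absurd ⟨hin x, hin y⟩ hij)
  exact ⟨R, C, hRc, hC⟩

end OOC16


theorem stmt_16 (m r n : ℕ) (hr : r = 1 ∨ r = 2 ∨ r = 4 ∨ r = 5)
    (hmr : m % 6 = r) (hm : 7 ≤ m) (hn4 : n % 4 = 0) (hn8 : 8 ≤ n) :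
    ∃ (R : Finset (Fin m)) (C : Finset (Finset (Fin m × ZMod n))),
      R.card = r ∧ IsOOC m n 3 1 C ∧ (∀ i ∈ R, ∀ j ∈ R, Delta i j C = 0) ∧
      C.card = ((m ^ 2 - r ^ 2) * n - 2 * (m - r)) / 6 := by
  obtain ⟨s, rfl⟩ : ∃ s, m = 6 * s + r := ⟨m / 6, by omega⟩
  obtain ⟨t, rfl⟩ : ∃ t, n = 4 * t := ⟨n / 4, by omega⟩
  have hs : 1 ≤ s := by omega
  have ht : 1 ≤ t := by omega
  obtain ⟨R, C, h1, h2, h3, h4⟩ := OOC16.final s r t hr ht hs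
  refine ⟨R, C, h1, h2, h3, ?_⟩
  have e1 := OOC16.NN_add s r t ht
  rw [h4]
  have e2 : (6 * s + r) ^ 2 - r ^ 2 = 36 * s * s + 12 * s * r := by
    rw [show (6 * s + r) ^ 2 = 36 * s * s + 12 * s * r + r ^ 2 by ring]
    omega
  have e3 : 6 * s + r - r = 6 * s := by omega
  rw [e2, e3]
  have e4 : (36 * s * s + 12 * s * r) * (4 * t) = 6 * OOC16.NN s r t + 2 * (6 * s) := by
    have e5 : (36 * s * s + 12 * s * r) * (4 * t) = 6 * (s * (24 * s * t + 8 * r * t)) := by ring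
    rw [e5, ← e1]
    ring
  rw [e4]
  omega
end

section
/- For every positive integer m, Φ(m×2,3,1) = J*(m×2,3,1); that is, there exists an optimal 2-D (m×2,3,1)-OOC with exactly J*(m×2,3,1) codewords, where J(m×2,3,1) = ⌊m(m−1)/3⌋ and J*(m×2,3,1) = J(m×2,3,1) − 1 if m ≡ 3, 5, 6, 7, 8 or 10 (mod 12), and J*(m×2,3,1) = J(m×2,3,1) otherwise. -/
lemma OOC_mem_shift {m n : ℕ} (B : Finset (Fin m × ZMod n)) (τ : ZMod n) (p : Fin m × ZMod n) :
    p ∈ OOCshift B τ ↔ (p.1, p.2 - τ) ∈ B := by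
  unfold OOCshift
  rw [Finset.mem_image]
  constructor
  · rintro ⟨q, hq, rfl⟩
    simpa using hq
  · intro h
    exact ⟨_, h, by simp⟩

/-- partial sums of the labels around a triangle -/
def ooc_pot (l : Fin 3 → ZMod 2) : Fin 3 → ZMod 2 := ![0, l 0, l 0 + l 1]

lemma ooc_pot_succ (l : Fin 3 → ZMod 2) (h : l 0 + l 1 + l 2 = 0) (k : Fin 3) :
    ooc_pot l k + ooc_pot l (k + 1) = l k := by
  have key : ∀ a b c : ZMod 2, a + b + c = 0 → 0 + a = a ∧ a + (a + b) = b ∧ a + b + 0 = c := by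
    decide
  have := key _ _ _ h
  fin_cases k
  · exact this.1
  · exact this.2.1
  · exact this.2.2

lemma fin3_pair (k l : Fin 3) (h : k ≠ l) : ∃ j : Fin 3, (k = j ∧ l = j + 1) ∨ (l = j ∧ k = j + 1) := by
  revert k l; decide

lemma zmod2_sub_add (a b τ : ZMod 2) : (a - τ) + (b - τ) = a + b := by
  revert a b τ; decide

theorem code_of_labels {P B : Type*} [Fintype P] [DecidableEq P] [DecidableEq B] {m : ℕ}
    (hP : Fintype.card P = m) (S : Finset B) (v : B → Fin 3 → P) (lab : B → Fin 3 → ZMod 2)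
    (hv : ∀ b ∈ S, Function.Injective (v b))
    (hl : ∀ b ∈ S, lab b 0 + lab b 1 + lab b 2 = 0)
    (hs : ∀ b ∈ S, ∀ b' ∈ S, ∀ k k', s(v b k, v b (k + 1)) = s(v b' k', v b' (k' + 1)) →
      lab b k = lab b' k' → b = b') :
    ∃ C : Finset (Finset (Fin m × ZMod 2)), IsOOC m 2 3 1 C ∧ C.card = S.card := by
  classical
  let e : P ≃ Fin m := Fintype.equivFinOfCardEq hP
  let w : B → Finset (Fin m × ZMod 2) := fun b =>
    Finset.univ.image fun k : Fin 3 => (e (v b k), ooc_pot (lab b) k)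
  have hmem : ∀ b p, p ∈ w b ↔ ∃ k, (e (v b k), ooc_pot (lab b) k) = p := by
    intro b p; simp [w]
  have hcard : ∀ b ∈ S, (w b).card = 3 := by
    intro b hb
    rw [Finset.card_image_of_injective]
    · simp
    · intro k k' h
      exact hv b hb (e.injective (Prod.ext_iff.1 h).1)
  have key : ∀ b ∈ S, ∀ b' ∈ S, ∀ τ, 1 < (w b ∩ OOCshift (w b') τ).card → b = b' := by
    intro b hb b' hb' τ h
    obtain ⟨p, hp, q, hq, hpq⟩ := Finset.one_lt_card.1 h
    rw [Finset.mem_inter, OOC_mem_shift, hmem, hmem] at hp hq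
    obtain ⟨⟨k, rfl⟩, ⟨k', hk'⟩⟩ := hp
    obtain ⟨⟨l, rfl⟩, ⟨l', hl'⟩⟩ := hq
    have hkl : k ≠ l := by rintro rfl; exact hpq rfl
    simp only [Prod.mk.injEq, EmbeddingLike.apply_eq_iff_eq] at hk' hl'
    have hkl' : k' ≠ l' := by
      rintro rfl
      exact hkl (hv b hb (hk'.1.symm.trans hl'.1))
    have hsum : ooc_pot (lab b') k' + ooc_pot (lab b') l' = ooc_pot (lab b) k + ooc_pot (lab b) l := by
      rw [hk'.2, hl'.2, zmod2_sub_add]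
    obtain ⟨j, hj⟩ := fin3_pair k l hkl
    obtain ⟨j', hj'⟩ := fin3_pair k' l' hkl'
    have h1 := ooc_pot_succ _ (hl b hb) j
    have h2 := ooc_pot_succ _ (hl b' hb') j'
    refine hs b hb b' hb' j j' ?_ ?_
    · rcases hj with ⟨rfl, rfl⟩ | ⟨rfl, rfl⟩ <;> rcases hj' with ⟨rfl, rfl⟩ | ⟨rfl, rfl⟩ <;>
        simp [hk'.1, hl'.1]
    · rw [← h1, ← h2]
      rcases hj with ⟨rfl, rfl⟩ | ⟨rfl, rfl⟩ <;> rcases hj' with ⟨rfl, rfl⟩ | ⟨rfl, rfl⟩ <;>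
        linear_combination (-1 : ZMod 2) * hsum
  have shift0 : ∀ A : Finset (Fin m × ZMod 2), OOCshift A 0 = A := by
    intro A; ext p; rw [OOC_mem_shift]; simp
  refine ⟨S.image w, ⟨?_, ?_, ?_⟩, ?_⟩
  · intro A hA
    obtain ⟨b, hb, rfl⟩ := Finset.mem_image.1 hA
    exact hcard b hb
  · intro A hA τ hτ
    obtain ⟨b, hb, rfl⟩ := Finset.mem_image.1 hA
    have : w b ∩ OOCshift (w b) τ = ∅ := by
      rw [Finset.eq_empty_iff_forall_notMem]
      intro p hp
      rw [Finset.mem_inter, OOC_mem_shift, hmem, hmem] at hp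
      obtain ⟨⟨k, rfl⟩, ⟨k', hk'⟩⟩ := hp
      simp only [Prod.mk.injEq, EmbeddingLike.apply_eq_iff_eq] at hk'
      have := hv b hb hk'.1
      subst this
      apply hτ
      linear_combination hk'.2
    simp [this]
  · intro A hA A' hA' hne τ
    obtain ⟨b, hb, rfl⟩ := Finset.mem_image.1 hA
    obtain ⟨b', hb', rfl⟩ := Finset.mem_image.1 hA'
    by_contra hcon
    exact hne (by rw [key b hb b' hb' τ (by omega)])
  · apply Finset.card_image_of_injOn
    intro b hb b' hb' h
    apply key b hb b' hb' 0
    rw [shift0, ← h, Finset.inter_self, hcard b hb]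
    norm_num

/-- number of flags of `b` on the edge `e`, weighted -/
def ooc_bd {P B : Type*} (v : B → Fin 3 → P) (y : Sym2 P → ZMod 2) (b : B) : ZMod 2 :=
  ∑ k : Fin 3, y s(v b k, v b (k + 1))

theorem labels_exist {P B : Type*} [DecidableEq P] [Fintype B] [DecidableEq B]
    (v : B → Fin 3 → P) (bit : B → Fin 3 → ZMod 2)
    (hs : ∀ b b' k k', s(v b k, v b (k + 1)) = s(v b' k', v b' (k' + 1)) →
      bit b k = bit b' k' → b = b' ∧ k = k')
    (hv : ∀ b, Function.Injective (v b))
    (b0 : B)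
    (hconn : ∀ b, Relation.ReflTransGen
      (fun b b' => ∃ k k', s(v b k, v b (k + 1)) = s(v b' k', v b' (k' + 1))) b0 b) :
    ∃ y : Sym2 P → ZMod 2, (∀ b, b ≠ b0 → ooc_bd v y b = ∑ k, bit b k) ∧
      (Fintype.card B % 4 = 0 → ooc_bd v y b0 = ∑ k, bit b0 k) := by
  classical
  have hadd : ∀ y y' b, ooc_bd v (y + y') b = ooc_bd v y b + ooc_bd v y' b := by
    intro y y' b; simp [ooc_bd, Finset.sum_add_distrib]
  have hedge : ∀ b k k', s(v b k, v b (k + 1)) = s(v b k', v b (k' + 1)) → k = k' := by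
    intro b k k' h
    rw [Sym2.eq_iff] at h
    have H := hv b
    rcases h with h | h
    · exact H h.1
    · have h1 := H h.1
      have h2 := H h.2
      clear h H; revert h1 h2; revert k k'; decide
  have hsingle : ∀ b k bb, ooc_bd v (Pi.single s(v b k, v b (k+1)) 1) bb =
      if ∃ k', s(v bb k', v bb (k' + 1)) = s(v b k, v b (k+1)) then 1 else 0 := by
    intro b k bb
    unfold ooc_bd
    split_ifs with h
    · obtain ⟨k', hk'⟩ := h
      rw [Finset.sum_eq_single k']
      · rw [hk']; simp
      · intro l _ hl
        rw [Pi.single_apply, if_neg]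
        intro h2
        exact hl (hedge bb l k' (h2.trans hk'.symm))
      · simp
    · apply Finset.sum_eq_zero
      intro l _
      rw [Pi.single_apply, if_neg]
      exact fun h2 => h ⟨l, h2⟩
  have z2 : ∀ a b c : ZMod 2, a ≠ b → c = a ∨ c = b := by decide
  have htwo : ∀ b b' k k', b ≠ b' → s(v b k, v b (k + 1)) = s(v b' k', v b' (k' + 1)) →
      ∀ bb, ooc_bd v (Pi.single s(v b k, v b (k+1)) 1) bb =
        (Pi.single b 1 : B → ZMod 2) bb + (Pi.single b' 1 : B → ZMod 2) bb := by
    intro b b' k k' hne he bb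
    rw [hsingle, Pi.single_apply, Pi.single_apply]
    have hbit : bit b k ≠ bit b' k' := fun h => hne (hs _ _ _ _ he h).1
    by_cases h1 : bb = b
    · subst h1
      rw [if_pos ⟨k, rfl⟩, if_pos rfl, if_neg hne, add_zero]
    · by_cases h2 : bb = b'
      · subst h2
        rw [if_pos ⟨k', he.symm⟩, if_neg h1, if_pos rfl, zero_add]
      · rw [if_neg, if_neg h1, if_neg h2, add_zero]
        rintro ⟨l, hl⟩
        rcases z2 _ _ (bit bb l) hbit with h | h
        · exact h1 (hs _ _ _ _ hl h).1
        · exact h2 (hs _ _ _ _ (hl.trans he) h).1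
  have self0 : ∀ a : ZMod 2, a + a = 0 := by decide
  have hreach : ∀ b, ∃ y : Sym2 P → ZMod 2, ∀ bb, ooc_bd v y bb =
      (Pi.single b0 1 : B → ZMod 2) bb + (Pi.single b 1 : B → ZMod 2) bb := by
    intro b
    induction hconn b with
    | refl => exact ⟨0, fun bb => by rw [self0]; simp [ooc_bd]⟩
    | @tail b b' _ h ih =>
      obtain ⟨y, hy⟩ := ih
      obtain ⟨k, k', hk⟩ := h
      by_cases hne : b = b'
      · subst hne; exact ⟨y, hy⟩
      · refine ⟨y + Pi.single s(v b k, v b (k+1)) 1, fun bb => ?_⟩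
        rw [hadd, hy, htwo b b' k k' hne hk, add_assoc, ← add_assoc (Pi.single b 1 bb), self0, zero_add]
  choose Y hY using hreach
  set c : B → ZMod 2 := fun b => ∑ k, bit b k with hc
  let y : Sym2 P → ZMod 2 := fun e => ∑ b, c b * Y b e
  have hy : ∀ b, ooc_bd v y b = c b + (∑ b', c b') * (Pi.single b0 1 : B → ZMod 2) b := by
    intro b
    have : ooc_bd v y b = ∑ b', c b' * ooc_bd v (Y b') b := by
      unfold ooc_bd
      simp only [y, Finset.mul_sum]
      rw [Finset.sum_comm]
    rw [this]
    simp only [hY, mul_add, Finset.sum_add_distrib]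
    rw [← Finset.sum_mul, add_comm]
    congr 1
    rw [Finset.sum_eq_single b]
    · simp
    · intro b' _ hb'
      rw [Pi.single_apply, if_neg (Ne.symm hb'), mul_zero]
    · simp
  by_cases hsum : ∑ b, c b = 0
  · exact ⟨y, fun b _ => by rw [hy, hsum]; simp [hc], fun _ => by rw [hy, hsum]; simp [hc]⟩
  by_cases hall : ∀ f : B × Fin 3, ∃ f' : B × Fin 3,
      s(v f.1 f.2, v f.1 (f.2 + 1)) = s(v f'.1 f'.2, v f'.1 (f'.2 + 1)) ∧ bit f'.1 f'.2 ≠ bit f.1 f.2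
  · refine ⟨y, fun b hb => by rw [hy, Pi.single_apply, if_neg hb]; simp [hc], fun h4 => ?_⟩
    exfalso
    apply hsum
    choose σ hσ using hall
    have h01 : ∀ a : ZMod 2, a = 0 ∨ a = 1 := by decide
    let F1 : Finset (B × Fin 3) := Finset.univ.filter fun f => bit f.1 f.2 = 1
    let F0 : Finset (B × Fin 3) := Finset.univ.filter fun f => ¬ bit f.1 f.2 = 1
    have hinj : Function.Injective σ := by
      intro f g h
      have h1 := (hσ f).1.trans ((congrArg (fun f' : B × Fin 3 => s(v f'.1 f'.2, v f'.1 (f'.2 + 1))) h).trans (hσ g).1.symm)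
      have h2 : bit f.1 f.2 = bit g.1 g.2 := by
        have a1 := (hσ f).2
        have a2 := (hσ g).2
        rw [h] at a1
        have : ∀ a b c : ZMod 2, a ≠ b → a ≠ c → b = c := by decide
        exact this _ _ _ a1 a2
      have := hs _ _ _ _ h1 h2
      exact Prod.ext this.1 this.2
    have e1 : F1.card ≤ F0.card := by
      apply Finset.card_le_card_of_injOn σ
      · intro f hf
        have hf' : bit f.1 f.2 = 1 := by simpa [F1] using hf
        have := (hσ f).2
        rw [hf'] at this
        simpa [F0] using this
      · exact hinj.injOn
    have e0 : F0.card ≤ F1.card := by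
      apply Finset.card_le_card_of_injOn σ
      · intro f hf
        have hf' : ¬ bit f.1 f.2 = 1 := by simpa [F0] using hf
        have := (hσ f).2
        have a1 := h01 (bit f.1 f.2)
        have a2 := h01 (bit (σ f).1 (σ f).2)
        have : bit (σ f).1 (σ f).2 = 1 := by
          rcases a1 with a1 | a1
          · rcases a2 with a2 | a2
            · rw [a1, a2] at this; exact absurd rfl this
            · exact a2
          · exact absurd a1 hf'
        simpa [F1] using this
      · exact hinj.injOn
    have e2 : F1.card + F0.card = Fintype.card B * 3 := by
      have := Finset.card_filter_add_card_filter_not (s := (Finset.univ : Finset (B × Fin 3)))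
        (fun f => bit f.1 f.2 = 1)
      rw [Finset.card_univ, Fintype.card_prod, Fintype.card_fin] at this
      exact this
    have e3 : ∑ b, c b = (F1.card : ZMod 2) := by
      simp only [hc]
      rw [← Fintype.sum_prod_type' (fun b k => bit b k), Finset.card_filter]
      push_cast
      apply Finset.sum_congr rfl
      intro f _
      rcases h01 (bit f.1 f.2) with h | h <;> simp [h]
    rw [e3, ZMod.natCast_eq_zero_iff]
    omega
  · push Not at hall
    obtain ⟨⟨b1, k1⟩, hf⟩ := hall
    have hone : ∀ bb, ooc_bd v (Pi.single s(v b1 k1, v b1 (k1+1)) 1) bb =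
        (Pi.single b1 1 : B → ZMod 2) bb := by
      intro bb
      rw [hsingle, Pi.single_apply]
      by_cases h1 : bb = b1
      · subst h1
        rw [if_pos ⟨k1, rfl⟩, if_pos rfl]
      · rw [if_neg, if_neg h1]
        rintro ⟨l, hl⟩
        exact h1 (hs _ _ _ _ hl (hf (bb, l) hl.symm)).1
    have hs1 : ∑ b, c b = 1 := by
      have : ∀ a : ZMod 2, a ≠ 0 → a = 1 := by decide
      exact this _ hsum
    have hfin : ∀ b, ooc_bd v (y + (Pi.single s(v b1 k1, v b1 (k1+1)) 1 + Y b1)) b = c b := by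
      intro b
      rw [hadd, hadd, hy, hs1, hone, hY, one_mul]
      have : ∀ a b c : ZMod 2, a + b + (c + (b + c)) = a := by decide
      exact this _ _ _
    exact ⟨_, fun b _ => hfin b, fun _ => hfin b0⟩

theorem code_of_design {P B : Type*} [Fintype P] [DecidableEq P] [Fintype B] [DecidableEq B] {m : ℕ}
    (hP : Fintype.card P = m)
    (v : B → Fin 3 → P) (bit : B → Fin 3 → ZMod 2)
    (hs : ∀ b b' k k', s(v b k, v b (k + 1)) = s(v b' k', v b' (k' + 1)) →
      bit b k = bit b' k' → b = b' ∧ k = k')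
    (hv : ∀ b, Function.Injective (v b))
    (b0 : B)
    (hconn : ∀ b, Relation.ReflTransGen
      (fun b b' => ∃ k k', s(v b k, v b (k + 1)) = s(v b' k', v b' (k' + 1))) b0 b) :
    ∃ C : Finset (Finset (Fin m × ZMod 2)), IsOOC m 2 3 1 C ∧
      C.card = if Fintype.card B % 4 = 0 then Fintype.card B else Fintype.card B - 1 := by
  classical
  obtain ⟨y, hy, hy0⟩ := labels_exist v bit hs hv b0 hconn
  let lab : B → Fin 3 → ZMod 2 := fun b k => y s(v b k, v b (k + 1)) + bit b k
  have hlab : ∀ b, ooc_bd v y b = ∑ k, bit b k → lab b 0 + lab b 1 + lab b 2 = 0 := by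
    intro b h
    have h2 : ∑ k, lab b k = 0 := by
      have : ∀ a : ZMod 2, a + a = 0 := by decide
      simp only [lab, Finset.sum_add_distrib]
      rw [← h]; exact this _
    rwa [Fin.sum_univ_three] at h2
  have hss : ∀ b b' k k', s(v b k, v b (k + 1)) = s(v b' k', v b' (k' + 1)) →
      lab b k = lab b' k' → b = b' := by
    intro b b' k k' h h2
    simp only [lab] at h2
    rw [h] at h2
    exact (hs _ _ _ _ h (add_left_cancel h2)).1
  split_ifs with h4
  · obtain ⟨C, hC, hc⟩ := code_of_labels hP (Finset.univ : Finset B) v lab (fun b _ => hv b)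
      (fun b _ => by
        by_cases hb : b = b0
        · subst hb; exact hlab _ (hy0 h4)
        · exact hlab _ (hy b hb))
      (fun b _ b' _ k k' h h2 => hss b b' k k' h h2)
    exact ⟨C, hC, by rw [hc, Finset.card_univ]⟩
  · obtain ⟨C, hC, hc⟩ := code_of_labels hP ((Finset.univ : Finset B).erase b0) v lab (fun b _ => hv b)
      (fun b hb => hlab _ (hy b (Finset.ne_of_mem_erase hb)))
      (fun b _ b' _ k k' h h2 => hss b b' k k' h h2)
    exact ⟨C, hC, by rw [hc, Finset.card_erase_of_mem (Finset.mem_univ _), Finset.card_univ]⟩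

theorem ooc_upper_facts (m : ℕ) (C : Finset (Finset (Fin m × ZMod 2))) (hC : IsOOC m 2 3 1 C) :
    ∃ I : Finset (Fin m × Fin m × ZMod 2),
      I.card = 6 * C.card ∧ (∀ u ∈ I, u.1 ≠ u.2.1) ∧
      (∀ u ∈ I, (u.2.1, u.1, u.2.2) ∈ I) ∧
      4 ∣ (I.filter fun u => u.2.2 = 1).card ∧
      (∀ i, 2 ∣ (I.filter fun u => u.1 = i).card) := by
  classical
  obtain ⟨h3, hauto, hcross⟩ := hC
  have z2 : ∀ a b : ZMod 2, a ≠ b → a - 1 = b := by decide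
  have hrow : ∀ A ∈ C, ∀ p ∈ A, ∀ q ∈ A, p.1 = q.1 → p = q := by
    intro A hA p hp q hq h
    by_contra hne
    have h2 : p.2 ≠ q.2 := fun h' => hne (Prod.ext h h')
    have := hauto A hA 1 (by decide)
    have hlt : 1 < (A ∩ OOCshift A 1).card := by
      rw [Finset.one_lt_card]
      refine ⟨p, ?_, q, ?_, hne⟩
      · rw [Finset.mem_inter, OOC_mem_shift, z2 _ _ h2, h]; exact ⟨hp, hq⟩
      · rw [Finset.mem_inter, OOC_mem_shift, z2 _ _ h2.symm, ← h]; exact ⟨hq, hp⟩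
    omega
  let F : Finset (Σ _ : Finset (Fin m × ZMod 2), (Fin m × ZMod 2) × (Fin m × ZMod 2)) :=
    C.sigma fun A => A.offDiag
  let φ : (Σ _ : Finset (Fin m × ZMod 2), (Fin m × ZMod 2) × (Fin m × ZMod 2)) →
    Fin m × Fin m × ZMod 2 := fun t => (t.2.1.1, t.2.2.1, t.2.1.2 + t.2.2.2)
  have hF : ∀ t, t ∈ F ↔ t.1 ∈ C ∧ t.2.1 ∈ t.1 ∧ t.2.2 ∈ t.1 ∧ t.2.1 ≠ t.2.2 := by
    intro t; simp [F, Finset.mem_sigma, Finset.mem_offDiag]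
  have hinj : Set.InjOn φ F := by
    rintro ⟨A, p, q⟩ ht ⟨B, p', q'⟩ ht' h
    rw [Finset.mem_coe, hF] at ht ht'
    simp only at ht ht'
    obtain ⟨hA, hp, hq, hpq⟩ := ht
    obtain ⟨hB, hp', hq', hpq'⟩ := ht'
    simp only [φ, Prod.mk.injEq] at h
    obtain ⟨e1, e2, e3⟩ := h
    have s1 : ∀ a b c d : ZMod 2, a + b = c + d → b - (a - c) = d := by decide
    have hlt : 1 < (A ∩ OOCshift B (p.2 - p'.2)).card := by
      rw [Finset.one_lt_card]
      refine ⟨p, ?_, q, ?_, hpq⟩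
      · rw [Finset.mem_inter, OOC_mem_shift, e1, sub_sub_cancel]; exact ⟨hp, hp'⟩
      · rw [Finset.mem_inter, OOC_mem_shift, e2, s1 _ _ _ _ e3]; exact ⟨hq, hq'⟩
    by_cases hAB : A = B
    · subst hAB
      by_cases hτ : p.2 - p'.2 = 0
      · have hp2 := sub_eq_zero.1 hτ
        have h1 : p = p' := Prod.ext e1 hp2
        have h2 : q = q' := Prod.ext e2 (by rw [hp2] at e3; exact add_left_cancel e3)
        rw [h1, h2]
      · have := hauto A hA _ hτ; omega
    · have := hcross A hA B hB hAB (p.2 - p'.2); omega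
  have hfil : ∀ (Q : Fin m × Fin m × ZMod 2 → Prop) [DecidablePred Q],
      ((F.image φ).filter Q).card =
        ∑ A ∈ C, (A.offDiag.filter fun pq => Q (pq.1.1, pq.2.1, pq.1.2 + pq.2.2)).card := by
    intro Q _
    rw [Finset.filter_image, Finset.card_image_of_injOn (hinj.mono (Finset.coe_subset.2 (Finset.filter_subset _ _))),
      ← Finset.card_sigma]
    congr 1
    ext t
    simp [F, φ, Finset.mem_sigma, and_assoc]
  refine ⟨F.image φ, ?_, ?_, ?_, ?_, ?_⟩
  · rw [Finset.card_image_of_injOn hinj, Finset.card_sigma, Finset.sum_const_nat (m := 6), mul_comm]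
    intro A hA
    rw [Finset.offDiag_card, h3 A hA]
  · intro u hu
    obtain ⟨t, ht, rfl⟩ := Finset.mem_image.1 hu
    rw [hF] at ht
    intro h
    exact ht.2.2.2 (hrow _ ht.1 _ ht.2.1 _ ht.2.2.1 h)
  · intro u hu
    obtain ⟨t, ht, rfl⟩ := Finset.mem_image.1 hu
    rw [hF] at ht
    refine Finset.mem_image.2 ⟨⟨t.1, t.2.2, t.2.1⟩, ?_, ?_⟩
    · rw [hF]; exact ⟨ht.1, ht.2.2.1, ht.2.1, ht.2.2.2.symm⟩
    · simp [φ, add_comm]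
  · rw [hfil]
    apply Finset.dvd_sum
    intro A hA
    have h01 : ∀ a b : ZMod 2, a + b = 1 ↔ (a = 0 ∧ ¬ b = 0) ∨ (¬ a = 0 ∧ b = 0) := by decide
    have : (A.offDiag.filter fun pq => pq.1.2 + pq.2.2 = 1) =
      ((A.filter fun p => p.2 = 0) ×ˢ (A.filter fun p => ¬ p.2 = 0)) ∪
      ((A.filter fun p => ¬ p.2 = 0) ×ˢ (A.filter fun p => p.2 = 0)) := by
      ext ⟨p, q⟩
      simp only [Finset.mem_filter, Finset.mem_offDiag, Finset.mem_union, Finset.mem_product, h01]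
      constructor
      · rintro ⟨⟨a, b, c⟩, d | d⟩
        · exact Or.inl ⟨⟨a, d.1⟩, b, d.2⟩
        · exact Or.inr ⟨⟨a, d.1⟩, b, d.2⟩
      · rintro (⟨⟨a, b⟩, c, d⟩ | ⟨⟨a, b⟩, c, d⟩)
        · exact ⟨⟨a, c, by rintro rfl; exact d b⟩, Or.inl ⟨b, d⟩⟩
        · exact ⟨⟨a, c, by rintro rfl; exact b d⟩, Or.inr ⟨b, d⟩⟩
    rw [this, Finset.card_union_of_disjoint, Finset.card_product, Finset.card_product]
    · have hc := Finset.card_filter_add_card_filter_not (s := A) (fun p => p.2 = 0)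
      rw [h3 A hA] at hc
      generalize (A.filter fun p => p.2 = 0).card = a at *
      generalize (A.filter fun p => ¬ p.2 = 0).card = b at *
      have ha : a ≤ 3 := by omega
      interval_cases a
      · simp
      · obtain rfl : b = 2 := by omega
        norm_num
      · obtain rfl : b = 1 := by omega
        norm_num
      · obtain rfl : b = 0 := by omega
        norm_num
    · rw [Finset.disjoint_left]
      rintro ⟨p, q⟩ h1 h2
      simp only [Finset.mem_product, Finset.mem_filter] at h1 h2
      exact h2.1.2 h1.1.2
  · intro i
    rw [hfil]
    apply Finset.dvd_sum
    intro A hA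
    have : (A.offDiag.filter fun pq => pq.1.1 = i).card = ∑ p ∈ A.filter (fun p => p.1 = i), 2 := by
      rw [Finset.sum_congr rfl (g := fun p => (A.erase p).card)]
      · rw [← Finset.card_sigma]
        apply Finset.card_bij (fun pq _ => ⟨pq.1, pq.2⟩)
        · rintro ⟨p, q⟩ h
          simp only [Finset.mem_filter, Finset.mem_offDiag, Finset.mem_sigma, Finset.mem_erase] at h ⊢
          exact ⟨⟨h.1.1, h.2⟩, h.1.2.2.symm, h.1.2.1⟩
        · rintro ⟨p, q⟩ _ ⟨p', q'⟩ _ h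
          simp only [Sigma.mk.injEq, heq_eq_eq] at h
          rw [h.1, h.2]
        · rintro ⟨p, q⟩ h
          simp only [Finset.mem_filter, Finset.mem_sigma, Finset.mem_erase] at h
          refine ⟨(p, q), ?_, rfl⟩
          simp only [Finset.mem_filter, Finset.mem_offDiag]
          exact ⟨⟨h.1.1, h.2.2, h.2.1.symm⟩, h.1.2⟩
      · intro p hp
        rw [Finset.card_erase_of_mem (Finset.mem_filter.1 hp).1, h3 A hA]
    rw [this, Finset.sum_const]
    exact ⟨_, by rw [smul_eq_mul, mul_comm]⟩

lemma ooc_mod12 (m r : ℕ) (h : m % 12 = r) (hr : 1 ≤ r) : (m * (m - 1)) % 12 = (r * (r - 1)) % 12 := by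
  have h1 : (m - 1) % 12 = (r - 1) % 12 := by omega
  have h2 : m % 12 = r % 12 := by omega
  exact Nat.ModEq.mul h2 h1

theorem ooc_upper (m : ℕ) (C : Finset (Finset (Fin m × ZMod 2))) (hC : IsOOC m 2 3 1 C) :
    C.card ≤ if m % 12 = 3 ∨ m % 12 = 5 ∨ m % 12 = 6 ∨ m % 12 = 7 ∨
          m % 12 = 8 ∨ m % 12 = 10
        then m * (m - 1) / 3 - 1 else m * (m - 1) / 3 := by
  classical
  obtain ⟨I, hcard, hne, hsymm, h4, h2⟩ := ooc_upper_facts m C hC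
  let S : Finset (Fin m × Fin m × ZMod 2) := Finset.univ.filter fun u => u.1 ≠ u.2.1
  have hIS : I ⊆ S := fun u hu => by simp [S, hne u hu]
  have hoff : (Finset.univ : Finset (Fin m)).offDiag.card = m * (m - 1) := by
    rw [Finset.offDiag_card, Finset.card_univ, Fintype.card_fin, Nat.mul_sub_one]
  have hSl : ∀ l : ZMod 2, (S.filter fun u => u.2.2 = l).card = m * (m - 1) := by
    intro l
    rw [← hoff]
    symm
    apply Finset.card_bij (fun ij _ => (ij.1, ij.2, l))
    · intro ij h
      simpa [S] using h
    · rintro ⟨i, j⟩ _ ⟨i', j'⟩ _ h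
      simp only [Prod.mk.injEq] at h
      rw [h.1, h.2.1]
    · rintro ⟨i, j, l'⟩ h
      simp only [S, Finset.mem_filter, Finset.mem_univ, true_and] at h
      exact ⟨(i, j), by simpa using h.1, by rw [h.2]⟩
  have hS : S.card = 2 * (m * (m - 1)) := by
    have := Finset.card_filter_add_card_filter_not (s := S) (fun u => u.2.2 = 1)
    have h0 : ∀ a : ZMod 2, ¬ a = 1 ↔ a = 0 := by decide
    simp only [h0, hSl] at this
    omega
  have hSi : ∀ i, (S.filter fun u => u.1 = i).card = (m - 1) * 2 := by
    intro i
    have : (S.filter fun u => u.1 = i) =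
        ({i} : Finset (Fin m)) ×ˢ ((Finset.univ.erase i) ×ˢ (Finset.univ : Finset (ZMod 2))) := by
      ext ⟨a, b, l⟩
      simp only [S, Finset.mem_filter, Finset.mem_univ, true_and, Finset.mem_product,
        Finset.mem_singleton, Finset.mem_erase, and_true]
      constructor
      · rintro ⟨h, rfl⟩; exact ⟨rfl, h.symm⟩
      · rintro ⟨rfl, h⟩; exact ⟨h.symm, rfl⟩
    rw [this, Finset.card_product, Finset.card_product, Finset.card_erase_of_mem (Finset.mem_univ _)]
    simp [ZMod.card]
  have hle : 6 * C.card ≤ 2 * (m * (m - 1)) := by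
    rw [← hcard, ← hS]; exact Finset.card_le_card hIS
  split_ifs with hm
  swap
  · omega
  by_contra hcon
  by_cases hA : m % 12 = 5 ∨ m % 12 = 8
  · have hmod : (m * (m - 1)) % 12 = 8 := by
      rcases hA with h | h <;> rw [ooc_mod12 m _ h (by norm_num)]
    let U := S \ I
    have hU : U.card = 4 := by
      rw [Finset.card_sdiff_of_subset hIS, hS, hcard]; omega
    have hUmem : ∀ u, u ∈ U ↔ u.1 ≠ u.2.1 ∧ u ∉ I := by
      intro u; simp [U, S]
    have hUs : ∀ i j l, (i, j, l) ∈ U → (j, i, l) ∈ U := by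
      intro i j l h
      rw [hUmem] at h ⊢
      exact ⟨h.1.symm, fun h' => h.2 (hsymm _ h')⟩
    have hsplit : ∀ (Q : Fin m × Fin m × ZMod 2 → Prop) [DecidablePred Q],
        (U.filter Q).card + (I.filter Q).card = (S.filter Q).card := by
      intro Q _
      rw [← Finset.card_union_of_disjoint, ← Finset.filter_union, Finset.sdiff_union_of_subset hIS]
      exact Finset.disjoint_filter_filter Finset.sdiff_disjoint
    have hU2 : ∀ i, 2 ∣ (U.filter fun u => u.1 = i).card := by
      intro i
      have := hsplit (fun u => u.1 = i)
      rw [hSi] at this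
      have := h2 i
      omega
    have hother : ∀ u ∈ U, ∃ u' ∈ U, u' ≠ u ∧ u'.1 = u.1 := by
      intro u hu
      have hmem : u ∈ U.filter fun w => w.1 = u.1 := by simp [hu]
      have hpos := Finset.card_pos.2 ⟨u, hmem⟩
      have := hU2 u.1
      obtain ⟨u', h', hne'⟩ := Finset.exists_mem_ne (s := U.filter fun w => w.1 = u.1) (by omega) u
      exact ⟨u', (Finset.mem_filter.1 h').1, hne', (Finset.mem_filter.1 h').2⟩
    obtain ⟨⟨i, j, l⟩, hu⟩ := Finset.card_pos.1 (by omega : 0 < U.card)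
    have hij : i ≠ j := ((hUmem _).1 hu).1
    obtain ⟨⟨i', k, l'⟩, hu', hne', hi⟩ := hother _ hu
    simp only at hi
    subst hi
    have hik : i' ≠ k := ((hUmem _).1 hu').1
    have hkl : ¬ (k = j ∧ l' = l) := by
      rintro ⟨rfl, rfl⟩; exact hne' rfl
    have hUeq : ({(i', j, l), (j, i', l), (i', k, l'), (k, i', l')} : Finset _) = U := by
      apply Finset.eq_of_subset_of_card_le
      · intro x hx
        simp only [Finset.mem_insert, Finset.mem_singleton] at hx
        rcases hx with rfl | rfl | rfl | rfl
        · exact hu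
        · exact hUs _ _ _ hu
        · exact hu'
        · exact hUs _ _ _ hu'
      · rw [hU, Finset.card_insert_of_notMem, Finset.card_insert_of_notMem,
          Finset.card_insert_of_notMem, Finset.card_singleton]
        · simp; intro h; exact absurd h hik
        · simp; exact ⟨fun h => absurd h.symm hij, fun h h' => hkl ⟨h.symm, h'.symm⟩⟩
        · simp; exact ⟨fun h => absurd h hij, fun h h' => hkl ⟨h.symm, h'.symm⟩, fun h => absurd h hik⟩
    obtain ⟨⟨a, b, c⟩, hw, hwne, hw1⟩ := hother _ (hUs _ _ _ hu)
    simp only at hw1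
    subst hw1
    rw [← hUeq] at hw
    simp only [Finset.mem_insert, Finset.mem_singleton, Prod.mk.injEq] at hw
    have hka : k = a := by
      rcases hw with h | h | h | h
      · exact absurd h.1.symm hij
      · exact absurd (by rw [h.2.1, h.2.2]) hwne
      · exact absurd h.1.symm hij
      · exact h.1.symm
    subst hka
    have hll : l' ≠ l := fun h => hkl ⟨rfl, h⟩
    have hU1 : (U.filter fun u => u.2.2 = 1).card = 2 := by
      rw [← hUeq]
      have : ∀ a b : ZMod 2, a ≠ b → (a = 0 ∧ b = 1) ∨ (a = 1 ∧ b = 0) := by decide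
      rcases this _ _ hll with ⟨rfl, rfl⟩ | ⟨rfl, rfl⟩ <;>
        simp [Finset.filter_insert, Finset.filter_singleton, hij, hij.symm]
    have := hsplit (fun u => u.2.2 = 1)
    rw [hU1, hSl] at this
    omega
  · have hmod : (m * (m - 1)) % 12 = 6 := by
      have hr : m % 12 = 3 ∨ m % 12 = 6 ∨ m % 12 = 7 ∨ m % 12 = 10 := by omega
      rcases hr with h | h | h | h <;> rw [ooc_mod12 m _ h (by norm_num)]
    have hIeq : I = S := by
      apply Finset.eq_of_subset_of_card_le hIS
      rw [hS, hcard]; omega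
    rw [hIeq, hSl] at h4
    omega

/-- order indicator -/
def ooc_eps {n : ℕ} (x y : ZMod n) : ZMod 2 := if x.val < y.val then 1 else 0

def ooc_sh {n : ℕ} (e : ZMod 2) (w : ZMod n) : ZMod n := if e = 1 then w else 0

lemma ooc_eps_ne {n : ℕ} [NeZero n] (x y : ZMod n) (h : x ≠ y) : ooc_eps x y ≠ ooc_eps y x := by
  have h' : x.val ≠ y.val := fun h' => h (ZMod.val_injective n h')
  unfold ooc_eps
  rcases lt_or_gt_of_ne h' with h1 | h1
  · rw [if_pos h1, if_neg (by omega)]; decide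
  · rw [if_neg (by omega), if_pos h1]; decide

lemma ooc_eps_cases {n : ℕ} [NeZero n] (x y : ZMod n) (h : x ≠ y) (e : ZMod 2) :
    ooc_eps x y = e ∨ ooc_eps y x = e := by
  have h1 := ooc_eps_ne x y h
  have : ∀ a b c : ZMod 2, a ≠ b → a = c ∨ b = c := by decide
  exact this _ _ _ h1

abbrev OPt (n j : ℕ) := (Fin 3 × ZMod n) ⊕ Fin j

abbrev OBl (n j : ℕ) (T : Type) :=
  (Fin 3 × {p : ZMod n × ZMod n // p.1 ≠ p.2}) ⊕ (T ⊕ (Fin j × Fin 3 × ZMod n))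

def ooc_cr {n : ℕ} (j : ℕ) (i : Fin 3) (x z : ZMod n) : Sym2 (OPt n j) :=
  s(Sum.inl (i, x), Sum.inl (i + 1, z))

def ooc_hz {n : ℕ} (j : ℕ) (i : Fin 3) (x y : ZMod n) : Sym2 (OPt n j) :=
  s(Sum.inl (i, x), Sum.inl (i, y))

def ooc_inf {n j : ℕ} (a : Fin j) (i : Fin 3) (x : ZMod n) : Sym2 (OPt n j) :=
  s(Sum.inl (i, x), Sum.inr a)

lemma fin3_a (i : Fin 3) : i ≠ i + 1 := by revert i; decide
lemma fin3_b (i : Fin 3) : i ≠ i + 1 + 1 := by revert i; decide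

lemma ooc_cr_inj {n j : ℕ} {i i' : Fin 3} {x z x' z' : ZMod n} (h : ooc_cr j i x z = ooc_cr j i' x' z') :
    i = i' ∧ x = x' ∧ z = z' := by
  simp only [ooc_cr, Sym2.eq_iff, Sum.inl.injEq, Prod.mk.injEq] at h
  rcases h with h | h
  · exact ⟨h.1.1, h.1.2, h.2.2⟩
  · exfalso
    have h1 := h.1.1
    rw [← h.2.1] at h1
    exact fin3_b _ h1

lemma ooc_hz_inj {n j : ℕ} {i i' : Fin 3} {x y x' y' : ZMod n} (h : ooc_hz j i x y = ooc_hz j i' x' y') :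
    i = i' ∧ ((x = x' ∧ y = y') ∨ (x = y' ∧ y = x')) := by
  simp only [ooc_hz, Sym2.eq_iff, Sum.inl.injEq, Prod.mk.injEq] at h
  tauto

lemma ooc_inf_inj {n j : ℕ} {a a' : Fin j} {i i' : Fin 3} {x x' : ZMod n}
    (h : ooc_inf a i x = ooc_inf a' i' x') : a = a' ∧ i = i' ∧ x = x' := by
  simp only [ooc_inf, Sym2.eq_iff, Sum.inl.injEq, Sum.inr.injEq, Prod.mk.injEq, reduceCtorEq] at h
  tauto

lemma ooc_cr_ne_hz {n j : ℕ} {i i' : Fin 3} {x z x' z' : ZMod n} : ooc_cr j i x z ≠ ooc_hz j i' x' z' := by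
  intro h
  simp only [ooc_cr, ooc_hz, Sym2.eq_iff, Sum.inl.injEq, Prod.mk.injEq] at h
  rcases h with h | h
  · exact fin3_a _ (h.1.1.trans h.2.1.symm)
  · exact fin3_a _ (h.1.1.trans h.2.1.symm)

lemma ooc_cr_ne_inf {n j : ℕ} {i i' : Fin 3} {x z x' : ZMod n} {a : Fin j} :
    ooc_cr j i x z ≠ ooc_inf a i' x' := by
  intro h
  simp [ooc_cr, ooc_inf, Sym2.eq_iff] at h

lemma ooc_hz_ne_inf {n j : ℕ} {i i' : Fin 3} {x z x' : ZMod n} {a : Fin j} :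
    ooc_hz j i x z ≠ ooc_inf a i' x' := by
  intro h
  simp [ooc_hz, ooc_inf, Sym2.eq_iff] at h

section design
variable {n j : ℕ} {T : Type} (f : ZMod n ≃ ZMod n) (c : Fin 3 → ZMod n)
  (t : T → Fin 3 → ZMod n) (g : Fin j → Fin 3 → ZMod n → ZMod n)

def ooc_v : OBl n j T → Fin 3 → OPt n j
  | Sum.inl (i, p) => ![Sum.inl (i, p.1.1), Sum.inl (i, p.1.2),
      Sum.inl (i + 1, f.symm (p.1.1 + p.1.2 + ooc_sh (ooc_eps p.1.1 p.1.2) (c i)))]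
  | Sum.inr (Sum.inl e) => fun k => Sum.inl (k, t e k)
  | Sum.inr (Sum.inr (a, i, x)) => ![Sum.inl (i, x), Sum.inl (i + 1, g a i x), Sum.inr a]

def ooc_rb (x z : ZMod n) : ZMod 2 := if f z = x + x then 0 else 1

def ooc_bit : OBl n j T → Fin 3 → ZMod 2
  | Sum.inl (_, p) => fun _ => ooc_eps p.1.1 p.1.2
  | Sum.inr (Sum.inl e) => fun k => ooc_rb f (t e k) (t e (k + 1))
  | Sum.inr (Sum.inr (a, i, x)) => ![ooc_rb f x (g a i x), 0, 1]

def ooc_edge (b : OBl n j T) (k : Fin 3) : Sym2 (OPt n j) :=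
  s(ooc_v f c t g b k, ooc_v f c t g b (k + 1))

lemma ooc_rb_spec (x z w : ZMod n) (h : f z = x + x ∨ f z = x + x + w) :
    f z = x + x + ooc_sh (ooc_rb f x z) w := by
  unfold ooc_rb ooc_sh
  by_cases h1 : f z = x + x
  · simp [h1]
  · rw [if_neg h1]; simpa using h.resolve_left h1

/-- classification of flags -/
lemma ooc_flag (hT : ∀ e k, f (t e (k + 1)) = t e k + t e k ∨ f (t e (k + 1)) = t e k + t e k + c k)
    (hG : ∀ a i x, f (g a i x) = x + x ∨ f (g a i x) = x + x + c i)
    (b : OBl n j T) (k : Fin 3) :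
    (∃ i p, b = Sum.inl (i, p) ∧ k = 0 ∧ ooc_edge f c t g b k = ooc_hz j i p.1.1 p.1.2) ∨
    (∃ i x y z, ∃ h : x ≠ y, ooc_edge f c t g b k = ooc_cr j i x z ∧
      f z = x + y + ooc_sh (ooc_bit f t g b k) (c i) ∧
      ((b = Sum.inl (i, ⟨(x, y), h⟩) ∧ k = 2 ∧ ooc_bit f t g b k = ooc_eps x y) ∨
       (b = Sum.inl (i, ⟨(y, x), h.symm⟩) ∧ k = 1 ∧ ooc_bit f t g b k = ooc_eps y x))) ∨
    (∃ i x z, ooc_edge f c t g b k = ooc_cr j i x z ∧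
      f z = x + x + ooc_sh (ooc_bit f t g b k) (c i) ∧
      ((∃ e, b = Sum.inr (Sum.inl e) ∧ k = i ∧ x = t e k ∧ z = t e (k + 1)) ∨
       (∃ a, b = Sum.inr (Sum.inr (a, i, x)) ∧ k = 0 ∧ z = g a i x))) ∨
    (∃ a i x, b = Sum.inr (Sum.inr (a, i, x)) ∧
      ((k = 1 ∧ ooc_edge f c t g b k = ooc_inf a (i + 1) (g a i x) ∧ ooc_bit f t g b k = 0) ∨
       (k = 2 ∧ ooc_edge f c t g b k = ooc_inf a i x ∧ ooc_bit f t g b k = 1))) := by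
  rcases b with ⟨i, ⟨x, y⟩, h⟩ | e | ⟨a, i, x⟩
  · have hk : k = 0 ∨ k = 1 ∨ k = 2 := by revert k; decide
    rcases hk with rfl | rfl | rfl
    · left; exact ⟨i, ⟨(x, y), h⟩, rfl, rfl, rfl⟩
    · right; left
      refine ⟨i, y, x, _, Ne.symm h, rfl, ?_, Or.inr ⟨rfl, rfl, rfl⟩⟩
      simp [ooc_bit, add_comm]
    · right; left
      refine ⟨i, x, y, _, h, Sym2.eq_swap, ?_, Or.inl ⟨rfl, rfl, rfl⟩⟩
      simp [ooc_bit]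
  · right; right; left
    refine ⟨k, t e k, t e (k + 1), rfl, ?_, Or.inl ⟨e, rfl, rfl, rfl, rfl⟩⟩
    exact ooc_rb_spec f _ _ _ (hT e k)
  · have hk : k = 0 ∨ k = 1 ∨ k = 2 := by revert k; decide
    rcases hk with rfl | rfl | rfl
    · right; right; left
      exact ⟨i, x, g a i x, rfl, ooc_rb_spec f _ _ _ (hG a i x), Or.inr ⟨a, rfl, rfl, rfl⟩⟩
    · right; right; right
      exact ⟨a, i, x, rfl, Or.inl ⟨rfl, rfl, rfl⟩⟩
    · right; right; right
      exact ⟨a, i, x, rfl, Or.inr ⟨rfl, Sym2.eq_swap, rfl⟩⟩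

lemma ooc_slots [NeZero n]
    (hT : ∀ e k, f (t e (k + 1)) = t e k + t e k ∨ f (t e (k + 1)) = t e k + t e k + c k)
    (hG : ∀ a i x, f (g a i x) = x + x ∨ f (g a i x) = x + x + c i)
    (hginj : ∀ a i, Function.Injective (g a i))
    (d1 : ∀ e e' k, t e k = t e' k → t e (k + 1) = t e' (k + 1) → e = e')
    (d2 : ∀ a a' i x, g a i x = g a' i x → a = a')
    (d3 : ∀ e a k, t e (k + 1) ≠ g a k (t e k))
    (b b' : OBl n j T) (k k' : Fin 3) (he : ooc_edge f c t g b k = ooc_edge f c t g b' k')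
    (hb : ooc_bit f t g b k = ooc_bit f t g b' k') : b = b' ∧ k = k' := by
  have F := ooc_flag f c t g hT hG b k
  have F' := ooc_flag f c t g hT hG b' k'
  rcases F with ⟨i, p, hb1, hk, h1⟩ | ⟨i, x, y, z, hxy, h1, h2, h3⟩ | ⟨i, x, z, h1, h2, h3⟩ |
    ⟨a, i, x, hb1, h1⟩
  · rcases F' with ⟨i', p', hb1', hk', h1'⟩ | ⟨i', x', y', z', hxy', h1', h2', h3'⟩ |
      ⟨i', x', z', h1', h2', h3'⟩ | ⟨a', i', x', hb1', ⟨_, h1', _⟩ | ⟨_, h1', _⟩⟩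
    · rw [h1, h1'] at he
      obtain ⟨rfl, h | h⟩ := ooc_hz_inj he
      · obtain rfl : p = p' := Subtype.ext (Prod.ext h.1 h.2)
        exact ⟨hb1.trans hb1'.symm, hk.trans hk'.symm⟩
      · exfalso
        subst hb1 hb1'
        simp only [ooc_bit] at hb
        rw [h.1, h.2] at hb
        exact ooc_eps_ne _ _ (Ne.symm p'.2) hb
    · rw [h1, h1'] at he; exact absurd he.symm ooc_cr_ne_hz
    · rw [h1, h1'] at he; exact absurd he.symm ooc_cr_ne_hz
    · rw [h1, h1'] at he; exact absurd he ooc_hz_ne_inf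
    · rw [h1, h1'] at he; exact absurd he ooc_hz_ne_inf
  · rcases F' with ⟨i', p', hb1', hk', h1'⟩ | ⟨i', x', y', z', hxy', h1', h2', h3'⟩ |
      ⟨i', x', z', h1', h2', h3'⟩ | ⟨a', i', x', hb1', ⟨_, h1', _⟩ | ⟨_, h1', _⟩⟩
    · rw [h1, h1'] at he; exact absurd he ooc_cr_ne_hz
    · rw [h1, h1'] at he
      obtain ⟨rfl, rfl, rfl⟩ := ooc_cr_inj he
      rw [hb] at h2
      have hy : y = y' := by
        have := h2.symm.trans h2'
        linear_combination this
      subst hy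
      have hne := ooc_eps_ne _ _ hxy
      rcases h3 with ⟨a1, a2, a3⟩ | ⟨a1, a2, a3⟩ <;> rcases h3' with ⟨a1', a2', a3'⟩ | ⟨a1', a2', a3'⟩
      · exact ⟨a1.trans a1'.symm, a2.trans a2'.symm⟩
      · exact absurd (a3.symm.trans (hb.trans a3')) hne
      · exact absurd (a3'.symm.trans (hb.symm.trans a3)) hne
      · exact ⟨a1.trans a1'.symm, a2.trans a2'.symm⟩
    · rw [h1, h1'] at he
      obtain ⟨rfl, rfl, rfl⟩ := ooc_cr_inj he
      rw [hb] at h2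
      exfalso; apply hxy
      have := h2.symm.trans h2'
      linear_combination -this
    · rw [h1, h1'] at he; exact absurd he ooc_cr_ne_inf
    · rw [h1, h1'] at he; exact absurd he ooc_cr_ne_inf
  · rcases F' with ⟨i', p', hb1', hk', h1'⟩ | ⟨i', x', y', z', hxy', h1', h2', h3'⟩ |
      ⟨i', x', z', h1', h2', h3'⟩ | ⟨a', i', x', hb1', ⟨_, h1', _⟩ | ⟨_, h1', _⟩⟩
    · rw [h1, h1'] at he; exact absurd he ooc_cr_ne_hz
    · rw [h1, h1'] at he
      obtain ⟨rfl, rfl, rfl⟩ := ooc_cr_inj he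
      rw [hb] at h2
      exfalso; apply hxy'
      have := h2.symm.trans h2'
      linear_combination this
    · rw [h1, h1'] at he
      obtain ⟨rfl, rfl, rfl⟩ := ooc_cr_inj he
      rcases h3 with ⟨e, e1, e2, e3, e4⟩ | ⟨a, e1, e2, e3⟩ <;>
        rcases h3' with ⟨e', e1', e2', e3', e4'⟩ | ⟨a', e1', e2', e3'⟩
      · subst e2
        subst e2'
        have := d1 e e' k' (e3.symm.trans e3') (e4.symm.trans e4')
        subst this
        exact ⟨e1.trans e1'.symm, rfl⟩
      · subst e2
        exact absurd (by rw [← e4, ← e3, e3']) (d3 e a' k)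
      · subst e2'
        exact absurd (by rw [← e4', ← e3', e3]) (d3 e' a k')
      · have := d2 a a' i x (e3.symm.trans e3')
        subst this
        exact ⟨e1.trans e1'.symm, e2.trans e2'.symm⟩
    · rw [h1, h1'] at he; exact absurd he ooc_cr_ne_inf
    · rw [h1, h1'] at he; exact absurd he ooc_cr_ne_inf
  · rcases F' with ⟨i', p', hb1', hk', h1'⟩ | ⟨i', x', y', z', hxy', h1', h2', h3'⟩ |
      ⟨i', x', z', h1', h2', h3'⟩ | ⟨a', i', x', hb1', h1'⟩
    · rcases h1 with ⟨_, h1, _⟩ | ⟨_, h1, _⟩ <;>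
      · rw [h1, h1'] at he; exact absurd he.symm ooc_hz_ne_inf
    · rcases h1 with ⟨_, h1, _⟩ | ⟨_, h1, _⟩ <;>
      · rw [h1, h1'] at he; exact absurd he.symm ooc_cr_ne_inf
    · rcases h1 with ⟨_, h1, _⟩ | ⟨_, h1, _⟩ <;>
      · rw [h1, h1'] at he; exact absurd he.symm ooc_cr_ne_inf
    · rcases h1 with ⟨e1, e2, e3⟩ | ⟨e1, e2, e3⟩ <;> rcases h1' with ⟨e1', e2', e3'⟩ | ⟨e1', e2', e3'⟩
      · rw [e2, e2'] at he
        obtain ⟨rfl, hi, hx⟩ := ooc_inf_inj he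
        obtain rfl := add_right_cancel hi
        obtain rfl := hginj _ _ hx
        exact ⟨hb1.trans hb1'.symm, e1.trans e1'.symm⟩
      · rw [e3, e3'] at hb; exact absurd hb (by decide)
      · rw [e3, e3'] at hb; exact absurd hb (by decide)
      · rw [e2, e2'] at he
        obtain ⟨rfl, rfl, rfl⟩ := ooc_inf_inj he
        exact ⟨hb1.trans hb1'.symm, e1.trans e1'.symm⟩

lemma ooc_v_inj (b : OBl n j T) : Function.Injective (ooc_v f c t g b) := by
  rcases b with ⟨i, ⟨x, y⟩, h⟩ | e | ⟨a, i, x⟩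
  · have h' : x ≠ y := h
    intro k k' hk
    fin_cases k <;> fin_cases k' <;>
      simp [ooc_v, h', h'.symm] at hk ⊢
  · intro k k' hk
    simp only [ooc_v, Sum.inl.injEq, Prod.mk.injEq] at hk
    exact hk.1
  · intro k k' hk
    fin_cases k <;> fin_cases k' <;>
      simp [ooc_v] at hk ⊢

lemma ooc_conn [NeZero n]
    (hc0 : ∀ i, c i ≠ 0) (hgen : ∀ i w, ∃ k : ℕ, w = k • c i)
    (hT : ∀ e k, f (t e (k + 1)) = t e k + t e k ∨ f (t e (k + 1)) = t e k + t e k + c k)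
    (hG : ∀ a i x, f (g a i x) = x + x ∨ f (g a i x) = x + x + c i)
    (hne : Nonempty T ∨ 0 < j) (b0 b1 : OBl n j T) :
    Relation.ReflTransGen
      (fun b b' => ∃ k k', ooc_edge f c t g b k = ooc_edge f c t g b' k') b0 b1 := by
  set R : OBl n j T → OBl n j T → Prop :=
    fun b b' => ∃ k k', ooc_edge f c t g b k = ooc_edge f c t g b' k' with hR
  have hsym : ∀ {b b'}, Relation.ReflTransGen R b b' → Relation.ReflTransGen R b' b := by
    intro b b' h
    induction h with
    | refl => exact .refl
    | tail _ h ih =>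
      obtain ⟨k, k', hk⟩ := h
      exact (Relation.ReflTransGen.single ⟨k', k, hk.symm⟩).trans ih
  have hone : ∀ {b b' : OBl n j T} (k k'), ooc_edge f c t g b k = ooc_edge f c t g b' k' →
      Relation.ReflTransGen R b b' := fun k k' h => Relation.ReflTransGen.single ⟨k, k', h⟩
  have htr : ∀ {b b' bb}, Relation.ReflTransGen R b b' → Relation.ReflTransGen R b' bb →
    Relation.ReflTransGen R b bb := fun h h' => h.trans h'
  let L : (i : Fin 3) → (x y : ZMod n) → x ≠ y → OBl n j T := fun i x y h => Sum.inl (i, ⟨(x, y), h⟩)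
  have C0 : ∀ i x y (h : x ≠ y), Relation.ReflTransGen R (L i x y h) (L i y x h.symm) := by
    intro i x y h
    exact hone 0 0 Sym2.eq_swap
  have C1 : ∀ i x y (h : x ≠ y) (e : ZMod 2), ∃ b k, Relation.ReflTransGen R (L i x y h) b ∧
      ooc_edge f c t g b k = ooc_cr j i x (f.symm (x + y + ooc_sh e (c i))) := by
    intro i x y h e
    rcases ooc_eps_cases x y h e with rfl | rfl
    · exact ⟨L i x y h, 2, Relation.ReflTransGen.refl, Sym2.eq_swap⟩
    · refine ⟨L i y x h.symm, 1, C0 i x y h, ?_⟩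
      rw [add_comm x y]
      rfl
  have C2 : ∀ i x y (h : x ≠ y) (h' : x ≠ y + c i),
      Relation.ReflTransGen R (L i x y h) (L i x (y + c i) h') := by
    intro i x y h h'
    obtain ⟨b, k, hb, he⟩ := C1 i x y h 1
    obtain ⟨b', k', hb', he'⟩ := C1 i x (y + c i) h' 0
    refine htr hb (htr (hone k k' ?_) (hsym hb'))
    rw [he, he']
    simp [ooc_sh, add_assoc]
  have C3' : ∀ i x (k : ℕ) (h : x ≠ x + k • c i) (h' : x ≠ x + c i),
      Relation.ReflTransGen R (L i x (x + c i) h') (L i x (x + k • c i) h) := by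
    intro i x k
    induction k with
    | zero => intro h _; simp at h
    | succ k ih =>
      intro h h'
      by_cases hk : k • c i = 0
      · have : x + (k + 1) • c i = x + c i := by rw [add_smul, hk, zero_add, one_smul]
        simp only [this]
        exact Relation.ReflTransGen.refl
      · have h1 : x ≠ x + k • c i := fun h2 => hk (left_eq_add.1 h2)
        have e : x + (k + 1) • c i = x + k • c i + c i := by rw [add_smul, one_smul, add_assoc]
        simp only [e] at h ⊢
        exact htr (ih h1 h') (C2 i x _ h1 h)
  have C3 : ∀ i x y y' (h : x ≠ y) (h' : x ≠ y'), Relation.ReflTransGen R (L i x y h) (L i x y' h') := by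
    have : ∀ i x y (h : x ≠ y) (h1 : x ≠ x + c i),
        Relation.ReflTransGen R (L i x (x + c i) h1) (L i x y h) := by
      intro i x y h h1
      obtain ⟨k, hk⟩ := hgen i (y - x)
      have hy : y = x + k • c i := by rw [← hk]; ring
      subst hy
      exact C3' i x k h h1
    intro i x y y' h h'
    have h1 : x ≠ x + c i := fun h2 => hc0 i (left_eq_add.1 h2)
    exact htr (hsym (this i x y h h1)) (this i x y' h' h1)
  have C4 : ∀ i x y x' y' (h : x ≠ y) (h' : x' ≠ y'),
      Relation.ReflTransGen R (L i x y h) (L i x' y' h') := by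
    intro i x y x' y' h h'
    by_cases hx : x' = y
    · subst hx
      exact htr (C0 i x x' h) (C3 i x' x y' h.symm h')
    · exact htr (C0 i x y h) (htr (C3 i y x x' h.symm (Ne.symm hx)) (htr (C0 i y x' (Ne.symm hx))
        (C3 i x' y y' hx h')))
  have C5 : ∀ (b : OBl n j T) k i x z, ooc_edge f c t g b k = ooc_cr j i x z →
      (f z = x + x ∨ f z = x + x + c i) → ∀ x' y' (h : x' ≠ y'),
      Relation.ReflTransGen R b (L i x' y' h) := by
    intro b k i x z hb hz x' y' h
    rcases hz with hz | hz
    · have h1 : x ≠ x - c i := fun h2 => hc0 i (by linear_combination h2)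
      obtain ⟨b', k', hb', he'⟩ := C1 i x (x - c i) h1 1
      refine htr (hone k k' ?_) (htr (hsym hb') (C4 _ _ _ _ _ _ _))
      rw [hb, he']
      congr 1
      rw [← f.symm_apply_apply z, hz]
      congr 1
      simp [ooc_sh, add_assoc]
    · have h1 : x ≠ x + c i := fun h2 => hc0 i (left_eq_add.1 h2)
      obtain ⟨b', k', hb', he'⟩ := C1 i x (x + c i) h1 0
      refine htr (hone k k' ?_) (htr (hsym hb') (C4 _ _ _ _ _ _ _))
      rw [hb, he']
      congr 1
      rw [← f.symm_apply_apply z, hz]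
      congr 1
      simp [ooc_sh, add_assoc]
  have C6 : ∀ i x y x' y' (h : x ≠ y) (h' : x' ≠ y'),
      Relation.ReflTransGen R (L i x y h) (L (i + 1) x' y' h') := by
    intro i x y x' y' h h'
    rcases hne with ⟨⟨e⟩⟩ | hj
    · exact htr (hsym (C5 (Sum.inr (Sum.inl e)) i i _ _ rfl (hT e i) x y h))
        (C5 (Sum.inr (Sum.inl e)) (i + 1) (i + 1) _ _ rfl (hT e (i + 1)) x' y' h')
    · have a : Fin j := ⟨0, hj⟩
      refine htr (hsym (C5 (Sum.inr (Sum.inr (a, i, 0))) 0 i _ _ rfl (hG a i 0) x y h))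
        (htr (hone 1 2 ?_) (C5 (Sum.inr (Sum.inr (a, i + 1, g a i 0))) 0 (i + 1) _ _ rfl
          (hG a (i + 1) _) x' y' h'))
      exact Sym2.eq_swap
  have h01 : (0 : ZMod n) ≠ 0 + c 0 := by rw [zero_add]; exact (hc0 0).symm
  have C7 : ∀ i x y (h : x ≠ y), Relation.ReflTransGen R (L i x y h) (L 0 0 (0 + c 0) h01) := by
    intro i x y h
    have hi : i = 0 ∨ i = 1 ∨ i = 2 := by revert i; decide
    rcases hi with rfl | rfl | rfl
    · exact C4 _ _ _ _ _ _ _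
    · exact htr (C6 1 x y x y h h) (C6 2 x y _ _ h _)
    · exact C6 2 x y _ _ h _
  have C8 : ∀ b : OBl n j T, Relation.ReflTransGen R b (L 0 0 (0 + c 0) h01) := by
    rintro (⟨i, ⟨x, y⟩, h⟩ | e | ⟨a, i, x⟩)
    · exact C7 i x y h
    · exact C5 (Sum.inr (Sum.inl e)) 0 0 _ _ rfl (hT e 0) _ _ _
    · exact htr (C5 (Sum.inr (Sum.inr (a, i, x))) 0 i _ _ rfl (hG a i x) _ _ h01) (C7 i _ _ _)
  exact htr (C8 b0) (hsym (C8 b1))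

end design

theorem ooc_construct {n j : ℕ} {T : Type} [Fintype T] [DecidableEq T] [NeZero n]
    (f : ZMod n ≃ ZMod n) (c : Fin 3 → ZMod n)
    (t : T → Fin 3 → ZMod n) (g : Fin j → Fin 3 → ZMod n → ZMod n)
    (hc0 : ∀ i, c i ≠ 0) (hgen : ∀ i w, ∃ k : ℕ, w = k • c i)
    (hT : ∀ e k, f (t e (k + 1)) = t e k + t e k ∨ f (t e (k + 1)) = t e k + t e k + c k)
    (hG : ∀ a i x, f (g a i x) = x + x ∨ f (g a i x) = x + x + c i)
    (hginj : ∀ a i, Function.Injective (g a i))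
    (d1 : ∀ e e' k, t e k = t e' k → t e (k + 1) = t e' (k + 1) → e = e')
    (d2 : ∀ a a' i x, g a i x = g a' i x → a = a')
    (d3 : ∀ e a k, t e (k + 1) ≠ g a k (t e k))
    (hne : Nonempty T ∨ 0 < j) (N : ℕ) (hN : N = 3 * (n * n - n) + (Fintype.card T + 3 * n * j)) :
    ∃ C : Finset (Finset (Fin (3 * n + j) × ZMod 2)), IsOOC (3 * n + j) 2 3 1 C ∧
      C.card = if N % 4 = 0 then N else N - 1 := by
  classical
  have hcard : Fintype.card (OBl n j T) = N := by
    have h1 : Fintype.card {p : ZMod n × ZMod n // p.1 ≠ p.2} = n * n - n := by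
      rw [Fintype.card_subtype]
      have := Finset.offDiag_card (Finset.univ : Finset (ZMod n))
      rw [Finset.card_univ, ZMod.card] at this
      rw [← this]
      congr 1
      ext p; simp
    simp only [OBl, Fintype.card_sum, Fintype.card_prod, Fintype.card_fin, ZMod.card, h1]
    rw [hN]; ring
  have hP : Fintype.card (OPt n j) = 3 * n + j := by
    simp [OPt, ZMod.card]
  have h01 : (0 : ZMod n) ≠ c 0 := (hc0 0).symm
  have := code_of_design hP (ooc_v f c t g) (ooc_bit f t g)
    (fun b b' k k' h h' => ooc_slots f c t g hT hG hginj d1 d2 d3 b b' k k' h h')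
    (fun b => ooc_v_inj f c t g b) (Sum.inl (0, ⟨(0, c 0), h01⟩))
    (fun b => ooc_conn f c t g hc0 hgen hT hG hne _ b)
  rwa [hcard] at this

/-- the sizes of the codes, uniformly -/
def ooc_size (N : ℕ) : ℕ := if N % 4 = 0 then N else N - 1

lemma ooc_even_low (q : ℕ) (hq : 0 < q) (x : ZMod (2 * q)) :
    (x + (q : ZMod (2 * q))).val < q ↔ ¬ x.val < q := by
  haveI : NeZero (2 * q) := ⟨by omega⟩
  have hx := x.val_lt
  rw [ZMod.val_add, ZMod.val_natCast_of_lt (by omega)]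
  by_cases h : x.val < q
  · rw [Nat.mod_eq_of_lt (by omega)]; omega
  · rw [Nat.mod_eq_sub_mod (by omega), Nat.mod_eq_of_lt (by omega)]; omega

lemma ooc_even_half (q : ℕ) : (q : ZMod (2 * q)) + (q : ZMod (2 * q)) = 0 := by
  have : ((2 * q : ℕ) : ZMod (2 * q)) = 0 := ZMod.natCast_self _
  push_cast at this
  linear_combination this

lemma ooc_even_half_ne (q : ℕ) (hq : 0 < q) : (q : ZMod (2 * q)) ≠ 0 := by
  haveI : NeZero (2 * q) := ⟨by omega⟩
  intro h
  have := congrArg ZMod.val h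
  rw [ZMod.val_natCast_of_lt (by omega), ZMod.val_zero] at this
  omega

lemma ooc_even_f (q : ℕ) (hq : 0 < q) : ∃ f : ZMod (2 * q) ≃ ZMod (2 * q),
    ∀ z, f z = z + z ∨ f z = z + z + 1 := by
  haveI : NeZero (2 * q) := ⟨by omega⟩
  let F : ZMod (2 * q) → ZMod (2 * q) := fun z =>
    ((if z.val < q then 2 * z.val else 2 * z.val + 1 - 2 * q : ℕ) : ZMod (2 * q))
  have hF : ∀ z, (F z).val = if z.val < q then 2 * z.val else 2 * z.val + 1 - 2 * q := by
    intro z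
    have hz := z.val_lt
    apply ZMod.val_natCast_of_lt
    split_ifs <;> omega
  have hinj : Function.Injective F := by
    intro z w h
    have h1 := congrArg ZMod.val h
    rw [hF, hF] at h1
    have hz := z.val_lt
    have hw := w.val_lt
    apply ZMod.val_injective
    split_ifs at h1 <;> omega
  refine ⟨Equiv.ofBijective F (Finite.injective_iff_bijective.1 hinj), fun z => ?_⟩
  change F z = _ ∨ F z = _
  by_cases h : z.val < q
  · left
    simp only [F, if_pos h]
    push_cast
    rw [ZMod.natCast_zmod_val]; ring
  · right
    simp only [F, if_neg h]
    rw [Nat.cast_sub (by omega), ZMod.natCast_self]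
    push_cast
    rw [ZMod.natCast_zmod_val]; ring

lemma ooc_gen_one (n : ℕ) [NeZero n] (w : ZMod n) : ∃ k : ℕ, w = k • (1 : ZMod n) :=
  ⟨w.val, by simp⟩

lemma ooc_even (q j : ℕ) (hq : 0 < q) (hj : j < 3) :
    ∃ C : Finset (Finset (Fin (3 * (2 * q) + j) × ZMod 2)), IsOOC (3 * (2 * q) + j) 2 3 1 C ∧
      C.card = ooc_size (3 * (2 * q * (2 * q) - 2 * q) +
        ((2 - j) * (2 * q) + 3 * (2 * q) * j)) := by
  haveI : NeZero (2 * q) := ⟨by omega⟩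
  haveI : Fact (1 < 2 * q) := ⟨by omega⟩
  obtain ⟨f, hf⟩ := ooc_even_f q hq
  obtain ⟨H, hH⟩ : ∃ H : ZMod (2 * q), H = (q : ZMod (2 * q)) := ⟨_, rfl⟩
  have hHH : H + H = 0 := by rw [hH]; exact ooc_even_half q
  have hH0 : H ≠ 0 := by rw [hH]; exact ooc_even_half_ne q hq
  have hlow : ∀ x : ZMod (2 * q), (x + H).val < q ↔ ¬ x.val < q := by
    rw [hH]; exact ooc_even_low q hq
  have hf' : ∀ x, f (x + H) = x + x ∨ f (x + H) = x + x + 1 := by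
    intro x
    have e : x + H + (x + H) = x + x := by linear_combination hHH
    have := hf (x + H)
    rwa [e] at this
  have hc0 : ∀ i : Fin 3, (fun _ => 1 : Fin 3 → ZMod (2 * q)) i ≠ 0 := fun _ => one_ne_zero
  have hgen : ∀ (i : Fin 3) w, ∃ k : ℕ, w = k • (fun _ => 1 : Fin 3 → ZMod (2 * q)) i :=
    fun _ w => ooc_gen_one _ w
  have hshift : ∀ x : ZMod (2 * q), x ≠ x + H := fun x h => hH0 (by linear_combination -h)
  unfold ooc_size
  obtain rfl | rfl | rfl : j = 0 ∨ j = 1 ∨ j = 2 := by omega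
  · let L : ZMod (2 * q) → ZMod (2 * q) := fun x => if x.val < q then x else x + H
    let U : ZMod (2 * q) → ZMod (2 * q) := fun x => if x.val < q then x + H else x
    have hL : ∀ x, L x = x ∨ L x = x + H := by
      intro x; simp only [L]; split_ifs <;> simp
    have hU : ∀ x, U x = x ∨ U x = x + H := by
      intro x; simp only [U]; split_ifs <;> simp
    have hL2 : ∀ x, L x + L x = x + x := by
      intro x; rcases hL x with h | h <;> rw [h]; linear_combination hHH
    have hU2 : ∀ x, U x + U x = x + x := by
      intro x; rcases hU x with h | h <;> rw [h]; linear_combination hHH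
    have hLl : ∀ x, (L x).val < q := by
      intro x; simp only [L]; split_ifs with h
      · exact h
      · exact (hlow x).2 h
    have hUl : ∀ x, ¬ (U x).val < q := by
      intro x; simp only [U]; split_ifs with h
      · rw [hlow]; exact not_not.2 h
      · exact h
    have hLU : ∀ x y, L x ≠ U y := fun x y h => hUl y (h ▸ hLl x)
    have hfc : ∀ x y z : ZMod (2 * q), (y = x ∨ y = x + H) → z + z = x + x →
        f y = z + z ∨ f y = z + z + 1 := by
      rintro x y z (rfl | rfl) h2
      · rw [h2]; exact hf _
      · rw [h2]; exact hf' _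
    refine ooc_construct (T := ZMod (2 * q) × Bool) f (fun _ => 1)
      (fun e => if e.2 then ![e.1, e.1 + H, U e.1] else ![e.1, e.1, L e.1])
      (fun a => a.elim0) hc0 hgen ?_ (fun a => a.elim0) (fun a => a.elim0) ?_ (fun a => a.elim0)
      (fun _ a => a.elim0) (Or.inl inferInstance) _ ?_
    · rintro ⟨x, b⟩ k
      cases b
      · fin_cases k
        · exact hfc x x x (Or.inl rfl) rfl
        · exact hfc x (L x) x (hL x) rfl
        · exact hfc x x (L x) (Or.inl rfl) (hL2 x)
      · fin_cases k
        · exact hfc x (x + H) x (Or.inr rfl) rfl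
        · exact hfc x (U x) (x + H) (hU x) (by linear_combination hHH)
        · exact hfc x x (U x) (Or.inl rfl) (hU2 x)
    · rintro ⟨x, b⟩ ⟨y, b'⟩ k h1 h2
      cases b <;> cases b' <;> fin_cases k <;> dsimp at h1 h2
      all_goals first
        | (have : x = y := h1
           subst this; rfl)
        | (have : x = y := h2
           subst this; rfl)
        | (have : x + H = y + H := h1
           have : x = y := by linear_combination this
           subst this; rfl)
        | (exfalso
           have a1 : x = y := h1
           have a2 : x = y + H := h2
           exact hshift y (a1.symm.trans a2))
        | (exfalso
           have a1 : x = y := h1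
           have a2 : x + H = y := h2
           exact hshift x (a1.trans a2.symm))
        | exact absurd h2 (hLU _ _)
        | exact absurd h2.symm (hLU _ _)
        | exact absurd h1 (hLU _ _)
        | exact absurd h1.symm (hLU _ _)
    · simp [ZMod.card, mul_comm]
  · refine ooc_construct (T := ZMod (2 * q)) f (fun _ => 1)
      (fun e _ => e) (fun _ _ x => x + H) hc0 hgen (fun e _ => hf e) (fun _ _ x => hf' x)
      (fun _ _ => add_left_injective H) (fun _ _ _ h _ => h) (fun _ _ _ _ _ => Subsingleton.elim _ _)
      (fun e _ _ => hshift e) (Or.inr (by norm_num)) _ ?_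
    simp [ZMod.card]
  · refine ooc_construct (T := Empty) f (fun _ => 1)
      (fun e => e.elim) (fun a _ x => if a = 0 then x else x + H) hc0 hgen (fun e => e.elim) ?_ ?_
      (fun e => e.elim) ?_ (fun e => e.elim) (Or.inr (by norm_num)) _ ?_
    · intro a i x
      split_ifs
      · exact hf x
      · exact hf' x
    · intro a i
      split_ifs
      · exact Function.injective_id
      · exact add_left_injective H
    · intro a a' i x h
      fin_cases a <;> fin_cases a' <;> simp at h ⊢
      · exact hH0 h
      · exact hH0 h
    · simp

lemma ooc_odd (q j : ℕ) (hq : 0 < q) (hj : j < 3) :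
    ∃ C : Finset (Finset (Fin (3 * (2 * q + 1) + j) × ZMod 2)),
      IsOOC (3 * (2 * q + 1) + j) 2 3 1 C ∧
      C.card = ooc_size (3 * ((2 * q + 1) * (2 * q + 1) - (2 * q + 1)) +
        ((2 - j) * (2 * q + 1) + 3 * (2 * q + 1) * j)) := by
  haveI : Fact (1 < 2 * q + 1) := ⟨by omega⟩
  obtain ⟨h, hh⟩ : ∃ h : ZMod (2 * q + 1), 2 * h = 1 := by
    refine ⟨((q + 1 : ℕ) : ZMod (2 * q + 1)), ?_⟩
    have : ((2 * q + 1 : ℕ) : ZMod (2 * q + 1)) = 0 := ZMod.natCast_self _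
    push_cast at this ⊢
    linear_combination this
  have h1 : (1 : ZMod (2 * q + 1)) ≠ 0 := one_ne_zero
  have hh0 : h ≠ 0 := by
    intro e; rw [e] at hh; exact h1 (by linear_combination -hh)
  have h2 : (2 : ZMod (2 * q + 1)) ≠ 0 := by
    intro e; rw [e] at hh; exact h1 (by linear_combination -hh)
  let f : ZMod (2 * q + 1) ≃ ZMod (2 * q + 1) :=
    ⟨fun z => 2 * z, fun z => h * z, fun z => by
      show h * (2 * z) = z
      linear_combination z * hh, fun z => by
      show 2 * (h * z) = z
      linear_combination z * hh⟩
  have hf : ∀ z, f z = 2 * z := fun z => rfl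
  let c : Fin 3 → ZMod (2 * q + 1) := ![1, 1, -2]
  have hc0 : ∀ i, c i ≠ 0 := by
    intro i; fin_cases i
    · exact h1
    · exact h1
    · exact neg_ne_zero.2 h2
  have hgen : ∀ i w, ∃ k : ℕ, w = k • c i := by
    intro i w; fin_cases i
    · exact ooc_gen_one _ w
    · exact ooc_gen_one _ w
    · refine ⟨(-(w * h)).val, ?_⟩
      rw [nsmul_eq_mul, ZMod.natCast_zmod_val]
      show w = -(w * h) * (-2)
      linear_combination -w * hh
  have hgx : ∀ i x, f (x + h * c i) = x + x + c i := by
    intro i x; rw [hf]; linear_combination c i * hh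
  have hhc : ∀ i, h * c i ≠ 0 := by
    intro i e
    exact hc0 i (by linear_combination 2 * e - c i * hh)
  unfold ooc_size
  obtain rfl | rfl | rfl : j = 0 ∨ j = 1 ∨ j = 2 := by omega
  · refine ooc_construct (T := ZMod (2 * q + 1) × Bool) f c
      (fun e => if e.2 then ![e.1, e.1 + h, e.1 + 1] else ![e.1, e.1, e.1])
      (fun a => a.elim0) hc0 hgen ?_ (fun a => a.elim0) (fun a => a.elim0) ?_ (fun a => a.elim0)
      (fun _ a => a.elim0) (Or.inl inferInstance) _ ?_
    · rintro ⟨x, b⟩ k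
      cases b
      · left
        fin_cases k
        all_goals
          show f x = x + x
          rw [hf]; ring
      · right
        fin_cases k
        · show f (x + h) = x + x + 1
          rw [hf]; linear_combination hh
        · show f (x + 1) = (x + h) + (x + h) + 1
          rw [hf]; linear_combination -hh
        · show f x = (x + 1) + (x + 1) + (-2)
          rw [hf]; ring
    · rintro ⟨x, b⟩ ⟨y, b'⟩ k e1 e2
      cases b <;> cases b'
      · have : x = y := by fin_cases k <;> exact e1
        rw [this]
      · exfalso
        fin_cases k
        · have a1 : x = y := e1
          have a2 : x = y + h := e2
          exact hh0 (by linear_combination a1 - a2)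
        · have a1 : x = y + h := e1
          have a2 : x = y + 1 := e2
          exact hh0 (by linear_combination a1 - a2 + hh)
        · have a1 : x = y + 1 := e1
          have a2 : x = y := e2
          exact h1 (by linear_combination a2 - a1)
      · exfalso
        fin_cases k
        · have a1 : x = y := e1
          have a2 : x + h = y := e2
          exact hh0 (by linear_combination a2 - a1)
        · have a1 : x + h = y := e1
          have a2 : x + 1 = y := e2
          exact hh0 (by linear_combination a2 - a1 + hh)
        · have a1 : x + 1 = y := e1
          have a2 : x = y := e2
          exact h1 (by linear_combination a1 - a2)
      · have : x = y := by
          fin_cases k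
          · exact e1
          · have a1 : x + h = y + h := e1
            linear_combination a1
          · exact e2
        rw [this]
    · simp [ZMod.card, mul_comm]
  · refine ooc_construct (T := ZMod (2 * q + 1)) f c
      (fun e _ => e) (fun _ i x => x + h * c i) hc0 hgen
      (fun e _ => Or.inl (by rw [hf]; ring)) (fun _ i x => Or.inr (hgx i x))
      (fun _ _ => add_left_injective _) (fun _ _ _ h _ => h) (fun _ _ _ _ _ => Subsingleton.elim _ _)
      (fun e _ i he => hhc i (by linear_combination -he)) (Or.inr (by norm_num)) _ ?_
    simp [ZMod.card]
  · refine ooc_construct (T := Empty) f c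
      (fun e => e.elim) (fun a i x => if a = 0 then x else x + h * c i) hc0 hgen
      (fun e => e.elim) ?_ ?_
      (fun e => e.elim) ?_ (fun e => e.elim) (Or.inr (by norm_num)) _ ?_
    · intro a i x
      split_ifs
      · left; rw [hf]; ring
      · right; exact hgx i x
    · intro a i
      split_ifs
      · exact Function.injective_id
      · exact add_left_injective _
    · intro a a' i x he
      fin_cases a <;> fin_cases a'
      · rfl
      · exfalso
        have he : x = x + h * c i := he
        exact hhc i (by linear_combination -he)
      · exfalso
        have he : x + h * c i = x := he
        exact hhc i (by linear_combination he)
      · rfl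
    · simp

lemma ooc_big (m : ℕ) (hm : 6 ≤ m) :
    ∃ C : Finset (Finset (Fin m × ZMod 2)), IsOOC m 2 3 1 C ∧
      C.card = ooc_size (m * (m - 1) / 3) := by
  obtain ⟨n, j, hj, rfl⟩ : ∃ n j, j < 3 ∧ m = 3 * n + j := ⟨m / 3, m % 3, by omega, by omega⟩
  have hn : 2 ≤ n := by omega
  have hcount : (3 * n + j) * (3 * n + j - 1) / 3 =
      3 * (n * n - n) + ((2 - j) * n + 3 * n * j) := by
    obtain ⟨k, rfl⟩ : ∃ k, n = k + 1 := ⟨n - 1, by omega⟩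
    have e1 : (k + 1) * (k + 1) - (k + 1) = (k + 1) * k := by
      rw [show (k + 1) * (k + 1) = (k + 1) * k + (k + 1) by ring]; simp
    rw [e1, show 3 * (k + 1) + j - 1 = 3 * k + j + 2 by omega]
    obtain rfl | rfl | rfl : j = 0 ∨ j = 1 ∨ j = 2 := by omega
    · rw [show (3 * (k + 1) + 0) * (3 * k + 0 + 2) = 3 * ((k + 1) * (3 * k + 2)) by ring,
        Nat.mul_div_cancel_left _ (by norm_num)]; ring
    · rw [show (3 * (k + 1) + 1) * (3 * k + 1 + 2) = 3 * ((3 * (k + 1) + 1) * (k + 1)) by ring,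
        Nat.mul_div_cancel_left _ (by norm_num)]; ring
    · rw [show (3 * (k + 1) + 2) * (3 * k + 2 + 2) = 2 + 3 * (3 * (k + 1) * k + 6 * (k + 1)) by ring,
        Nat.add_mul_div_left _ _ (by norm_num)]; ring
  rw [hcount]
  obtain ⟨q, rfl | rfl⟩ : ∃ q, n = 2 * q ∨ n = 2 * q + 1 := ⟨n / 2, by omega⟩
  · exact ooc_even q j (by omega) hj
  · exact ooc_odd q j (by omega) hj

lemma ooc_small3 : ∃ C : Finset (Finset (Fin 3 × ZMod 2)), IsOOC 3 2 3 1 C ∧ C.card = 1 :=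
  code_of_labels (P := Fin 3) (by simp) (Finset.univ : Finset (Fin 1)) (fun _ => ![0, 1, 2])
    (fun _ => ![0, 0, 0]) (by decide) (by decide) (by decide)

lemma ooc_small4 : ∃ C : Finset (Finset (Fin 4 × ZMod 2)), IsOOC 4 2 3 1 C ∧ C.card = 4 :=
  code_of_labels (P := Fin 4) (by simp) (Finset.univ : Finset (Fin 4))
    ![![0, 1, 2], ![0, 1, 3], ![0, 2, 3], ![1, 2, 3]]
    ![![0, 0, 0], ![1, 0, 1], ![1, 1, 0], ![1, 0, 1]] (by decide) (by decide) (by decide)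

lemma ooc_small5 : ∃ C : Finset (Finset (Fin 5 × ZMod 2)), IsOOC 5 2 3 1 C ∧ C.card = 5 :=
  code_of_labels (P := Fin 5) (by simp) (Finset.univ : Finset (Fin 5))
    ![![0, 1, 2], ![0, 1, 3], ![0, 2, 3], ![1, 2, 4], ![1, 3, 4]]
    ![![0, 0, 0], ![1, 0, 1], ![1, 1, 0], ![1, 0, 1], ![1, 1, 0]]
    (by decide) (by decide) (by decide)

lemma ooc_empty (m : ℕ) : IsOOC m 2 3 1 ∅ := by
  refine ⟨?_, ?_, ?_⟩ <;> simp

lemma ooc_exists (m : ℕ) (hm : 0 < m) :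
    ∃ C : Finset (Finset (Fin m × ZMod 2)), IsOOC m 2 3 1 C ∧
      C.card = ooc_size (m * (m - 1) / 3) := by
  by_cases h : 6 ≤ m
  · exact ooc_big m h
  · obtain rfl | rfl | rfl | rfl | rfl : m = 1 ∨ m = 2 ∨ m = 3 ∨ m = 4 ∨ m = 5 := by omega
    · exact ⟨∅, ooc_empty 1, rfl⟩
    · exact ⟨∅, ooc_empty 2, rfl⟩
    · exact ooc_small3
    · exact ooc_small4
    · exact ooc_small5

lemma ooc_size_eq (m : ℕ) (hm : 0 < m) : ooc_size (m * (m - 1) / 3) =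
    if m % 12 = 3 ∨ m % 12 = 5 ∨ m % 12 = 6 ∨ m % 12 = 7 ∨
          m % 12 = 8 ∨ m % 12 = 10
        then m * (m - 1) / 3 - 1 else m * (m - 1) / 3 := by
  have h0 : m % 12 < 12 := Nat.mod_lt _ (by norm_num)
  have key : (m * (m - 1)) % 12 = (m % 12 * ((m + 11) % 12)) % 12 := by
    rw [← Nat.mul_mod, show m + 11 = (m - 1) + 12 by omega, Nat.mul_add, Nat.add_mul_mod_self_right]
  unfold ooc_size
  generalize m * (m - 1) = X at key ⊢
  have h1 : (m + 11) % 12 = (m % 12 + 11) % 12 := by omega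
  rw [h1] at key
  generalize m % 12 = r at key h0 ⊢
  interval_cases r <;> norm_num at key ⊢ <;> omega

theorem stmt_17 (m : ℕ) (hm : 0 < m) (Jstar : ℕ)
    (hJ : Jstar = if m % 12 = 3 ∨ m % 12 = 5 ∨ m % 12 = 6 ∨ m % 12 = 7 ∨
          m % 12 = 8 ∨ m % 12 = 10
        then m * (m - 1) / 3 - 1 else m * (m - 1) / 3) :
    (∃ C : Finset (Finset (Fin m × ZMod 2)), IsOOC m 2 3 1 C ∧ C.card = Jstar) ∧
    (∀ C : Finset (Finset (Fin m × ZMod 2)), IsOOC m 2 3 1 C → C.card ≤ Jstar) := by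
  refine ⟨?_, fun C hC => hJ ▸ ooc_upper m C hC⟩
  rw [hJ, ← ooc_size_eq m hm]
  exact ooc_exists m hm
end
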